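/- Let d > 3 and let π be an irreducible non-degenerate permutation of {1,…,d}. Then the set of length vectors L in the simplex Δ_{d−1} such that all entries of L are strictly positive and the interval exchange transformation T_{L,π} is topologically mixing is residual in Δ_{d−1}, i.e., it contains a dense Gδ subset of Δ_{d−1} with its subspace topology from ℝ^d. -/

import Mathlib

open Finset MeasureTheory

namespace IETPaper

/-- The first index `0` of `Fin d` (corresponding to `1` in `{1,…,d}`). -/
def firstIdx (d : ℕ) [NeZero d] : Fin d := ⟨0, Nat.pos_of_ne_zero (NeZero.ne d)⟩

/-- The last index `d-1` of `Fin d` (corresponding to `d` in `{1,…,d}`). -/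
def lastIdx (d : ℕ) [NeZero d] : Fin d :=
  ⟨d - 1, Nat.sub_lt (Nat.pos_of_ne_zero (NeZero.ne d)) one_pos⟩

/-- Left endpoint `l₁ + ⋯ + l_{j-1}` of the `j`-th interval `I_j`. -/
noncomputable def leftEnd {d : ℕ} (L : Fin d → ℝ) (j : Fin d) : ℝ :=
  ∑ k ∈ Finset.univ.filter (fun k => k < j), L k

/-- The interval exchange transformation `T_{L,π}`: on the interval
`I_j = [leftEnd L j, leftEnd L j + L j)` it is the translation
`x ↦ x - ∑_{k < j} l_k + ∑_{π k' < π j} l_{k'}`; elsewhere it is the identity. -/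
noncomputable def ietMap {d : ℕ} (π : Equiv.Perm (Fin d)) (L : Fin d → ℝ) (x : ℝ) : ℝ :=
  if h : ∃ j : Fin d, x ∈ Set.Ico (leftEnd L j) (leftEnd L j + L j) then
    x - leftEnd L h.choose + ∑ k ∈ Finset.univ.filter (fun k => π k < π h.choose), L k
  else x

/-- Topological mixing of `T` on the subspace `X ⊆ ℝ` (with its subspace topology:
open sets of `X` are exactly the sets `U ∩ X` with `U` open in `ℝ`). -/
def TopMixingOn (T : ℝ → ℝ) (X : Set ℝ) : Prop :=
  ∀ U V : Set ℝ, IsOpen U → IsOpen V → (U ∩ X).Nonempty → (V ∩ X).Nonempty →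
    ∃ N : ℕ, ∀ n : ℕ, N ≤ n → ((T^[n] '' (U ∩ X)) ∩ (V ∩ X)).Nonempty

/-- Irreducibility of a permutation: `π {1,…,k} ≠ {1,…,k}` for all `k < d`
(0-indexed: `π` does not preserve `{j | j < k}` for `0 < k < d`). -/
def IsIrreducible {d : ℕ} (π : Equiv.Perm (Fin d)) : Prop :=
  ∀ k : ℕ, 0 < k → k < d →
    (⇑π '' {j : Fin d | (j : ℕ) < k}) ≠ {j : Fin d | (j : ℕ) < k}

/-- A permutation of `{1,…,d}` (written 0-indexed on `Fin d`) is degenerate if for some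
`1 ≤ j < d` (0-indexed: `j + 1 < d`) one of the four listed conditions holds. -/
def IsDegenerate {d : ℕ} (π : Equiv.Perm (Fin d)) : Prop :=
  ∃ j : ℕ, ∃ hj : j + 1 < d,
    ((π ⟨j + 1, hj⟩ : ℕ) = (π ⟨j, by omega⟩ : ℕ) + 1) ∨
    ((π ⟨j, by omega⟩ : ℕ) = d - 1 ∧ (π ⟨j + 1, hj⟩ : ℕ) = 0 ∧
      (π ⟨0, by omega⟩ : ℕ) = (π ⟨d - 1, by omega⟩ : ℕ) + 1) ∨
    ((π ⟨j + 1, hj⟩ : ℕ) = 0 ∧ (π ⟨0, by omega⟩ : ℕ) = (π ⟨j, by omega⟩ : ℕ) + 1) ∨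
    ((π ⟨j + 1, hj⟩ : ℕ) = (π ⟨d - 1, by omega⟩ : ℕ) + 1 ∧ (π ⟨j, by omega⟩ : ℕ) = d - 1)

/-- The Keane condition (idoc): the forward orbits of the interior discontinuities
`δ_i = leftEnd L i` (`i ≠ 0`) are pairwise disjoint infinite sets. -/
def KeaneCondition {d : ℕ} (π : Equiv.Perm (Fin d)) (L : Fin d → ℝ) : Prop :=
  ∀ i j : Fin d, (i : ℕ) ≠ 0 → (j : ℕ) ≠ 0 → ∀ m n : ℕ,
    (ietMap π L)^[m] (leftEnd L i) = (ietMap π L)^[n] (leftEnd L j) → i = j ∧ m = n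

/-- `w` is an allowed block for `T_{L,π}`: some point `x` satisfies
`T^{i+1} x ∈ I_{w i}` for all positions `i` of `w` (i.e. `x ∈ ⋂ T^{-i} I_{a_i}`). -/
def IsAllowedBlock {d : ℕ} (π : Equiv.Perm (Fin d)) (L : Fin d → ℝ)
    (w : List (Fin d)) : Prop :=
  ∃ x : ℝ, ∀ (i : ℕ) (hi : i < w.length),
    (ietMap π L)^[i + 1] x ∈
      Set.Ico (leftEnd L (w.get ⟨i, hi⟩)) (leftEnd L (w.get ⟨i, hi⟩) + L (w.get ⟨i, hi⟩))

/-- `k`-alphabet mixing: there is `N` such that for any two allowed `k`-blocks `u, v`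
and any `n > N` there is an allowed `n`-block beginning with `u` and ending with `v`. -/
def AlphabetMixing {d : ℕ} (π : Equiv.Perm (Fin d)) (L : Fin d → ℝ) (k : ℕ) : Prop :=
  ∃ N : ℕ, ∀ u v : List (Fin d), u.length = k → v.length = k →
    IsAllowedBlock π L u → IsAllowedBlock π L v →
    ∀ n : ℕ, N < n → ∃ w : List (Fin d),
      w.length = n ∧ IsAllowedBlock π L w ∧ u <+: w ∧ v <:+ w

/-- `π'` is obtained from `π` by the Rauzy move of type `a`. -/
def RauzyMoveA {d : ℕ} [NeZero d] (π π' : Equiv.Perm (Fin d)) : Prop :=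
  ∀ j : Fin d,
    ((j : ℕ) ≤ (π.symm (lastIdx d) : ℕ) → π' j = π j) ∧
    ((j : ℕ) = (π.symm (lastIdx d) : ℕ) + 1 → π' j = π (lastIdx d)) ∧
    ((π.symm (lastIdx d) : ℕ) + 1 < (j : ℕ) →
      π' j = π ⟨(j : ℕ) - 1, lt_of_le_of_lt (Nat.sub_le _ _) j.isLt⟩)

/-- `π'` is obtained from `π` by the Rauzy move of type `b`. -/
def RauzyMoveB {d : ℕ} [NeZero d] (π π' : Equiv.Perm (Fin d)) : Prop :=
  ∀ j : Fin d,
    ((π j : ℕ) ≤ (π (lastIdx d) : ℕ) → π' j = π j) ∧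
    ((π (lastIdx d) : ℕ) < (π j : ℕ) → (π j : ℕ) < d - 1 →
      (π' j : ℕ) = (π j : ℕ) + 1) ∧
    ((π j : ℕ) = d - 1 → (π' j : ℕ) = (π (lastIdx d) : ℕ) + 1)

/-- `π` is in the Rauzy class of `π₀`: reachable by finitely many moves `a`, `b`. -/
def InRauzyClass {d : ℕ} [NeZero d] (π₀ π : Equiv.Perm (Fin d)) : Prop :=
  Relation.ReflTransGen (fun p q => RauzyMoveA p q ∨ RauzyMoveB p q) π₀ π

/-- The permutation `(4321)` on `{1,2,3,4}` (0-indexed: `j ↦ 3 - j`). -/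
def perm4321 : Equiv.Perm (Fin 4) := ⟨![3, 2, 1, 0], ![3, 2, 1, 0], by decide, by decide⟩

/-- The permutation `(4213)` on `{1,2,3,4}`: `1↦4, 2↦2, 3↦1, 4↦3`. -/
def perm4213 : Equiv.Perm (Fin 4) := ⟨![3, 1, 0, 2], ![2, 1, 3, 0], by decide, by decide⟩

/-- The combinatorial data of an interval exchange transformation:
a permutation together with a length vector. -/
structure IET (d : ℕ) where
  perm : Equiv.Perm (Fin d)
  len : Fin d → ℝ

/-- The first step of Rauzy induction on `T` is of type `a`, i.e.
`δ_max = δ_+` (equivalently `l_d < l_{π⁻¹ d}`). -/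
def stepA {d : ℕ} [NeZero d] (T : IET d) : Prop :=
  T.len (lastIdx d) < T.len (T.perm.symm (lastIdx d))

/-- The first step of Rauzy induction on `T` is of type `b`, i.e.
`δ_max = δ_-` (equivalently `l_{π⁻¹ d} < l_d`). -/
def stepB {d : ℕ} [NeZero d] (T : IET d) : Prop :=
  T.len (T.perm.symm (lastIdx d)) < T.len (lastIdx d)

/-- The length vector of `R(T)` after a type `a` step (the first return map of `T`
to `[0, δ_+)`, with intervals in their natural order). -/
noncomputable def lenAfterA {d : ℕ} [NeZero d] (π : Equiv.Perm (Fin d))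
    (L : Fin d → ℝ) : Fin d → ℝ := fun j =>
  if (j : ℕ) < (π.symm (lastIdx d) : ℕ) then L j
  else if (j : ℕ) = (π.symm (lastIdx d) : ℕ) then L j - L (lastIdx d)
  else if (j : ℕ) = (π.symm (lastIdx d) : ℕ) + 1 then L (lastIdx d)
  else L ⟨(j : ℕ) - 1, lt_of_le_of_lt (Nat.sub_le _ _) j.isLt⟩

/-- The length vector of `R(T)` after a type `b` step (the first return map of `T`
to `[0, δ_-)`). -/
noncomputable def lenAfterB {d : ℕ} [NeZero d] (π : Equiv.Perm (Fin d))
    (L : Fin d → ℝ) : Fin d → ℝ := fun j =>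
  if j = lastIdx d then L j - L (π.symm (lastIdx d)) else L j

/-- `T'` is the result of one step of Rauzy induction applied to `T`
(`T' = R(T)`, un-rescaled). -/
def IsRauzyStep {d : ℕ} [NeZero d] (T T' : IET d) : Prop :=
  (stepA T ∧ RauzyMoveA T.perm T'.perm ∧ T'.len = lenAfterA T.perm T.len) ∨
  (stepB T ∧ RauzyMoveB T.perm T'.perm ∧ T'.len = lenAfterB T.perm T.len)

/-- The matrix `M(T,1)` of a type `a` step. -/
def matA {d : ℕ} [NeZero d] (π : Equiv.Perm (Fin d)) : Matrix (Fin d) (Fin d) ℤ :=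
  Matrix.of fun i j =>
    if (j : ℕ) ≤ (π.symm (lastIdx d) : ℕ) then (if i = j then 1 else 0)
    else if i = lastIdx d then (if (j : ℕ) = (π.symm (lastIdx d) : ℕ) + 1 then 1 else 0)
    else if (i : ℕ) = (j : ℕ) - 1 then 1 else 0

/-- The matrix `M(T,1)` of a type `b` step. -/
def matB {d : ℕ} [NeZero d] (π : Equiv.Perm (Fin d)) : Matrix (Fin d) (Fin d) ℤ :=
  Matrix.of fun i j =>
    if i = lastIdx d ∧ j = π.symm (lastIdx d) then 1 else if i = j then 1 else 0

open Classical in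
/-- The matrix `M(T,1)` of the first step of Rauzy induction on `T`. -/
noncomputable def stepMat {d : ℕ} [NeZero d] (T : IET d) : Matrix (Fin d) (Fin d) ℤ :=
  if stepA T then matA T.perm else matB T.perm

/-- A run of `n` steps of Rauzy induction: `seq 0 = T`, `seq (i+1) = R(seq i)`
for `i < n`.  `T` admits `n` steps of Rauzy induction iff such a chain starting
at `T` exists. -/
structure RauzyChain (d : ℕ) [NeZero d] (n : ℕ) where
  seq : ℕ → IET d
  step : ∀ i, i < n → IsRauzyStep (seq i) (seq (i + 1))

/-- The matrix `M(R^a(T), m)` of the steps `a, a+1, …, a+m-1` of a chain. -/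
noncomputable def chainMatrixFrom {d n : ℕ} [NeZero d] (c : RauzyChain d n)
    (a m : ℕ) : Matrix (Fin d) (Fin d) ℤ :=
  ((List.range m).map fun i => stepMat (c.seq (a + i))).prod

/-- The matrix `M(T, m)` of the first `m` steps of a chain starting at `T`. -/
noncomputable def chainMatrix {d n : ℕ} [NeZero d] (c : RauzyChain d n)
    (m : ℕ) : Matrix (Fin d) (Fin d) ℤ :=
  chainMatrixFrom c 0 m

/-- `|C_j(M)|`, the sum of the entries of the `j`-th column of `M`. -/
def colSum {d : ℕ} (M : Matrix (Fin d) (Fin d) ℤ) (j : Fin d) : ℤ := ∑ i, M i j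

/-- `M_Δ = M ℝ₊^d ∩ Δ̊_{d-1}`: positive vectors of the cone of `M` lying in the
interior of the standard simplex. -/
def matSimplex {d : ℕ} (M : Matrix (Fin d) (Fin d) ℤ) : Set (Fin d → ℝ) :=
  {L | (∃ v : Fin d → ℝ, (∀ i, 0 ≤ v i) ∧ L = (M.map (Int.cast : ℤ → ℝ)).mulVec v) ∧
       (∀ i, 0 < L i) ∧ ∑ i, L i = 1}

/-- `u^n`, the `n`-fold concatenation of the word `u` with itself. -/
def wpow {α : Type*} (u : List α) (n : ℕ) : List α := (List.replicate n u).flatten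

section
variable {d : ℕ}

/-- Left endpoint of the interval labelled `j` when the intervals of lengths `v` are placed in the
order given by the positions `t`. -/
def lo {M : Type*} [AddCommMonoid M] (t : Equiv.Perm (Fin d)) (v : Fin d → M) (j : Fin d) : M :=
  ∑ k ∈ univ.filter (fun k => t k < t j), v k

lemma lo_first {M : Type*} [AddCommMonoid M] {t : Equiv.Perm (Fin d)} (v : Fin d → M) {j : Fin d}
    (h : (t j : ℕ) = 0) : lo t v j = 0 := by
  unfold lo
  rw [Finset.filter_false_of_mem, Finset.sum_empty]
  intro k _ hk
  have := Fin.lt_def.1 hk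
  omega

lemma lo_succ {M : Type*} [AddCommMonoid M] {t : Equiv.Perm (Fin d)} (v : Fin d → M) {x y : Fin d}
    (h : (t y : ℕ) = t x + 1) : lo t v y = lo t v x + v x := by
  unfold lo
  have : univ.filter (fun k => t k < t y) = insert x (univ.filter (fun k => t k < t x)) := by
    ext k
    simp only [mem_filter, mem_univ, true_and, mem_insert, Fin.lt_def]
    have : k = x ↔ (t k : ℕ) = t x := by rw [← Fin.ext_iff, t.injective.eq_iff]
    rw [this]; omega
  rw [this, Finset.sum_insert (by simp), add_comm]

lemma lo_last {M : Type*} [AddCommMonoid M] {t : Equiv.Perm (Fin d)} (v : Fin d → M) {x : Fin d}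
    (h : (t x : ℕ) + 1 = d) : lo t v x + v x = ∑ k, v k := by
  unfold lo
  have : (univ : Finset (Fin d)) = insert x (univ.filter (fun k => t k < t x)) := by
    ext k
    simp only [mem_filter, mem_univ, true_and, mem_insert, Fin.lt_def]
    have h1 : k = x ↔ (t k : ℕ) = t x := by rw [← Fin.ext_iff, t.injective.eq_iff]
    have := (t k).isLt
    rw [h1]; simp only [true_iff]; omega
  conv_rhs => rw [this]
  rw [Finset.sum_insert (by simp), add_comm]

lemma lo_neg {M : Type*} [AddCommGroup M] (t : Equiv.Perm (Fin d)) (v : Fin d → M) (j : Fin d) :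
    lo t (fun k => - v k) j = - lo t v j := Finset.sum_neg_distrib _

lemma lo_nonneg {t : Equiv.Perm (Fin d)} {v : Fin d → ℝ} (hv : ∀ j, 0 ≤ v j) (j : Fin d) :
    0 ≤ lo t v j := Finset.sum_nonneg fun k _ => hv k

lemma lo_add_le {t : Equiv.Perm (Fin d)} {v : Fin d → ℝ} (hv : ∀ j, 0 ≤ v j) {x y : Fin d}
    (h : t x < t y) : lo t v x + v x ≤ lo t v y := by
  unfold lo
  rw [add_comm, ← Finset.sum_insert (a := x) (by simp)]
  apply Finset.sum_le_sum_of_subset_of_nonneg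
  · intro k
    simp only [mem_filter, mem_univ, true_and, mem_insert]
    rintro (rfl | hk)
    · exact h
    · exact hk.trans h
  · intro i _ _; exact hv i

lemma lo_add_le_sum {t : Equiv.Perm (Fin d)} {v : Fin d → ℝ} (hv : ∀ j, 0 ≤ v j) (x : Fin d) :
    lo t v x + v x ≤ ∑ k, v k := by
  unfold lo
  rw [add_comm, ← Finset.sum_insert (a := x) (by simp)]
  apply Finset.sum_le_sum_of_subset_of_nonneg (subset_univ _)
  intro i _ _; exact hv i

lemma exists_mem_interval {t : Equiv.Perm (Fin d)} {v : Fin d → ℝ} {x : ℝ}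
    (h0 : 0 ≤ x) (h1 : x < ∑ k, v k) : ∃ j, lo t v j ≤ x ∧ x < lo t v j + v j := by
  by_contra! hc
  have key : ∀ n : ℕ, ∀ j : Fin d, (t j : ℕ) = n → lo t v j + v j ≤ x := by
    intro n
    induction n with
    | zero =>
      intro j hj
      exact hc j (by rw [lo_first v hj]; exact h0)
    | succ n ih =>
      intro j hj
      have hn : n < d := by have := (t j).isLt; omega
      have := ih (t.symm ⟨n, hn⟩) (by simp)
      refine hc j ?_
      rw [lo_succ v (x := t.symm ⟨n, hn⟩) (by simp [hj])]
      exact this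
  rcases Nat.eq_zero_or_pos d with hd | hd
  · subst hd; simp at h1; linarith
  · have := key (d-1) (t.symm ⟨d-1, by omega⟩) (by simp)
    rw [lo_last v (by simp; omega)] at this
    linarith

lemma interval_unique {t : Equiv.Perm (Fin d)} {v : Fin d → ℝ} (hv : ∀ j, 0 ≤ v j) {x : ℝ}
    {i j : Fin d} (hi : lo t v i ≤ x) (hi' : x < lo t v i + v i) (hj : lo t v j ≤ x)
    (hj' : x < lo t v j + v j) : i = j := by
  by_contra hne
  rcases lt_or_gt_of_ne (fun h => hne (t.injective h) : t i ≠ t j) with h | h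
  · linarith [lo_add_le hv h]
  · linarith [lo_add_le hv h]

/-- `Walk t b L h x m y`: following the interval exchange with rows `t`, `b` and lengths `L`,
the point `x` reaches `y`, and the heights `h` of the intervals met on the way add up to `m`. -/
inductive Walk (t b : Equiv.Perm (Fin d)) (L : Fin d → ℝ) (h : Fin d → ℕ) : ℝ → ℕ → ℝ → Prop
  | nil (x : ℝ) : Walk t b L h x 0 x
  | cons {x : ℝ} {m : ℕ} {y : ℝ} (j : Fin d) (h1 : lo t L j ≤ x) (h2 : x < lo t L j + L j)
      (hw : Walk t b L h (x - lo t L j + lo b L j) m y) : Walk t b L h x (h j + m) y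

namespace Walk
variable {t b t' b' : Equiv.Perm (Fin d)} {L L' : Fin d → ℝ} {h h' : Fin d → ℕ}

lemma append {x y z : ℝ} {m n : ℕ} (hw : Walk t b L h x m y) (hw' : Walk t b L h y n z) :
    Walk t b L h x (m + n) z := by
  induction hw with
  | nil x => simpa using hw'
  | cons j h1 h2 _ ih => rw [add_assoc]; exact cons j h1 h2 (ih hw')

lemma single (j : Fin d) {x y : ℝ} (h1 : lo t L j ≤ x) (h2 : x < lo t L j + L j)
    (hy : y = x - lo t L j + lo b L j) : Walk t b L h x (h j) y := by
  subst hy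
  have := cons (b := b) (h := h) j h1 h2 (nil _)
  simpa using this

lemma cast {x y x' y' : ℝ} {m m' : ℕ} (hw : Walk t b L h x m y) (hx : x = x') (hm : m = m')
    (hy : y = y') : Walk t b L h x' m' y' := by
  subst hx hm hy; exact hw

lemma swap {x y : ℝ} {m : ℕ} (hw : Walk t b L h x m y) : Walk b t L h y m x := by
  induction hw with
  | nil x => exact nil x
  | @cons x m y j h1 h2 _ ih =>
    rw [add_comm]
    refine ih.append (single j ?_ ?_ ?_) <;> linarith

lemma lift {x y : ℝ} {m : ℕ} (hw : Walk t' b' L' h' x m y)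
    (H : ∀ j x, lo t' L' j ≤ x → x < lo t' L' j + L' j →
      Walk t b L h x (h' j) (x - lo t' L' j + lo b' L' j)) : Walk t b L h x m y := by
  induction hw with
  | nil x => exact nil x
  | cons j h1 h2 _ ih => exact (H j _ h1 h2).append ih

end Walk

/-- The bottom row `b'` is obtained from `b` by moving the last letter `β` just after `α`,
where `α` is the last letter of the top row `t`. -/
structure TopWin (t b b' : Equiv.Perm (Fin d)) (α β : Fin d) : Prop where
  ne : α ≠ β
  top_last : (t α : ℕ) + 1 = d
  bot_last : (b β : ℕ) + 1 = d
  le : ∀ j, b j ≤ b α → b' j = b j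
  mid : (b' β : ℕ) = b α + 1
  gt : ∀ j, j ≠ β → b α < b j → (b' j : ℕ) = b j + 1

/-- Subtract the entry at `l` from the entry at `w`. -/
def red {M : Type*} [AddCommGroup M] (v : Fin d → M) (w l : Fin d) : Fin d → M :=
  fun j => v j - if j = w then v l else 0

/-- Add the entry at `w` to the entry at `l`. -/
def inc (h : Fin d → ℕ) (w l : Fin d) : Fin d → ℕ := fun j => h j + if j = l then h w else 0

namespace TopWin
variable {t b b' : Equiv.Perm (Fin d)} {α β : Fin d}

lemma lo_top {M : Type*} [AddCommGroup M] (H : TopWin t b b' α β) (v : Fin d → M) (j : Fin d) :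
    lo t (red v α β) j = lo t v j := by
  unfold lo red
  refine Finset.sum_congr rfl fun k hk => ?_
  rw [if_neg, sub_zero]
  rintro rfl
  have := Fin.lt_def.1 (mem_filter.1 hk).2
  have := H.top_last
  have := (t j).isLt
  omega

lemma bα_lt (H : TopWin t b b' α β) : (b α : ℕ) < b β := by
  have h1 := (b α).isLt
  have h2 := H.bot_last
  have h3 : (b α : ℕ) ≠ b β := fun h => H.ne (b.injective (Fin.ext h))
  omega

lemma lo_bot {M : Type*} [AddCommGroup M] (H : TopWin t b b' α β) (v : Fin d → M) {j : Fin d}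
    (hj : j ≠ β) : lo b' (red v α β) j = lo b v j := by
  have hβ := H.bot_last
  have hα := H.bα_lt
  have hm := H.mid
  have hjlt : (b j : ℕ) < b β := by
    have h1 := (b j).isLt
    have h3 : (b j : ℕ) ≠ b β := fun h => hj (b.injective (Fin.ext h))
    omega
  unfold lo red
  rw [Finset.sum_sub_distrib, Finset.sum_ite_eq']
  rcases le_or_gt (b j) (b α) with h | h
  · have hs : univ.filter (fun k => b' k < b' j) = univ.filter (fun k => b k < b j) := by
      ext k
      simp only [mem_filter, mem_univ, true_and, Fin.lt_def]
      have hj' := H.le j h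
      rw [hj']
      by_cases hkβ : k = β
      · subst hkβ; rw [Fin.le_def] at h; omega
      · rcases le_or_gt (b k) (b α) with h' | h'
        · rw [H.le k h']
        · rw [H.gt k hkβ h']; rw [Fin.le_def] at h; rw [Fin.lt_def] at h'; omega
    rw [hs, if_neg, sub_zero]
    simp only [mem_filter, mem_univ, true_and, not_lt]; exact h
  · have hj' := H.gt j hj h
    have hs : univ.filter (fun k => b' k < b' j) = insert β (univ.filter (fun k => b k < b j)) := by
      ext k
      simp only [mem_filter, mem_univ, true_and, mem_insert, Fin.lt_def]
      rw [Fin.lt_def] at h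
      by_cases hkβ : k = β
      · subst hkβ; simp only [true_or, iff_true]; omega
      · rcases le_or_gt (b k) (b α) with h' | h'
        · rw [H.le k h']; rw [Fin.le_def] at h'; simp only [hkβ, false_or]; omega
        · rw [H.gt k hkβ h']; simp only [hkβ, false_or]; omega
    rw [hs, if_pos, Finset.sum_insert]
    · abel
    · simp only [mem_filter, mem_univ, true_and, Fin.lt_def]; omega
    · simp only [mem_insert, mem_filter, mem_univ, true_and]; right; exact h

lemma lo_bot_loser {M : Type*} [AddCommGroup M] (H : TopWin t b b' α β) (v : Fin d → M) :
    lo b' (red v α β) β = lo b v α + (v α - v β) := by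
  have hα := H.bα_lt
  rw [lo_succ (x := α) (red v α β) (by rw [H.mid, H.le α le_rfl]), H.lo_bot v H.ne]
  simp [red]

lemma walk {L : Fin d → ℝ} {h : Fin d → ℕ} (H : TopWin t b b' α β) (hβ : 0 ≤ L β)
    (hαβ : L β ≤ L α) {x y : ℝ} {m : ℕ} (hw : Walk t b' (red L α β) (inc h α β) x m y) :
    Walk t b L h x m y := by
  refine hw.lift fun j x h1 h2 => ?_
  rw [H.lo_top] at h1 h2 ⊢
  by_cases hj : j = β
  · subst hj
    have hj' : red L α j j = L j := by simp [red, H.ne.symm]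
    rw [hj'] at h2
    rw [H.lo_bot_loser]
    have e1 := lo_last L H.top_last
    have e2 := lo_last L H.bot_last
    have : inc h α j j = h j + h α := by simp [inc]
    rw [this]
    refine (Walk.single j h1 h2 rfl).append (Walk.single α ?_ ?_ ?_) <;> linarith
  · rw [H.lo_bot L hj]
    have : inc h α β j = h j := by simp [inc, hj]
    rw [this]
    refine Walk.single j h1 ?_ rfl
    have : red L α β j ≤ L j := by
      unfold red; split_ifs <;> linarith
    linarith

end TopWin

/-- An elementary Rauzy move with winner `w` and loser `l`. -/
def Mv (t b t' b' : Equiv.Perm (Fin d)) (w l : Fin d) : Prop :=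
  (t' = t ∧ TopWin t b b' w l) ∨ (b' = b ∧ TopWin b t t' w l)

lemma Mv.swap {t b t' b' : Equiv.Perm (Fin d)} {w l : Fin d} (H : Mv t b t' b' w l) :
    Mv b t b' t' w l := Or.symm H

lemma Mv.ne {t b t' b' : Equiv.Perm (Fin d)} {w l : Fin d} (H : Mv t b t' b' w l) : w ≠ l := by
  rcases H with ⟨_, h⟩ | ⟨_, h⟩ <;> exact h.ne

lemma Mv.walk {t b t' b' : Equiv.Perm (Fin d)} {w l : Fin d} {L : Fin d → ℝ} {h : Fin d → ℕ}
    (H : Mv t b t' b' w l) (hl : 0 ≤ L l) (hwl : L l ≤ L w) {x y : ℝ} {m : ℕ}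
    (hw : Walk t' b' (red L w l) (inc h w l) x m y) : Walk t b L h x m y := by
  rcases H with ⟨rfl, H⟩ | ⟨rfl, H⟩
  · exact H.walk hl hwl hw
  · exact (H.walk hl hwl hw.swap).swap

/-- Existence of the permutation produced by a move. -/
lemma exists_topWin {t b : Equiv.Perm (Fin d)} {α β : Fin d} (hne : α ≠ β)
    (hα : (t α : ℕ) + 1 = d) (hβ : (b β : ℕ) + 1 = d) : ∃ b', TopWin t b b' α β := by
  have hαβ : (b α : ℕ) < b β := by
    have h1 := (b α).isLt
    have h3 : (b α : ℕ) ≠ b β := fun h => hne (b.injective (Fin.ext h))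
    omega
  have hlt : ∀ j, j ≠ β → (b j : ℕ) + 1 < d := by
    intro j hj
    have h1 := (b j).isLt
    have h3 : (b j : ℕ) ≠ b β := fun h => hj (b.injective (Fin.ext h))
    omega
  let f : Fin d → Fin d := fun j =>
    if h : j = β then ⟨b α + 1, by omega⟩
    else if b j ≤ b α then b j else ⟨b j + 1, hlt j h⟩
  have hinj : Function.Injective f := by
    intro x y hxy
    have hxy' := congrArg Fin.val hxy
    have e : ∀ x y : Fin d, (b x : ℕ) = b y ↔ x = y := fun x y => by
      rw [← Fin.ext_iff, b.injective.eq_iff]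
    simp only [f] at hxy'
    rw [← e]
    by_cases hx : x = β <;> by_cases hy : y = β
    · rw [hx, hy]
    · subst hx; simp only [hy, dite_true, dite_false] at hxy'
      have := hlt y hy
      split_ifs at hxy' with h <;> simp only [Fin.le_def, not_le] at h hxy' <;> omega
    · subst hy; simp only [hx, dite_true, dite_false] at hxy'
      have := hlt x hx
      split_ifs at hxy' with h <;> simp only [Fin.le_def, not_le] at h hxy' <;> omega
    · simp only [hx, hy, dite_false] at hxy'
      split_ifs at hxy' with h h' h' <;> simp only [Fin.le_def, not_le] at h h' hxy' <;> omega
  refine ⟨Equiv.ofBijective f (Finite.injective_iff_bijective.1 hinj), hne, hα, hβ, ?_, ?_, ?_⟩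
  · intro j hj
    have : j ≠ β := by rintro rfl; rw [Fin.le_def] at hj; omega
    simp [f, this, hj]
  · simp [f]
  · intro j hj hj'
    have : ¬ b j ≤ b α := not_le.2 hj'
    simp [f, hj, this]

/-- The entries of `L` are linearly independent over the integers. -/
def RatIndep (L : Fin d → ℝ) : Prop := ∀ u : Fin d → ℤ, ∑ k, (u k : ℝ) * L k = 0 → u = 0

lemma RatIndep.red {L : Fin d → ℝ} (hL : RatIndep L) {w l : Fin d} (hne : w ≠ l) :
    RatIndep (red L w l) := by
  intro u hu
  have h1 : ∑ k, (((u k - if k = l then u w else 0 : ℤ)) : ℝ) * L k = 0 := by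
    rw [← hu]
    simp only [IETPaper.red, mul_sub, Finset.sum_sub_distrib, Int.cast_sub, sub_mul, Int.cast_ite,
      Int.cast_zero, ite_mul, mul_ite, zero_mul, mul_zero, Finset.sum_ite_eq', mem_univ, if_true]
  have h2 := hL _ h1
  have hw : u w = 0 := by
    have := congrFun h2 w
    simpa [hne] using this
  funext k
  have := congrFun h2 k
  simpa [hw] using this

/-- For lengths in an open cone, all sufficiently large times are attained by the suspension with
roof heights `h` over the interval exchange with rows `t`, `b`. -/
def Good (t b : Equiv.Perm (Fin d)) (h : Fin d → ℕ) : Prop :=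
  ∃ O : Set (Fin d → ℝ), IsOpen O ∧ O.Nonempty ∧
    (∀ L ∈ O, ∀ c : ℝ, 0 < c → (fun j => c * L j) ∈ O) ∧ (∀ L ∈ O, ∀ j, 0 < L j) ∧
    ∀ L ∈ O, RatIndep L → ∃ N : ℕ, ∀ m, N ≤ m → ∃ x y : ℝ, 0 ≤ x ∧ x < ∑ k, L k ∧
      0 ≤ y ∧ y < ∑ k, L k ∧ Walk t b L h x m y

lemma sum_red (L : Fin d → ℝ) (w l : Fin d) : ∑ k, red L w l k = ∑ k, L k - L l := by
  simp [red, Finset.sum_sub_distrib]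

lemma Mv.good {t b t' b' : Equiv.Perm (Fin d)} {w l : Fin d} {h : Fin d → ℕ}
    (H : Mv t b t' b' w l) (hG : Good t' b' (inc h w l)) : Good t b h := by
  obtain ⟨O, hO, ⟨L₀, hL₀⟩, hcone, hpos, hwalk⟩ := hG
  have hne := H.ne
  have hred : ∀ L : Fin d → ℝ, red L w l l = L l := fun L => by simp [red, hne.symm]
  refine ⟨(fun L => red L w l) ⁻¹' O, hO.preimage ?_,
    ⟨fun j => L₀ j + if j = w then L₀ l else 0, ?_⟩, ?_, ?_, ?_⟩
  · unfold red
    refine continuous_pi fun j => ?_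
    split_ifs <;> fun_prop
  · have : red (fun j => L₀ j + if j = w then L₀ l else 0) w l = L₀ := by
      funext j; simp [red, hne.symm]
    simpa [this] using hL₀
  · intro L hL c hc
    have : red (fun j => c * L j) w l = fun j => c * red L w l j := by
      funext j; simp only [red]; split_ifs <;> ring
    simpa [this] using hcone _ hL c hc
  · intro L hL j
    rw [Set.mem_preimage] at hL
    have h1 := hpos _ hL l
    rw [hred] at h1
    have h2 := hpos _ hL j
    simp only [red] at h2
    split_ifs at h2 <;> linarith
  · intro L hL hind
    rw [Set.mem_preimage] at hL
    obtain ⟨N, hN⟩ := hwalk _ hL (hind.red hne)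
    have h1 := hpos _ hL l
    have h2 := hpos _ hL w
    rw [hred] at h1
    simp only [red, if_true] at h2
    refine ⟨N, fun m hm => ?_⟩
    obtain ⟨x, y, hx, hx', hy, hy', hW⟩ := hN m hm
    rw [sum_red] at hx' hy'
    exact ⟨x, y, hx, by linarith, hy, by linarith, H.walk h1.le (by linarith) hW⟩

/-- A combinatorial state: the two rows of a labelled permutation together with tower heights. -/
abbrev State (d : ℕ) := Equiv.Perm (Fin d) × Equiv.Perm (Fin d) × (Fin d → ℕ)

/-- One Rauzy move on states. -/
def Step (s s' : State d) : Prop :=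
  ∃ w l, Mv s.1 s.2.1 s'.1 s'.2.1 w l ∧ s'.2.2 = inc s.2.2 w l

/-- Reachability by Rauzy moves. -/
def Reach : State d → State d → Prop := Relation.ReflTransGen Step

lemma Reach.trans {s s' s'' : State d} (h : Reach s s') (h' : Reach s' s'') : Reach s s'' :=
  Relation.ReflTransGen.trans h h'

lemma Reach.good {s s' : State d} (hr : Reach s s') (hG : Good s'.1 s'.2.1 s'.2.2) :
    Good s.1 s.2.1 s.2.2 := by
  induction hr with
  | refl => exact hG
  | tail _ hst ih =>
    obtain ⟨w, l, hmv, hh⟩ := hst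
    rw [hh] at hG
    exact ih (hmv.good hG)

/-- Exchange the two rows of a state. -/
def State.swap (s : State d) : State d := (s.2.1, s.1, s.2.2)

lemma Reach.swap {s s' : State d} (hr : Reach s s') : Reach s.swap s'.swap := by
  induction hr with
  | refl => exact Relation.ReflTransGen.refl
  | tail _ hst ih =>
    obtain ⟨w, l, hmv, hh⟩ := hst
    exact Relation.ReflTransGen.tail ih ⟨w, l, hmv.swap, hh⟩

lemma perm_filter_subset {p q : Equiv.Perm (Fin d)} {k : ℕ}
    (h : ∀ j, (p j : ℕ) < k → (q j : ℕ) < k) (j : Fin d) (hj : (q j : ℕ) < k) :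
    (p j : ℕ) < k := by
  have card : ∀ p : Equiv.Perm (Fin d), (univ.filter fun j => (p j : ℕ) < k).card =
      (univ.filter fun j : Fin d => (j : ℕ) < k).card := by
    intro p
    refine Finset.card_bij (fun j _ => p j) ?_ ?_ ?_
    · simp
    · intro a _ b _ hab; exact p.injective hab
    · intro b hb; exact ⟨p.symm b, by simpa using hb, by simp⟩
  have hs : (univ.filter fun j => (p j : ℕ) < k) ⊆ univ.filter fun j => (q j : ℕ) < k := by
    intro j; simpa using h j
  have := Finset.eq_of_subset_of_card_le hs (by rw [card, card])
  have hm : j ∈ univ.filter fun j => (q j : ℕ) < k := by simpa using hj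
  rw [← this] at hm
  simpa using hm

/-- Irreducibility of a labelled permutation. -/
def Irr (t b : Equiv.Perm (Fin d)) : Prop :=
  ∀ k : ℕ, 0 < k → k < d → ∃ j, (t j : ℕ) < k ∧ k ≤ b j

lemma Irr.swap {t b : Equiv.Perm (Fin d)} (h : Irr t b) : Irr b t := by
  intro k h0 hk
  by_contra! hc
  obtain ⟨j, h1, h2⟩ := h k h0 hk
  have := perm_filter_subset hc j h1
  omega

lemma TopWin.irr {t b b' : Equiv.Perm (Fin d)} {α β : Fin d} (H : TopWin t b b' α β)
    (h : Irr t b) : Irr t b' := by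
  intro k h0 hk
  by_contra! hc
  have hα : ¬ (b' α : ℕ) < k := fun hlt => by
    have := perm_filter_subset hc α hlt
    have := H.top_last
    omega
  rw [H.le α le_rfl] at hα
  obtain ⟨j, h1, h2⟩ := h k h0 hk
  have h3 := hc j h1
  by_cases hj : j = β
  · subst hj; have := H.mid; omega
  · rcases le_or_gt (b j) (b α) with h' | h'
    · rw [H.le j h'] at h3; omega
    · have := H.gt j hj h'; omega

lemma Mv.irr {t b t' b' : Equiv.Perm (Fin d)} {w l : Fin d} (H : Mv t b t' b' w l)
    (h : Irr t b) : Irr t' b' := by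
  rcases H with ⟨rfl, H⟩ | ⟨rfl, H⟩
  · exact H.irr h
  · exact (H.irr h.swap).swap

/-- Degeneracy of a labelled permutation. -/
def Deg (t b : Equiv.Perm (Fin d)) : Prop :=
  ∃ x y y₀, (t y : ℕ) = t x + 1 ∧
    ((b y₀ : ℕ) = b x + 1 ∨
      ((b x : ℕ) + 1 = d ∧ ∃ w, (t w : ℕ) + 1 = d ∧ (b y₀ : ℕ) = b w + 1)) ∧
    (y = y₀ ∨ ((t y₀ : ℕ) = 0 ∧ (b y : ℕ) = 0))

lemma Deg.swap {t b : Equiv.Perm (Fin d)} (h : Deg t b) : Deg b t := by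
  obtain ⟨x, y, y₀, h1, h2 | ⟨h2, w, hw, h2'⟩, h3 | ⟨h3, h4⟩⟩ := h
  · subst h3; exact ⟨x, y, y, h2, Or.inl h1, Or.inl rfl⟩
  · exact ⟨x, y₀, y, h2, Or.inl h1, Or.inr ⟨h4, h3⟩⟩
  · subst h3; exact ⟨w, y, y, h2', Or.inr ⟨hw, x, h2, h1⟩, Or.inl rfl⟩
  · exact ⟨w, y₀, y, h2', Or.inr ⟨hw, x, h2, h1⟩, Or.inr ⟨h4, h3⟩⟩

lemma TopWin.deg {t b b' : Equiv.Perm (Fin d)} {α β : Fin d} (H : TopWin t b b' α β)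
    (h : Deg t b') : Deg t b := by
  obtain ⟨x, y, y₀, h1, h2, h3⟩ := h
  have inj : ∀ (p : Equiv.Perm (Fin d)) {i j : Fin d}, (p i : ℕ) = p j → i = j :=
    fun p i j hij => p.injective (Fin.ext hij)
  have hαl := H.top_last
  have hβl := H.bot_last
  have hm := H.mid
  have hlt := H.bα_lt
  have hα' := congrArg Fin.val (H.le α le_rfl)
  have hxα : x ≠ α := by rintro rfl; have := (t y).isLt; omega
  have cases : ∀ j, j = β ∨ ((b j : ℕ) ≤ b α ∧ (b' j : ℕ) = b j) ∨
      ((b α : ℕ) < b j ∧ (b j : ℕ) + 1 < d ∧ (b' j : ℕ) = b j + 1) := by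
    intro j
    by_cases hj : j = β
    · exact Or.inl hj
    · right
      rcases le_or_gt (b j) (b α) with h' | h'
      · left; exact ⟨h', congrArg Fin.val (H.le j h')⟩
      · right
        have hjβ : (b j : ℕ) ≠ b β := fun e => hj (inj b e)
        have := (b j).isLt
        exact ⟨h', by omega, H.gt j hj h'⟩
  have h3' : y = y₀ ∨ ((t y₀ : ℕ) = 0 ∧ (b y : ℕ) = 0) := by
    refine h3.imp id fun ⟨h, h'⟩ => ⟨h, ?_⟩
    rcases cases y with rfl | ⟨_, hy⟩ | ⟨_, _, hy⟩ <;> omega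
  refine ⟨x, y, y₀, h1, ?_, h3'⟩
  rcases h2 with h2 | ⟨h2, w, hw, h2'⟩
  · rcases cases x with rfl | ⟨hx1, hx⟩ | ⟨hx1, _, hx⟩ <;>
      rcases cases y₀ with hy0 | ⟨hy1, hy⟩ | ⟨hy1, _, hy⟩
    · rw [hy0] at h2; omega
    · omega
    · right; exact ⟨hβl, α, hαl, by omega⟩
    · subst hy0
      exact absurd (inj b' (by omega)) hxα
    · left; omega
    · omega
    · subst hy0; omega
    · omega
    · left; omega
  · have hwα : w = α := inj t (by omega)
    subst hwα
    have hy0 : y₀ = β := inj b' (by omega)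
    subst hy0
    rcases cases x with rfl | ⟨hx1, hx⟩ | ⟨hx1, _, hx⟩
    · right; exact ⟨hβl, w, hαl, by omega⟩
    · omega
    · left; omega

lemma Mv.deg {t b t' b' : Equiv.Perm (Fin d)} {w l : Fin d} (H : Mv t b t' b' w l)
    (h : Deg t' b') : Deg t b := by
  rcases H with ⟨rfl, H⟩ | ⟨rfl, H⟩
  · exact H.deg h
  · exact (H.deg h.swap).swap

/-- The properties of a state preserved by Rauzy moves. -/
structure Inv (s : State d) : Prop where
  irr : Irr s.1 s.2.1
  deg : ¬ Deg s.1 s.2.1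
  prim : ∀ n : ℕ, (∀ j, n ∣ s.2.2 j) → n = 1
  pos : ∀ j, 0 < s.2.2 j

lemma Step.inv {s s' : State d} (H : Step s s') (h : Inv s) : Inv s' := by
  obtain ⟨w, l, hmv, hh⟩ := H
  refine ⟨hmv.irr h.irr, fun hd => h.deg (hmv.deg hd), fun n hn => h.prim n fun j => ?_,
    fun j => ?_⟩
  · rw [hh] at hn
    have hw : n ∣ s.2.2 w := by simpa [inc, hmv.ne] using hn w
    have hj := hn j
    simp only [inc] at hj
    split_ifs at hj
    · exact (Nat.dvd_add_left hw).1 hj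
    · simpa using hj
  · rw [hh]
    have := h.pos j
    simp only [inc]; omega

lemma Reach.inv {s s' : State d} (hr : Reach s s') (h : Inv s) : Inv s' := by
  induction hr with
  | refl => exact h
  | tail _ hst ih => exact hst.inv ih

lemma irr_of_isIrreducible {π : Equiv.Perm (Fin d)} (h : IsIrreducible π) : Irr 1 π := by
  intro k h0 hk
  by_contra! hc
  apply h k h0 hk
  have hc' : ∀ j : Fin d, (j : ℕ) < k → (π j : ℕ) < k := fun j => by simpa using hc j
  ext j
  simp only [Set.mem_image, Set.mem_ofPred_eq]
  constructor
  · rintro ⟨i, hi, rfl⟩; exact hc' i hi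
  · intro hj
    refine ⟨π.symm j, ?_, by simp⟩
    have := perm_filter_subset (p := 1) (q := π) (k := k) hc (π.symm j) (by simpa using hj)
    simpa using this

lemma not_deg_of_not_isDegenerate {π : Equiv.Perm (Fin d)} (h : ¬ IsDegenerate π) :
    ¬ Deg 1 π := by
  rintro ⟨x, y, y₀, h1, h2, h3⟩
  simp only [Equiv.Perm.coe_one, id_eq] at h1 h2 h3
  have hx : (x : ℕ) + 1 < d := h1 ▸ y.isLt
  have ey : y = ⟨x + 1, hx⟩ := Fin.ext h1
  have e0 : (y₀ : ℕ) = 0 → y₀ = ⟨0, by omega⟩ := fun h => Fin.ext h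
  apply h
  refine ⟨x, hx, ?_⟩
  rw [← ey]
  rcases h2 with h2 | ⟨h2, w, hw, h2'⟩
  · rcases h3 with rfl | ⟨h3, h4⟩
    · left; exact h2
    · right; right; left
      rw [← e0 h3]; exact ⟨h4, h2⟩
  · have ew : w = ⟨d - 1, by omega⟩ := Fin.ext (by simp; omega)
    rw [ew] at h2'
    have hx' : (π x : ℕ) = d - 1 := by omega
    rcases h3 with rfl | ⟨h3, h4⟩
    · right; right; right; exact ⟨h2', hx'⟩
    · right; left
      rw [← e0 h3]; exact ⟨hx', h4, h2'⟩

lemma reach_rotate {t b : Equiv.Perm (Fin d)} (h : Fin d → ℕ) {α : Fin d} (hα : (t α : ℕ) + 1 = d)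
    (i : ℕ) (hi : i + b α + 1 ≤ d) : ∃ b' : Equiv.Perm (Fin d),
      Reach (t, b, h)
        (t, b', fun j => h j + if (b α : ℕ) < b j ∧ d ≤ b j + i then h α else 0) ∧
      (∀ j, b j ≤ b α → b' j = b j) ∧
      (∀ j, b α < b j → (b j : ℕ) + i < d → (b' j : ℕ) = b j + i) ∧
      (∀ j, b α < b j → d ≤ (b j : ℕ) + i → (b' j : ℕ) + (d - 1) = b j + i + b α) := by
  induction i with
  | zero =>
    refine ⟨b, ?_, fun _ _ => rfl, fun _ _ _ => by omega, fun j _ h => ?_⟩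
    · have : (fun j => h j + if (b α : ℕ) < b j ∧ d ≤ b j + 0 then h α else 0) = h := by
        funext j
        have := (b j).isLt
        rw [if_neg (by omega)]; rfl
      rw [this]; exact Relation.ReflTransGen.refl
    · have := (b j).isLt; omega
  | succ i ih =>
    obtain ⟨b₁, hr, h1, h2, h3⟩ := ih (by omega)
    have hd : d - 1 < d := by omega
    set β := b₁.symm ⟨d - 1, hd⟩ with hβ
    have hbβ : (b₁ β : ℕ) = d - 1 := by simp [hβ]
    have hb1α : b₁ α = b α := h1 α le_rfl
    have hne : α ≠ β := by
      rintro h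
      rw [← h, hb1α] at hbβ; omega
    have hβlt : b α < b β := by
      by_contra hc
      have := h1 β (not_lt.1 hc)
      rw [this] at hbβ
      rw [not_lt, Fin.le_def] at hc
      omega
    have hβlt' := Fin.lt_def.1 hβlt
    have hβi : (b β : ℕ) + i = d - 1 := by
      rcases lt_or_ge ((b β : ℕ) + i) d with h' | h'
      · have := h2 β hβlt h'; omega
      · have := h3 β hβlt h'; have := (b β).isLt; omega
    obtain ⟨b₂, hT⟩ := exists_topWin (t := t) (b := b₁) hne hα (by omega)
    have huniq : ∀ j, (b₁ j : ℕ) = d - 1 → j = β := fun j hj =>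
      b₁.injective (Fin.ext (by omega))
    refine ⟨b₂, hr.tail ⟨α, β, Or.inl ⟨rfl, hT⟩, ?_⟩, ?_, ?_, ?_⟩
    · funext j
      simp only [inc, lt_irrefl, false_and, if_false, add_zero]
      by_cases hj : j = β
      · subst hj
        rw [if_pos (by omega), if_neg (by omega), if_pos rfl]; omega
      · have key : ((b α : ℕ) < b j ∧ d ≤ b j + (i + 1)) ↔ ((b α : ℕ) < b j ∧ d ≤ b j + i) := by
          refine and_congr_right fun hlt => ⟨fun hle => ?_, fun hle => by omega⟩
          by_contra hc
          exact hj (huniq j (by rw [h2 j hlt (by omega)]; omega))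
        simp only [key, hj, if_false, add_zero]
    · intro j hj
      have hj1 := h1 j hj
      rw [hT.le j (by rw [hj1, hb1α]; exact hj), hj1]
    · intro j hj hlt
      have hj1 := h2 j hj (by omega)
      have hjβ : j ≠ β := by rintro rfl; omega
      rw [hT.gt j hjβ (by rw [hb1α, Fin.lt_def]; have := Fin.lt_def.1 hj; omega)]; omega
    · intro j hj hle
      by_cases hjβ : j = β
      · subst hjβ; rw [hT.mid, hb1α]; omega
      · rcases lt_or_ge ((b j : ℕ) + i) d with h' | h'
        · exact absurd (huniq j (by rw [h2 j hj h']; omega)) hjβ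
        · have hj3 := h3 j hj h'
          have hj' := Fin.lt_def.1 hj
          rw [hT.gt j hjβ (by rw [hb1α, Fin.lt_def]; omega)]; omega

lemma reach_full_rotate {t b : Equiv.Perm (Fin d)} (h : Fin d → ℕ) {α : Fin d}
    (hα : (t α : ℕ) + 1 = d) :
    Reach (t, b, h) (t, b, fun j => h j + if b α < b j then h α else 0) := by
  have hlt := (b α).isLt
  obtain ⟨b', hr, h1, h2, h3⟩ := reach_rotate h hα (d - 1 - b α) (b := b) (by omega)
  have hb : b' = b := by
    ext j
    rcases le_or_gt (b j) (b α) with h' | h'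
    · rw [h1 j h']
    · have := h3 j h' (by have := Fin.lt_def.1 h'; omega)
      omega
  rw [hb] at hr
  convert hr using 6
  rw [Fin.lt_def]
  exact ⟨fun h => ⟨h, by omega⟩, fun h => h.1⟩

lemma reach_full_rotate_iterate {t b : Equiv.Perm (Fin d)} (h : Fin d → ℕ) {α : Fin d}
    (hα : (t α : ℕ) + 1 = d) (r : ℕ) :
    Reach (t, b, h) (t, b, fun j => h j + if b α < b j then r * h α else 0) := by
  induction r with
  | zero =>
    simp only [zero_mul, ite_self, add_zero]
    exact Relation.ReflTransGen.refl
  | succ r ih =>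
    refine ih.trans ?_
    convert reach_full_rotate (b := b) (fun j => h j + if b α < b j then r * h α else 0) hα using 4
    split_ifs with h1 h2
    · exact absurd h2 (lt_irrefl _)
    · ring
    · rfl

/-- A standard permutation: the first letter of each row is the last letter of the other. -/
structure Std (t b : Equiv.Perm (Fin d)) (a z : Fin d) : Prop where
  ta : (t a : ℕ) = 0
  ba : (b a : ℕ) + 1 = d
  bz : (b z : ℕ) = 0
  tz : (t z : ℕ) + 1 = d

lemma card_perm_lt (p : Equiv.Perm (Fin d)) {k : ℕ} (hk : k ≤ d) :
    (univ.filter fun j => (p j : ℕ) < k).card = k := by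
  have : (univ.filter fun j => (p j : ℕ) < k) =
      (univ.filter fun j : Fin d => (j : ℕ) < k).map p.symm.toEmbedding := by
    ext j; simp
  rw [this, Finset.card_map, Fin.card_filter_val_lt]
  omega

lemma exists_reach_std (hd : 1 < d) (n : ℕ) : ∀ s : State d, Irr s.1 s.2.1 →
    (∀ α, (s.1 α : ℕ) + 1 = d → (s.2.1 α : ℕ) = n) →
    ∃ s' a z, Reach s s' ∧ Std s'.1 s'.2.1 a z := by
  induction n using Nat.strong_induction_on with
  | _ m ih =>
  rintro ⟨t, b, h⟩ hirr hα
  simp only at hirr hα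
  have hd1 : d - 1 < d := by omega
  set α := t.symm ⟨d - 1, hd1⟩ with hαdef
  have htα : (t α : ℕ) + 1 = d := by simp [hαdef]; omega
  have hbα := hα α htα
  rcases Nat.eq_zero_or_pos m with hm | hm
  · obtain ⟨a, ha, ha'⟩ := hirr 1 one_pos hd
    have hba := (b a).isLt
    obtain ⟨b', hr, h1, h2, h3⟩ := reach_rotate h htα (d - 1 - b a) (b := b) (by omega)
    refine ⟨_, a, α, hr, by simp only; omega, ?_, ?_, htα⟩
    · have := h2 a (Fin.lt_def.2 (by omega)) (by omega)
      simp only; omega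
    · have := h1 α le_rfl
      simp only; rw [this]; omega
  · have hne : (univ.filter fun j => (b α) < b j).Nonempty := by
      obtain ⟨j, hj1, hj2⟩ := hirr (d - 1) (by omega) hd1
      refine ⟨j, ?_⟩
      simp only [mem_filter, mem_univ, true_and, Fin.lt_def]
      have hjα : (b j : ℕ) ≠ b α := fun e => by
        have : j = α := b.injective (Fin.ext e)
        rw [this] at hj1; omega
      have := (b j).isLt
      have := (b α).isLt
      omega
    obtain ⟨β, hβ, hmin⟩ := Finset.exists_min_image _ (fun j => t j) hne
    simp only [mem_filter, mem_univ, true_and] at hβ hmin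
    have hβ' := Fin.lt_def.1 hβ
    have hγ : ∃ γ, (b γ : ℕ) < m ∧ t β < t γ := by
      by_contra! hc
      have heq : (univ.filter fun j => (b j : ℕ) < m) = univ.filter fun j => (t j : ℕ) < t β := by
        ext j
        simp only [mem_filter, mem_univ, true_and]
        constructor
        · intro hj
          have h1 := Fin.le_def.1 (hc j hj)
          have : (t j : ℕ) ≠ t β := fun e => by
            have : j = β := t.injective (Fin.ext e)
            rw [this] at hj; omega
          omega
        · intro hj
          by_contra hc'
          have hjα : (b j : ℕ) ≠ b α := fun e => by
            have : j = α := b.injective (Fin.ext e)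
            rw [this] at hj; have := (t β).isLt; omega
          have := Fin.le_def.1 (hmin j (Fin.lt_def.2 (by omega)))
          omega
      have hmd : m ≤ d := by rw [← hbα]; exact (b α).isLt.le
      have hc1 := card_perm_lt b hmd
      rw [heq, card_perm_lt t (t β).isLt.le] at hc1
      obtain ⟨j, hj1, hj2⟩ := hirr m hm (by rw [← hbα]; exact (b α).isLt)
      have : j ∈ univ.filter fun j => (b j : ℕ) < m := by
        rw [heq]; simp only [mem_filter, mem_univ, true_and]; omega
      simp only [mem_filter, mem_univ, true_and] at this
      omega
    obtain ⟨γ, hγ1, hγ2⟩ := hγ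
    have hbβ := (b β).isLt
    have htγ := (t γ).isLt
    have hγ2' := Fin.lt_def.1 hγ2
    obtain ⟨b', hr, h1, h2, -⟩ := reach_rotate h htα (d - 1 - b β) (b := b) (by omega)
    have hb'β : (b' β : ℕ) + 1 = d := by rw [h2 β hβ (by omega)]; omega
    obtain ⟨t', hr', h1', h2', -⟩ := reach_rotate
      (fun j => h j + if (b α : ℕ) < b j ∧ d ≤ b j + (d - 1 - b β) then h α else 0) hb'β
      (d - 1 - t γ) (b := t) (by omega)
    have hR := hr.trans hr'.swap
    simp only [State.swap] at hR
    have hirr' : Irr t' b' := by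
      have key : ∀ s s' : State d, Reach s s' → Irr s.1 s.2.1 → Irr s'.1 s'.2.1 := by
        intro s s' hr hs
        induction hr with
        | refl => exact hs
        | tail _ hst ih => obtain ⟨w, l, hmv, _⟩ := hst; exact hmv.irr ih
      exact key _ _ hR hirr
    have hb'γ : b' γ = b γ := h1 γ (Fin.le_def.2 (by omega))
    have ht'γ : (t' γ : ℕ) + 1 = d := by rw [h2' γ hγ2 (by omega)]; omega
    obtain ⟨s', a, z, hs', hstd⟩ := ih (b γ) hγ1 (t', b', _) hirr' (fun δ hδ => by
      simp only at hδ ⊢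
      have : δ = γ := t'.injective (Fin.ext (by omega))
      rw [this, hb'γ])
    exact ⟨s', a, z, hR.trans hs', hstd⟩

/-- The heights after the loop based at a standard permutation in which `z` rotates the bottom row
until `k` is last, `k` makes `r` full rotations of the top row, and `z` completes its rotation. -/
def loopHeights (t b : Equiv.Perm (Fin d)) (h : Fin d → ℕ) (z k : Fin d) (r : ℕ) : Fin d → ℕ :=
  fun j => h j + (if b k < b j then h z else 0) + (if t k < t j then r * h k else 0) +
    (if b z < b j ∧ b j ≤ b k then h z + r * h k else 0)

lemma Std.reach_loop {t b : Equiv.Perm (Fin d)} {a z k : Fin d} (H : Std t b a z)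
    (hkz : k ≠ z) (h : Fin d → ℕ) (r : ℕ) :
    Reach (t, b, h) (t, b, loopHeights t b h z k r) := by
  have hbz := H.bz
  have htz := H.tz
  have hbk := (b k).isLt
  have hbk0 : (b k : ℕ) ≠ 0 := fun e => hkz (b.injective (Fin.ext (by omega)))
  have htk : (t k : ℕ) < t z := by
    have : (t k : ℕ) ≠ t z := fun e => hkz (t.injective (Fin.ext e))
    have := (t k).isLt
    omega
  obtain ⟨b₁, hr1, h11, h12, h13⟩ := reach_rotate h H.tz (d - 1 - b k) (b := b) (by omega)
  set h₁ : Fin d → ℕ :=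
    fun j => h j + if (b z : ℕ) < b j ∧ d ≤ b j + (d - 1 - b k) then h z else 0 with hh1
  have hb1k : (b₁ k : ℕ) + 1 = d := by rw [h12 k (Fin.lt_def.2 (by omega)) (by omega)]; omega
  have hb1z : b₁ z = b z := h11 z le_rfl
  have hr2 := (reach_full_rotate_iterate (b := t) h₁ hb1k r).swap
  simp only [State.swap] at hr2
  set h₂ : Fin d → ℕ := fun j => h₁ j + if t k < t j then r * h₁ k else 0 with hh2
  obtain ⟨b₃, hr3, h31, h32, h33⟩ := reach_rotate h₂ H.tz (b k) (b := b₁) (by rw [hb1z]; omega)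
  have hjz : ∀ j, (b j : ℕ) = 0 → j = z := fun j hj => b.injective (Fin.ext (by omega))
  have cases : ∀ j, j = z ∨ (0 < (b j : ℕ) ∧ (b j : ℕ) ≤ b k ∧ (b₁ j : ℕ) = b j + (d - 1 - b k)) ∨
      ((b k : ℕ) < b j ∧ (b₁ j : ℕ) + b k = b j) := by
    intro j
    by_cases hj : (b j : ℕ) = 0
    · exact Or.inl (hjz j hj)
    · right
      rcases le_or_gt (b j : ℕ) (b k) with hle | hle
      · left; exact ⟨by omega, hle, h12 j (Fin.lt_def.2 (by omega)) (by omega)⟩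
      · right
        have := h13 j (Fin.lt_def.2 (by omega)) (by omega)
        exact ⟨hle, by omega⟩
  have hb : b₃ = b := by
    ext j
    rcases cases j with rfl | ⟨hj1, hj2, hj3⟩ | ⟨hj1, hj2⟩
    · rw [h31 j le_rfl, hb1z]
    · have := h33 j (Fin.lt_def.2 (by rw [hb1z]; omega)) (by omega)
      rw [hb1z] at this; omega
    · have := (b j).isLt
      have := h32 j (Fin.lt_def.2 (by rw [hb1z]; omega)) (by omega)
      omega
  have hh : (fun j => h₂ j + if (b₁ z : ℕ) < b₁ j ∧ d ≤ b₁ j + b k then h₂ z else 0) =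
      loopHeights t b h z k r := by
    funext j
    have e1 : h₁ k = h k := by simp only [hh1]; rw [if_neg (by omega)]; rfl
    have e2 : h₂ z = h z + r * h k := by
      simp only [hh2, e1]
      rw [if_pos (Fin.lt_def.2 htk)]
      simp only [hh1]; rw [if_neg (by omega)]; rfl
    have e3 : h₂ j = h₁ j + if t k < t j then r * h k else 0 := by simp only [hh2, e1]
    simp only [e2, e3, loopHeights]
    simp only [hh1, Fin.lt_def, Fin.le_def, hb1z]
    have := (b j).isLt
    rcases cases j with rfl | ⟨hj1, hj2, hj3⟩ | ⟨hj1, hj2⟩ <;> split_ifs <;> omega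
  rw [hb, hh] at hr3
  exact (hr1.trans hr2).trans hr3

lemma exists_coprime_add_mul {x y D : ℕ} (hD : D ≠ 0) (h : Nat.gcd (Nat.gcd x y) D = 1) :
    ∃ r, Nat.Coprime (x + r * y) D := by
  refine ⟨∏ p ∈ D.primeFactors.filter (fun p => ¬ p ∣ x), p, ?_⟩
  refine Nat.coprime_of_dvd fun p hp h1 h2 => ?_
  by_cases hpx : p ∣ x
  · have h3 := (Nat.dvd_add_right hpx).1 h1
    rcases hp.dvd_mul.1 h3 with h4 | h4
    · obtain ⟨q, hq, hpq⟩ := (Prime.dvd_finsetProd_iff hp.prime _).1 h4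
      simp only [mem_filter, Nat.mem_primeFactors] at hq
      rw [Nat.prime_dvd_prime_iff_eq hp hq.1.1] at hpq
      subst hpq
      exact hq.2 hpx
    · exact hp.one_lt.ne' (Nat.dvd_one.1 (h ▸ Nat.dvd_gcd (Nat.dvd_gcd hpx h4) h2))
  · have : p ∣ ∏ p ∈ D.primeFactors.filter (fun p => ¬ p ∣ x), p :=
      Finset.dvd_prod_of_mem (fun p => p) (by simp [hp, h2, hD, hpx])
    exact hpx ((Nat.dvd_add_left (this.mul_right y)).1 h1)

lemma exists_gcd_add_mul (x y D : ℕ) (hD : D ≠ 0) :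
    ∃ r, Nat.gcd (x + r * y) D = Nat.gcd (Nat.gcd x y) D := by
  set g := Nat.gcd (Nat.gcd x y) D with hg
  have hgpos : 0 < g := Nat.gcd_pos_of_pos_right _ (Nat.pos_of_ne_zero hD)
  obtain ⟨x', hx⟩ : g ∣ x := (Nat.gcd_dvd_left _ _).trans (Nat.gcd_dvd_left _ _)
  obtain ⟨y', hy⟩ : g ∣ y := (Nat.gcd_dvd_left _ _).trans (Nat.gcd_dvd_right _ _)
  obtain ⟨D', hD'⟩ : g ∣ D := Nat.gcd_dvd_right _ _
  have h1 : Nat.gcd (Nat.gcd x' y') D' = 1 := by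
    have : g * 1 = g * Nat.gcd (Nat.gcd x' y') D' := by
      rw [← Nat.gcd_mul_left, ← Nat.gcd_mul_left, ← hx, ← hy, ← hD', mul_one]
    exact (Nat.eq_of_mul_eq_mul_left hgpos this).symm
  obtain ⟨r, hr⟩ := exists_coprime_add_mul (by rintro rfl; simp at hD'; exact hD hD') h1
  refine ⟨r, ?_⟩
  have e1 : x + r * y = g * (x' + r * y') := by
    calc x + r * y = g * x' + r * (g * y') := by rw [← hx, ← hy]
      _ = _ := by ring
  calc Nat.gcd (x + r * y) D = Nat.gcd (g * (x' + r * y')) (g * D') := by rw [← e1, ← hD']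
    _ = g := by rw [Nat.gcd_mul_left, hr, mul_one]

namespace Std
variable {t b : Equiv.Perm (Fin d)} {a z k : Fin d}

lemma loopHeights_a (H : Std t b a z) (h : Fin d → ℕ) (hka : k ≠ a) (r : ℕ) :
    loopHeights t b h z k r a = h a + h z := by
  have hb : (b k : ℕ) < b a := by
    have h1 : (b k : ℕ) ≠ b a := fun e => hka (b.injective (Fin.ext e))
    have := (b k).isLt
    have := H.ba
    omega
  have h2 : ¬ (t k : ℕ) < t a := by rw [H.ta]; omega
  simp only [loopHeights, Fin.lt_def, Fin.le_def]
  rw [if_pos hb, if_neg h2, if_neg (by omega)]; rfl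

lemma loopHeights_z (H : Std t b a z) (h : Fin d → ℕ) (hkz : k ≠ z) (r : ℕ) :
    loopHeights t b h z k r z = h z + r * h k := by
  have ht : (t k : ℕ) < t z := by
    have h1 : (t k : ℕ) ≠ t z := fun e => hkz (t.injective (Fin.ext e))
    have := (t k).isLt
    have := H.tz
    omega
  have := H.bz
  simp only [loopHeights, Fin.lt_def, Fin.le_def]
  rw [if_neg (by omega), if_pos ht, if_neg (by omega)]; rfl

lemma loopHeights_self (H : Std t b a z) (h : Fin d → ℕ) (hkz : k ≠ z) (r : ℕ) :
    loopHeights t b h z k r k = h k + (h z + r * h k) := by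
  have := H.bz
  have hb : (b z : ℕ) < b k := by
    have h1 : (b k : ℕ) ≠ b z := fun e => hkz (b.injective (Fin.ext e))
    omega
  simp only [loopHeights, Fin.lt_def, Fin.le_def]
  rw [if_neg (by omega), if_neg (by omega), if_pos (by omega)]; rfl

lemma exists_reach_gcd_eq_one (H : Std t b a z) (n : ℕ) : ∀ h : Fin d → ℕ, Inv (t, b, h) →
    Nat.gcd (h a) (h z) = n →
    ∃ h', Reach (t, b, h) (t, b, h') ∧ Nat.gcd (h' a) (h' z) = 1 := by
  induction n using Nat.strong_induction_on with
  | _ n ih =>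
  intro h hinv hn
  by_cases h1 : n = 1
  · exact ⟨h, Relation.ReflTransGen.refl, hn.trans h1⟩
  have hk : ∃ k, ¬ n ∣ h k := by
    by_contra! hc
    exact h1 (hinv.prim n hc)
  obtain ⟨k, hk⟩ := hk
  have hka : k ≠ a := by rintro rfl; exact hk (hn ▸ Nat.gcd_dvd_left _ _)
  have hkz : k ≠ z := by rintro rfl; exact hk (hn ▸ Nat.gcd_dvd_right _ _)
  have hapos : 0 < h a := hinv.pos a
  have hnpos : 0 < n := hn ▸ Nat.gcd_pos_of_pos_left _ hapos
  obtain ⟨r, hr⟩ := exists_gcd_add_mul (h z) (h k) (h a + h z) (by omega)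
  have hR := H.reach_loop hkz h r
  have hg : Nat.gcd (h a + h z) (h z + r * h k) = Nat.gcd n (h k) := by
    rw [Nat.gcd_comm, hr, Nat.gcd_right_comm, Nat.gcd_add_self_right, Nat.gcd_comm (h z), hn]
  have hlt : Nat.gcd n (h k) < n := by
    refine lt_of_le_of_ne (Nat.gcd_le_left _ hnpos) fun e => hk ?_
    exact e ▸ Nat.gcd_dvd_right _ _
  obtain ⟨h', hR', hh'⟩ := ih _ hlt _ (hR.inv hinv)
    (by rw [H.loopHeights_a h hka, H.loopHeights_z h hkz, hg])
  exact ⟨h', hR.trans hR', hh'⟩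

end Std

/-- A standard permutation whose second letters `β` and `k` in the two rows differ. -/
structure Std2 (t b : Equiv.Perm (Fin d)) (a z β k : Fin d) : Prop extends Std t b a z where
  tβ : (t β : ℕ) = 1
  bk : (b k : ℕ) = 1
  βk : β ≠ k

lemma Std2.coprime_step {t b : Equiv.Perm (Fin d)} {a z β k : Fin d} (hd : 3 < d)
    (H : Std2 t b a z β k) (h : Fin d → ℕ)
    (hg : Nat.gcd (h a) (h z) = 1) (hne : h a + h z ≠ h β) :
    ∃ h', Reach (t, b, h) (t, b, h') ∧ Nat.Coprime (h' a + h' z) (h' β) := by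
  have h1 := H.ta; have h2 := H.tz; have h3 := H.tβ
  have hβa : β ≠ a := by rintro rfl; omega
  have hβz : β ≠ z := by rintro rfl; omega
  have hD : ((h a + h z : ℤ) - h β).natAbs ≠ 0 := by omega
  have hcop : Nat.gcd (Nat.gcd (h β + h z) (h β)) ((h a + h z : ℤ) - h β).natAbs = 1 := by
    refine Nat.coprime_of_dvd fun p hp hp1 hp2 => ?_
    have e1 : p ∣ h β := hp1.trans (Nat.gcd_dvd_right _ _)
    have e2 : p ∣ h z := (Nat.dvd_add_right e1).1 (hp1.trans (Nat.gcd_dvd_left _ _))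
    rw [← Int.natCast_dvd] at hp2
    have e3 := dvd_add hp2 (Int.natCast_dvd_natCast.2 e1)
    rw [sub_add_cancel, ← Nat.cast_add, Int.natCast_dvd_natCast] at e3
    have e4 : p ∣ h a := (Nat.dvd_add_left e2).1 e3
    exact hp.one_lt.ne' (Nat.dvd_one.1 (hg ▸ Nat.dvd_gcd e4 e2))
  obtain ⟨r, hr⟩ := exists_coprime_add_mul hD hcop
  refine ⟨_, H.reach_loop hβz h r, ?_⟩
  rw [H.loopHeights_a h hβa, H.loopHeights_z h hβz, H.loopHeights_self h hβz]
  refine Nat.coprime_of_dvd fun p hp hp1 hp2 => ?_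
  refine hp.one_lt.ne' (Nat.dvd_one.1 (hr ▸ Nat.dvd_gcd ?_ ?_))
  · rwa [add_assoc]
  · rw [← Int.natCast_dvd]
    have e1 : (p : ℤ) ∣ ((h a + h z + (h z + r * h β) : ℕ) : ℤ) := Int.natCast_dvd_natCast.2 hp1
    have e2 : (p : ℤ) ∣ ((h β + (h z + r * h β) : ℕ) : ℤ) := Int.natCast_dvd_natCast.2 hp2
    have e3 := dvd_sub e1 e2
    push_cast at e3
    rw [show ((h a : ℤ) + h z - h β) = (h a + h z + (h z + r * h β)) - (h β + (h z + r * h β)) by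
      ring]
    exact e3

lemma exists_reach_coprime (hd : 3 < d) {s : State d} (hinv : Inv s) :
    ∃ t b h a z β k, Reach s (t, b, h) ∧ Std2 t b a z β k ∧ Inv (t, b, h) ∧
      Nat.Coprime (h a + h z) (h β) := by
  have hd1 : d - 1 < d := by omega
  obtain ⟨⟨t, b, h₀⟩, a, z, hr₀, hstd⟩ := exists_reach_std (by omega)
    (s.2.1 (s.1.symm ⟨d - 1, hd1⟩) : ℕ) s hinv.irr (fun α hα => by
      congr 2; rw [Equiv.eq_symm_apply]; ext; simp; omega)
  have hinv₀ := hr₀.inv hinv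
  simp only at hstd
  have h1 := hstd.ta; have h2 := hstd.tz; have h3 := hstd.ba; have h4 := hstd.bz
  set β := t.symm ⟨1, by omega⟩ with hβ
  set k := b.symm ⟨1, by omega⟩ with hk
  have htβ : (t β : ℕ) = 1 := by simp [hβ]
  have hbk : (b k : ℕ) = 1 := by simp [hk]
  have hβk : β ≠ k := by
    intro e
    refine hinv₀.deg ⟨a, β, k, ?_, Or.inr ⟨h3, z, h2, ?_⟩, Or.inl e⟩
    · simp only; omega
    · simp only; omega
  have H : Std2 t b a z β k := ⟨hstd, htβ, hbk, hβk⟩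
  have hka : k ≠ a := by intro e; rw [e] at hbk; omega
  have hkz : k ≠ z := by intro e; rw [e] at hbk; omega
  have hβz : β ≠ z := by intro e; rw [e] at htβ; omega
  obtain ⟨h₁, hr₁, hg₁⟩ := hstd.exists_reach_gcd_eq_one _ h₀ hinv₀ rfl
  have hinv₁ := hr₁.inv hinv₀
  obtain ⟨h₂, hr₂, hg₂, hne⟩ : ∃ h₂, Reach (t, b, h₁) (t, b, h₂) ∧
      Nat.gcd (h₂ a) (h₂ z) = 1 ∧ h₂ a + h₂ z ≠ h₂ β := by
    by_cases hne : h₁ a + h₁ z = h₁ β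
    · refine ⟨_, hstd.reach_loop hkz h₁ (h₁ a + h₁ z), ?_, ?_⟩
      · rw [hstd.loopHeights_a h₁ hka, hstd.loopHeights_z h₁ hkz,
          Nat.gcd_add_mul_left_right, Nat.gcd_add_self_left, hg₁]
      · rw [hstd.loopHeights_a h₁ hka, hstd.loopHeights_z h₁ hkz]
        have e : loopHeights t b h₁ z k (h₁ a + h₁ z) β = h₁ β + h₁ z := by
          have hb : (b β : ℕ) ≠ 1 := fun e => hβk (b.injective (Fin.ext (by omega)))
          have ht0 : (t k : ℕ) ≠ 0 := fun e => hka (t.injective (Fin.ext (by omega)))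
          have hb0 : (b β : ℕ) ≠ 0 := fun e => hβz (b.injective (Fin.ext (by omega)))
          simp only [loopHeights, Fin.lt_def, Fin.le_def]
          rw [if_pos (by omega), if_neg (by omega), if_neg (by omega)]; rfl
        rw [e]
        have p1 : 0 < h₁ a := hinv₁.pos a
        have p2 : 0 < h₁ k := hinv₁.pos k
        have : 0 < (h₁ a + h₁ z) * h₁ k := by positivity
        omega
    · exact ⟨h₁, Relation.ReflTransGen.refl, hg₁, hne⟩
  have hinv₂ := hr₂.inv hinv₁
  obtain ⟨h₃, hr₃, hc⟩ := H.coprime_step hd h₂ hg₂ hne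
  exact ⟨t, b, h₃, a, z, β, k, ((hr₀.trans hr₁).trans hr₂).trans hr₃, H, hr₃.inv hinv₂, hc⟩

/-- Suspension data: the partial sums of `τ` are positive along `t` and negative along `b`. -/
structure Susp (t b : Equiv.Perm (Fin d)) (τ : Fin d → ℤ) : Prop where
  top : ∀ j, (t j : ℕ) ≠ 0 → 0 < lo t τ j
  bot : ∀ j, (b j : ℕ) ≠ 0 → lo b τ j < 0

namespace Susp
variable {t b : Equiv.Perm (Fin d)} {τ : Fin d → ℤ}

lemma top_nonneg (H : Susp t b τ) (j : Fin d) : 0 ≤ lo t τ j := by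
  by_cases h : (t j : ℕ) = 0
  · rw [lo_first τ h]
  · exact (H.top j h).le

lemma bot_nonpos (H : Susp t b τ) (j : Fin d) : lo b τ j ≤ 0 := by
  by_cases h : (b j : ℕ) = 0
  · rw [lo_first τ h]
  · exact (H.bot j h).le

lemma swap (H : Susp t b τ) : Susp b t (fun j => - τ j) :=
  ⟨fun j hj => by rw [lo_neg]; have := H.bot j hj; omega,
    fun j hj => by rw [lo_neg]; have := H.top j hj; omega⟩

end Susp

lemma lo_sub_pos {t b : Equiv.Perm (Fin d)} (h : Irr t b) {j : Fin d} (hj : (t j : ℕ) ≠ 0) :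
    0 < lo t (fun i => (b i : ℤ) - t i) j := by
  obtain ⟨k, hk⟩ : ∃ k : ℕ, (t j : ℕ) = k := ⟨_, rfl⟩
  rw [hk] at hj
  obtain ⟨i, hi1, hi2⟩ := h.swap k (Nat.pos_of_ne_zero hj) (hk ▸ (t j).isLt)
  have e : ∀ p : Equiv.Perm (Fin d), ∑ i, (if (p i : ℕ) < k then ((p i : ℕ) : ℤ) - k else 0) =
      ∑ i : Fin d, if (i : ℕ) < k then ((i : ℕ) : ℤ) - k else 0 := fun p =>
    Equiv.sum_comp p fun i => if (i : ℕ) < k then ((i : ℕ) : ℤ) - k else 0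
  have h1 : ∑ i, (if (b i : ℕ) < k then ((b i : ℕ) : ℤ) - k else 0) <
      ∑ i, (if (t i : ℕ) < k then ((b i : ℕ) : ℤ) - k else 0) := by
    refine Finset.sum_lt_sum (fun i _ => ?_) ⟨i, mem_univ _, ?_⟩
    · split_ifs <;> omega
    · rw [if_pos hi1, if_neg (by omega)]; omega
  have h2 : lo t (fun i => (b i : ℤ) - t i) j =
      ∑ i, (if (t i : ℕ) < k then ((b i : ℕ) : ℤ) - k else 0) -
        ∑ i, (if (t i : ℕ) < k then ((t i : ℕ) : ℤ) - k else 0) := by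
    unfold lo
    rw [Finset.sum_filter, ← Finset.sum_sub_distrib]
    refine Finset.sum_congr rfl fun i _ => ?_
    simp only [Fin.lt_def, hk]
    split_ifs <;> ring
  rw [h2, e t, ← e b]
  linarith

lemma Irr.susp {t b : Equiv.Perm (Fin d)} (h : Irr t b) : Susp t b fun i => (b i : ℤ) - t i := by
  refine ⟨fun j hj => lo_sub_pos h hj, fun j hj => ?_⟩
  have := lo_sub_pos h.swap hj
  have e : (fun i => (b i : ℤ) - t i) = fun i => -((t i : ℤ) - b i) := by funext i; ring
  rw [e, lo_neg]; omega

lemma lo_eq_sum {M : Type*} [CommRing M] (t : Equiv.Perm (Fin d)) (v : Fin d → M) (j : Fin d) :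
    lo t v j = ∑ k, (if t k < t j then (1 : M) else 0) * v k := by
  simp [lo, Finset.sum_filter]

/-- The displacement of a walk, as an integer combination of lengths whose suspension value is
nonpositive. -/
lemma Walk.exists_displacement {t b : Equiv.Perm (Fin d)} {τ : Fin d → ℤ} (hτ : Susp t b τ)
    {L : Fin d → ℝ} {h : Fin d → ℕ} {x y : ℝ} {m : ℕ} (hw : Walk t b L h x m y) :
    ∃ u : Fin d → ℤ, y - x = ∑ k, (u k : ℝ) * L k ∧ ∑ k, u k * τ k ≤ 0 := by
  induction hw with
  | nil x => exact ⟨0, by simp, by simp⟩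
  | @cons x m y j _ _ _ ih =>
    obtain ⟨u, h1, h2⟩ := ih
    refine ⟨fun k => u k + ((if b k < b j then 1 else 0) - if t k < t j then 1 else 0), ?_, ?_⟩
    · push_cast
      simp only [add_mul, sub_mul, Finset.sum_add_distrib, Finset.sum_sub_distrib, ← lo_eq_sum]
      linarith
    · simp only [add_mul, sub_mul, Finset.sum_add_distrib, Finset.sum_sub_distrib, ← lo_eq_sum]
      have := hτ.top_nonneg j
      have := hτ.bot_nonpos j
      linarith

/-- No forward orbit connects a left endpoint of the bottom partition to a left endpoint of the
top partition, unless both are the origin. -/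
lemma not_walk_of_susp {t b : Equiv.Perm (Fin d)} {τ : Fin d → ℤ} (hτ : Susp t b τ)
    {L : Fin d → ℝ} (hL : ∀ u : Fin d → ℤ, ∑ k, (u k : ℝ) * L k = 0 → ∑ k, u k * τ k = 0)
    {h : Fin d → ℕ} {m : ℕ} {i j : Fin d} (hij : (b i : ℕ) ≠ 0 ∨ (t j : ℕ) ≠ 0) :
    ¬ Walk t b L h (lo b L i) m (lo t L j) := by
  intro hw
  obtain ⟨u, h1, h2⟩ := hw.exists_displacement hτ
  have h3 := hL (fun k => u k + ((if b k < b i then 1 else 0) - if t k < t j then 1 else 0)) (by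
    push_cast
    simp only [add_mul, sub_mul, Finset.sum_add_distrib, Finset.sum_sub_distrib, ← lo_eq_sum]
    linarith)
  simp only [add_mul, sub_mul, Finset.sum_add_distrib, Finset.sum_sub_distrib, ← lo_eq_sum] at h3
  rcases hij with h | h
  · have := hτ.bot i h
    have := hτ.top_nonneg j
    linarith
  · have := hτ.top j h
    have := hτ.bot_nonpos i
    linarith

lemma image_mem {t b : Equiv.Perm (Fin d)} {L : Fin d → ℝ} (hL : ∀ j, 0 ≤ L j) {x : ℝ} {j : Fin d}
    (h1 : lo t L j ≤ x) (h2 : x < lo t L j + L j) :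
    0 ≤ x - lo t L j + lo b L j ∧ x - lo t L j + lo b L j < ∑ k, L k := by
  have := lo_nonneg (t := b) hL j
  have := lo_add_le_sum (t := b) hL j
  constructor <;> linarith

lemma exists_backward_orbit {t b : Equiv.Perm (Fin d)} {L : Fin d → ℝ} (hL : ∀ j, 0 ≤ L j)
    {δ : ℝ} (h0 : 0 ≤ δ) (h1 : δ < ∑ k, L k) : ∃ (y : ℕ → ℝ) (j : ℕ → Fin d), y 0 = δ ∧
      ∀ q, 0 ≤ y q ∧ y q < ∑ k, L k ∧ lo t L (j q) ≤ y (q + 1) ∧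
        y (q + 1) < lo t L (j q) + L (j q) ∧ y q = y (q + 1) - lo t L (j q) + lo b L (j q) := by
  have hex : ∀ x : Set.Ico (0 : ℝ) (∑ k, L k), ∃ (j : Fin d) (x' : Set.Ico (0 : ℝ) (∑ k, L k)),
      lo t L j ≤ x' ∧ (x' : ℝ) < lo t L j + L j ∧ (x : ℝ) = x' - lo t L j + lo b L j := by
    rintro ⟨x, hx0, hx1⟩
    obtain ⟨j, hj1, hj2⟩ := exists_mem_interval (t := b) hx0 hx1
    exact ⟨j, ⟨_, image_mem (b := t) hL hj1 hj2⟩, by simp only; linarith, by simp only; linarith,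
      by simp⟩
  choose g f hf using hex
  refine ⟨fun q => (f^[q] ⟨δ, h0, h1⟩ : Set.Ico (0 : ℝ) (∑ k, L k)),
    fun q => g (f^[q] ⟨δ, h0, h1⟩), rfl, fun q => ?_⟩
  simp only [Function.iterate_succ_apply']
  exact ⟨(f^[q] ⟨δ, h0, h1⟩).2.1, (f^[q] ⟨δ, h0, h1⟩).2.2, hf _⟩

lemma exists_dvd_add_mul {q p : ℕ} (hq : 0 < q) (h : Nat.Coprime p q) (n : ℕ) :
    ∃ i < q, q ∣ n + i * p := by
  have : NeZero q := ⟨hq.ne'⟩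
  refine ⟨((-(n : ZMod q)) * (p : ZMod q)⁻¹).val, ZMod.val_lt _, ?_⟩
  rw [← ZMod.natCast_eq_zero_iff]
  push_cast
  rw [ZMod.natCast_val, ZMod.cast_id]
  have := ZMod.coe_mul_inv_eq_one p h
  linear_combination (-(n : ZMod q)) * this

/-- If every point soon enters a long run of towers of total height `p` or `q`, with `p` and `q`
coprime, and the endpoint `lo t L β` starts a long run of the first kind while its left neighbours
start a long run of the second kind, then all large times are attained. -/
lemma exists_walk_of_runs {t b : Equiv.Perm (Fin d)} {L : Fin d → ℝ} {h : Fin d → ℕ}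
    (hL : ∀ j, 0 < L j) (hpos : ∀ j, 0 < h j) {M : ℕ} (hM : ∀ j, h j ≤ M) (hind : RatIndep L)
    (hirr : Irr t b) {β : Fin d} (hβ : (t β : ℕ) ≠ 0) {p q K : ℕ} (hp : 0 < p) (hq : 0 < q)
    (hpq : Nat.Coprime p q)
    (hrun : ∀ x, 0 ≤ x → x < ∑ k, L k → ∃ m ≤ K, (∀ i < q, ∃ x', Walk t b L h x (m + i * p) x') ∨
      ∀ i < p, ∃ x', Walk t b L h x (m + i * q) x')
    (hleft : ∃ ε₀ > 0, ∀ ε, 0 < ε → ε < ε₀ → ∀ c ≤ M + K + p * q, ∃ y, 0 ≤ y ∧ y < ∑ k, L k ∧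
      Walk t b L h (lo t L β - ε) (c * q) y)
    (hright : ∀ c ≤ M + K + p * q, ∃ y, 0 ≤ y ∧ y < ∑ k, L k ∧
      Walk t b L h (lo t L β) (c * p) y) :
    ∃ N : ℕ, ∀ m, N ≤ m → ∃ x y : ℝ, 0 ≤ x ∧ x < ∑ k, L k ∧
      0 ≤ y ∧ y < ∑ k, L k ∧ Walk t b L h x m y := by
  have hL' : ∀ j, 0 ≤ L j := fun j => (hL j).le
  obtain ⟨y, j, hy0, hy⟩ := exists_backward_orbit (t := t) (b := b) hL'
    (lo_nonneg (t := t) hL' β)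
    (lt_of_lt_of_le (lt_add_of_pos_right _ (hL β)) (lo_add_le_sum (t := t) hL' β))
  set H : ℕ → ℕ := fun n => ∑ i ∈ range n, h (j i) with hH
  have hHs : ∀ n, H (n + 1) = H n + h (j n) := fun n => Finset.sum_range_succ _ _
  have hwalk : ∀ n, Walk t b L h (y n) (H n) (lo t L β) := by
    intro n
    induction n with
    | zero => rw [hy0]; exact Walk.nil _
    | succ n ih =>
      obtain ⟨-, -, h1, h2, h3⟩ := hy n
      rw [hHs, add_comm (H n)]
      exact Walk.cons (j n) h1 h2 (h3 ▸ ih)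
  have hstrict : ∀ n, lo t L (j n) < y (n + 1) := by
    intro n
    obtain ⟨-, -, h1, h2, h3⟩ := hy n
    refine lt_of_le_of_ne h1 fun he => ?_
    have hw := hwalk n
    rw [h3, ← he, sub_self, zero_add] at hw
    exact not_walk_of_susp hirr.susp (fun u hu => by simp [hind u hu]) (Or.inr hβ) hw
  have hnear : ∀ n, ∃ ε₀ > 0, ∀ ε, 0 < ε → ε < ε₀ →
      0 ≤ y n - ε ∧ Walk t b L h (y n - ε) (H n) (lo t L β - ε) := by
    intro n
    induction n with
    | zero =>
      have hpos0 : 0 < lo t L β := by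
        rcases (lo_nonneg (t := t) hL' β).lt_or_eq with h | h
        · exact h
        · have hb := hstrict
          exfalso
          have ht0 : 0 < d := by have := β.isLt; omega
          have := lo_add_le hL' (x := t.symm ⟨0, ht0⟩) (y := β) (t := t)
            (by rw [Fin.lt_def]; simp; omega)
          rw [← h, lo_first L (by simp)] at this
          linarith [hL (t.symm ⟨0, ht0⟩)]
      refine ⟨lo t L β, hpos0, fun ε h1 h2 => ⟨?_, ?_⟩⟩
      · rw [hy0]; linarith
      · rw [hy0]; exact Walk.nil _
    | succ n ih =>
      obtain ⟨ε₀, h0, hε⟩ := ih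
      refine ⟨min ε₀ (y (n + 1) - lo t L (j n)), lt_min h0 (sub_pos.2 (hstrict n)),
        fun ε h1 h2 => ?_⟩
      obtain ⟨-, -, h3, h4, h5⟩ := hy n
      rw [lt_min_iff] at h2
      have := lo_nonneg (t := t) hL' (j n)
      refine ⟨by linarith, ?_⟩
      rw [hHs, add_comm (H n)]
      refine Walk.cons (j n) (by linarith) (by linarith) ?_
      exact (hε ε h1 h2.1).2.cast (by rw [h5]; ring) rfl rfl
  have hdet : ∀ {x m x'}, Walk t b L h x m x' → ∀ n, x = y n → m ≤ H n →
      ∃ n', x' = y n' ∧ H n' + m = H n := by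
    intro x m x' hw
    induction hw with
    | nil x => intro n hx _; exact ⟨n, hx, rfl⟩
    | @cons x m x' i h1 h2 _ ih =>
      intro n hx hm
      cases n with
      | zero =>
        have := hpos i
        simp [hH] at hm
        omega
      | succ n =>
        obtain ⟨-, -, h3, h4, h5⟩ := hy n
        have hij : i = j n := interval_unique (t := t) hL' (hx ▸ h1) (hx ▸ h2) h3 h4
        subst hij
        rw [hHs] at hm ⊢
        obtain ⟨n', h6, h7⟩ := ih n (by rw [h5, hx]) (by omega)
        exact ⟨n', h6, by omega⟩
  have hHge : ∀ n, n ≤ H n := by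
    intro n
    induction n with
    | zero => simp
    | succ n ih => rw [hHs]; have := hpos (j n); omega
  refine ⟨K + p * q + M, fun m hm => ?_⟩
  obtain ⟨n, hn1, hn2⟩ : ∃ n, H n ≤ m ∧ m < H (n + 1) := by
    by_contra! hc
    have : ∀ n, H n ≤ m := fun n => by
      induction n with
      | zero => simp [hH]
      | succ n ih => exact hc n ih
    have h1 := this (m + 1)
    have h2 := hHge (m + 1)
    omega
  rw [hHs] at hn2
  have hjn := hM (j n)
  obtain ⟨m₀, hm₀, hcase⟩ := hrun (y n) (hy n).1 (hy n).2.1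
  rcases hcase with hcase | hcase
  · obtain ⟨i, hi, c, hc⟩ := exists_dvd_add_mul hq hpq (m - H n + m₀)
    obtain ⟨x', hx'⟩ := hcase i hi
    have hip : i * p ≤ p * q := by rw [mul_comm p q]; exact Nat.mul_le_mul_right _ hi.le
    obtain ⟨n', hn', hn''⟩ := hdet hx' n rfl (by omega)
    have hcle : c ≤ q * c := Nat.le_mul_of_pos_left _ hq
    obtain ⟨ε₁, hε₁, H₁⟩ := hleft
    obtain ⟨ε₂, hε₂, H₂⟩ := hnear n'
    have hmin : 0 < min ε₁ ε₂ := lt_min hε₁ hε₂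
    have hlt : min ε₁ ε₂ / 2 < min ε₁ ε₂ := half_lt_self hmin
    obtain ⟨z, hz0, hz1, hz⟩ := H₁ (min ε₁ ε₂ / 2) (half_pos hmin)
      (hlt.trans_le (min_le_left _ _)) c (by omega)
    obtain ⟨h1, h2⟩ := H₂ (min ε₁ ε₂ / 2) (half_pos hmin) (hlt.trans_le (min_le_right _ _))
    have := (hy n').2.1
    exact ⟨_, z, h1, by linarith, hz0, hz1, (h2.append hz).cast rfl (by rw [mul_comm c q]; omega)
      rfl⟩
  · obtain ⟨i, hi, c, hc⟩ := exists_dvd_add_mul hp hpq.symm (m - H n + m₀)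
    obtain ⟨x', hx'⟩ := hcase i hi
    have hip : i * q ≤ p * q := Nat.mul_le_mul_right _ hi.le
    obtain ⟨n', hn', hn''⟩ := hdet hx' n rfl (by omega)
    have hcle : c ≤ p * c := Nat.le_mul_of_pos_left _ hp
    obtain ⟨z, hz0, hz1, hz⟩ := hright c (by omega)
    exact ⟨_, z, (hy n').1, (hy n').2.1, hz0, hz1,
      ((hwalk n').append hz).cast rfl (by rw [mul_comm c p]; omega) rfl⟩

/-- Length vectors for which `a z` and `β` produce long runs. -/
structure RunCone (a z β k : Fin d) (R : ℝ) (L : Fin d → ℝ) : Prop where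
  pos : ∀ j, 0 < L j
  rest_lt : ∑ j, L j - L a - L z - L β - L k < L a - L z
  lt_k : L a - L z + (∑ j, L j - L a - L z - L β - L k) < L k
  lt_a : R * (L a - L z) < L a
  lt_β : R * L k < L β

section
variable {t b : Equiv.Perm (Fin d)} {a z β k : Fin d} {h : Fin d → ℕ} {L : Fin d → ℝ}

/-- The relative positions of the intervals in a standard configuration. -/
structure Std2Facts (t b : Equiv.Perm (Fin d)) (a z β k : Fin d) (L : Fin d → ℝ) : Prop where
  ta : lo t L a = 0
  tβ : lo t L β = L a
  tz : lo t L z = ∑ j, L j - L z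
  bz : lo b L z = 0
  bk : lo b L k = L z
  ba : lo b L a = ∑ j, L j - L a
  Bl : L z + L k ≤ lo b L β
  Bu : lo b L β + L β ≤ ∑ j, L j - L a
  Tl : L a + L β ≤ lo t L k
  Tu : lo t L k + L k ≤ ∑ j, L j - L z

lemma Std2.ne_all (H : Std2 t b a z β k) (hd : 3 < d) :
    a ≠ z ∧ a ≠ β ∧ a ≠ k ∧ z ≠ β ∧ z ≠ k ∧ β ≠ k := by
  have h1 := H.ta; have h2 := H.tz; have h3 := H.ba; have h4 := H.bz
  have h5 := H.tβ; have h6 := H.bk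
  refine ⟨?_, ?_, ?_, ?_, ?_, H.βk⟩ <;> rintro rfl <;> omega

lemma Std2.facts (H : Std2 t b a z β k) (hd : 3 < d) (hL : ∀ j, 0 ≤ L j) :
    Std2Facts t b a z β k L := by
  have h1 := H.ta; have h2 := H.tz; have h3 := H.ba; have h4 := H.bz
  have h5 := H.tβ; have h6 := H.bk
  obtain ⟨n1, n2, n3, n4, n5, n6⟩ := H.ne_all hd
  have ta := lo_first L H.ta
  have tβ := lo_succ L (x := a) (y := β) (t := t) (by omega)
  have tz := lo_last L H.tz
  have bz := lo_first L H.bz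
  have bk := lo_succ L (x := z) (y := k) (t := b) (by omega)
  have ba := lo_last L H.ba
  have inj : ∀ (p : Equiv.Perm (Fin d)) {i j : Fin d}, i ≠ j → (p i : ℕ) ≠ p j :=
    fun p i j hij e => hij (p.injective (Fin.ext e))
  have Bl := lo_add_le hL (t := b) (x := k) (y := β) (by
    have := inj b n6; have := inj b n4; rw [Fin.lt_def]; omega)
  have Bu := lo_add_le hL (t := b) (x := β) (y := a) (by
    have := inj b n2; have := (b β).isLt; rw [Fin.lt_def]; omega)
  have Tl := lo_add_le hL (t := t) (x := β) (y := k) (by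
    have := inj t n6; have := inj t n3; rw [Fin.lt_def]; omega)
  have Tu := lo_add_le hL (t := t) (x := k) (y := z) (by
    have := inj t n5; have := (t k).isLt; rw [Fin.lt_def]; omega)
  constructor <;> linarith

namespace Std2Facts

lemma walk_az (F : Std2Facts t b a z β k L) {x : ℝ} (h1 : L a - L z ≤ x) (h0 : 0 ≤ x)
    (h2 : x < L a) : Walk t b L h x (h a + h z) (x - (L a - L z)) := by
  have := F.ta; have := F.tz; have := F.ba; have := F.bz
  refine (Walk.single a (by linarith) (by linarith) rfl).append
    (Walk.single z ?_ ?_ ?_) <;> linarith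

lemma walk_az_iterate (F : Std2Facts t b a z β k L) (hθ : 0 ≤ L a - L z) (c : ℕ) :
    ∀ {x : ℝ}, c * (L a - L z) ≤ x → x < L a →
      Walk t b L h x (c * (h a + h z)) (x - c * (L a - L z)) := by
  induction c with
  | zero => intro x _ _; exact (Walk.nil x).cast rfl (by ring) (by simp)
  | succ c ih =>
    intro x h1 h2
    push_cast at h1 ⊢
    have : 0 ≤ c * (L a - L z) := by positivity
    refine ((F.walk_az (by linarith) (by linarith) h2).append
      (ih (x := x - (L a - L z)) (by linarith) (by linarith))).cast rfl ?_ ?_ <;> ring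

lemma walk_β (F : Std2Facts t b a z β k L) {x : ℝ} (h1 : L a ≤ x) (h2 : x < L a + L β) :
    Walk t b L h x (h β) (x + (lo b L β - L a)) := by
  have := F.tβ
  exact Walk.single β (by linarith) (by linarith) (by linarith)

lemma walk_β_iterate (F : Std2Facts t b a z β k L) (hθ : 0 ≤ lo b L β - L a) (c : ℕ) :
    ∀ {x : ℝ}, L a ≤ x → x + c * (lo b L β - L a) < L a + L β →
      Walk t b L h x (c * h β) (x + c * (lo b L β - L a)) := by
  induction c with
  | zero => intro x _ _; exact (Walk.nil x).cast rfl (by ring) (by simp)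
  | succ c ih =>
    intro x h1 h2
    push_cast at h2 ⊢
    have : 0 ≤ c * (lo b L β - L a) := by positivity
    refine ((F.walk_β h1 (by linarith)).append
      (ih (x := x + (lo b L β - L a)) (by linarith) (by linarith))).cast rfl ?_ ?_ <;> ring

lemma az_exit (F : Std2Facts t b a z β k L) (hθ : 0 ≤ L a - L z) (n : ℕ) :
    ∀ {x : ℝ}, 0 ≤ x → x < L a → n * (L a - L z) ≤ x ∨
      ∃ i ≤ n, ∃ y, 0 ≤ y ∧ y < L a - L z ∧ Walk t b L h x (i * (h a + h z)) y := by
  induction n with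
  | zero => intro x h0 _; left; simpa using h0
  | succ n ih =>
    intro x h0 h1
    rcases lt_or_ge x (L a - L z) with h2 | h2
    · exact Or.inr ⟨0, Nat.zero_le _, x, h0, h2, (Walk.nil x).cast rfl (by ring) rfl⟩
    · rcases ih (x := x - (L a - L z)) (by linarith) (by linarith) with
        h3 | ⟨i, hi, y, hy0, hy1, hy⟩
      · left; push_cast; linarith
      · right
        exact ⟨i + 1, by omega, y, hy0, hy1,
          ((F.walk_az h2 h0 h1).append hy).cast rfl (by ring) rfl⟩

lemma β_exit (F : Std2Facts t b a z β k L) (hθ : 0 ≤ lo b L β - L a) (n : ℕ) :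
    ∀ {x : ℝ}, L a ≤ x → x < L a + L β → x + n * (lo b L β - L a) < L a + L β ∨
      ∃ i ≤ n, ∃ y, L a + L β ≤ y ∧ y < L a + L β + (lo b L β - L a) ∧
        Walk t b L h x (i * h β) y := by
  induction n with
  | zero => intro x _ h; left; simpa using h
  | succ n ih =>
    intro x h0 h1
    rcases lt_or_ge (x + (lo b L β - L a)) (L a + L β) with h2 | h2
    · rcases ih (x := x + (lo b L β - L a)) (by linarith) (by linarith) with
        h3 | ⟨i, hi, y, hy0, hy1, hy⟩
      · left; push_cast; linarith
      · right
        exact ⟨i + 1, by omega, y, hy0, hy1,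
          ((F.walk_β h0 h1).append hy).cast rfl (by ring) rfl⟩
    · exact Or.inr ⟨1, by omega, _, h2, by linarith, (F.walk_β h0 h1).cast rfl (by ring) rfl⟩

end Std2Facts

lemma Std2.exists_walk (H : Std2 t b a z β k) (hd : 3 < d) (hirr : Irr t b) (hpos : ∀ j, 0 < h j)
    (hcop : Nat.Coprime (h a + h z) (h β)) {M : ℕ} (hM : ∀ j, h j ≤ M)
    (hC : RunCone a z β k ((M + (4 * M + (h β + (h a + h z)) * (h β + (h a + h z)) +
      h β * (h a + h z)) + (h β + (h a + h z)) + 2 : ℕ) : ℝ) L)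
    (hind : RatIndep L) :
    ∃ N : ℕ, ∀ m, N ≤ m → ∃ x y : ℝ, 0 ≤ x ∧ x < ∑ k, L k ∧
      0 ≤ y ∧ y < ∑ k, L k ∧ Walk t b L h x m y := by
  obtain ⟨hL, hC1, hC2, hC3, hC4⟩ := hC
  have hL' : ∀ j, 0 ≤ L j := fun j => (hL j).le
  have F := H.facts (L := L) hd hL'
  obtain ⟨n1, n2, n3, n4, n5, n6⟩ := H.ne_all hd
  obtain ⟨q, hq⟩ : ∃ q, h a + h z = q := ⟨_, rfl⟩
  obtain ⟨p, hp⟩ : ∃ p, h β = p := ⟨_, rfl⟩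
  rw [hq, hp] at hcop hC3 hC4
  have hp0 : 0 < p := hp ▸ hpos β
  have hq0 : 0 < q := by have := hpos a; omega
  obtain ⟨ta, tβ, tz, bz, bk, ba, Bl, Bu, Tl, Tu⟩ := id F
  have ha := hL a; have hz := hL z; have hβ := hL β; have hk := hL k
  have hθ₁ : 0 ≤ L a - L z := by linarith
  have hθ₂ : 0 ≤ lo b L β - L a := by linarith
  have hθ₂k : lo b L β - L a ≤ L k := by linarith
  set K := 4 * M + (p + q) * (p + q) with hK
  set R : ℕ := M + (K + p * q) + (p + q) + 2 with hR
  have hC3' : ∀ c : ℕ, c + 2 ≤ R → (c + 2) * (L a - L z) < L a := by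
    intro c hc
    refine lt_of_le_of_lt (mul_le_mul_of_nonneg_right ?_ hθ₁) hC3
    exact_mod_cast hc
  have hC4' : ∀ c : ℕ, c + 2 ≤ R → (c + 2) * L k < L β := by
    intro c hc
    refine lt_of_le_of_lt (mul_le_mul_of_nonneg_right ?_ hk.le) hC4
    exact_mod_cast hc
  have runC : ∀ c : ℕ, c + 2 ≤ R → ∀ x, L a - (L a - L z) ≤ x → x < L a →
      Walk t b L h x (c * q) (x - c * (L a - L z)) ∧ 0 ≤ x - c * (L a - L z) := by
    intro c hc x h1 h2
    have := hC3' c hc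
    refine ⟨hq ▸ F.walk_az_iterate hθ₁ c ?_ h2, ?_⟩ <;> linarith
  have runβ : ∀ c : ℕ, c + 2 ≤ R → ∀ x, L a ≤ x → x < L a + L k →
      Walk t b L h x (c * p) (x + c * (lo b L β - L a)) ∧
        x + c * (lo b L β - L a) < L a + L β := by
    intro c hc x h1 h2
    have e := hC4' c hc
    have e2 : c * (lo b L β - L a) ≤ c * L k := mul_le_mul_of_nonneg_left hθ₂k (Nat.cast_nonneg c)
    have e3 : x + c * (lo b L β - L a) < L a + L β := by linarith
    exact ⟨hp ▸ F.walk_β_iterate hθ₂ c h1 e3, e3⟩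
  have hpqR : p + q + 2 ≤ R := by omega
  let Q : ℕ → ℝ → Prop := fun K x => ∃ m ≤ K, (∀ i < q, ∃ x', Walk t b L h x (m + i * p) x') ∨
      ∀ i < p, ∃ x', Walk t b L h x (m + i * q) x'
  have Qmono : ∀ {K K' x}, Q K x → K ≤ K' → Q K' x := fun ⟨m, hm, hx⟩ hKK =>
    ⟨m, hm.trans hKK, hx⟩
  have Qstep : ∀ {K m x y}, Walk t b L h x m y → Q K y → Q (m + K) x := by
    rintro K m x y hw ⟨m', hm', hy⟩
    refine ⟨m + m', by omega, hy.imp (fun hy i hi => ?_) fun hy i hi => ?_⟩ <;>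
    · obtain ⟨x', hx'⟩ := hy i hi
      exact ⟨x', (hw.append hx').cast rfl (by ring) rfl⟩
  have Qstep1 : ∀ {K x} (j : Fin d), lo t L j ≤ x → x < lo t L j + L j →
      Q K (x - lo t L j + lo b L j) → Q (K + M) x := by
    intro K x j h1 h2 hQ
    refine Qmono (Qstep (Walk.single j h1 h2 rfl) hQ) ?_
    have := hM j; omega
  have Qβ : ∀ x, L a ≤ x → x < L a + L k → Q 0 x := by
    intro x h1 h2
    refine ⟨0, le_rfl, Or.inl fun i hi => ⟨_, (runβ i (by omega) x h1 h2).1.cast rfl ?_ rfl⟩⟩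
    omega
  have QC : ∀ x, L a - (L a - L z) ≤ x → x < L a → Q 0 x := by
    intro x h1 h2
    refine ⟨0, le_rfl, Or.inr fun i hi => ⟨_, (runC i (by omega) x h1 h2).1.cast rfl ?_ rfl⟩⟩
    omega
  have Qk : ∀ x, lo t L k ≤ x → x < lo t L k + L k → Q M x := by
    intro x h1 h2
    rw [← zero_add M]
    refine Qstep1 k h1 h2 ?_
    rcases lt_or_ge (x - lo t L k + lo b L k) (L a) with h3 | h3
    · exact QC _ (by linarith) h3
    · exact Qβ _ h3 (by linarith)
  have inj : ∀ (p : Equiv.Perm (Fin d)) {i j : Fin d}, i ≠ j → (p i : ℕ) ≠ p j :=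
    fun p i j hij e => hij (p.injective (Fin.ext e))
  have Qtiny : ∀ j, j ≠ a → j ≠ z → j ≠ β → ∀ x, lo t L j ≤ x → x < lo t L j + L j →
      Q (M + M) x := by
    intro j ja jz jβ x h1 h2
    by_cases jk : j = k
    · subst jk; exact Qmono (Qk x h1 h2) (by omega)
    refine Qstep1 j h1 h2 ?_
    have b1 := H.bz; have b2 := H.bk; have b3 := H.ba
    rcases lt_or_ge (b j) (b β) with h3 | h3
    · have e1 := lo_add_le hL' h3
      have e2 := lo_add_le hL' (t := b) (x := k) (y := j) (by
        have := inj b jk; have := inj b jz; rw [Fin.lt_def]; omega)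
      exact Qmono (Qβ _ (by linarith) (by linarith)) (Nat.zero_le _)
    · have e1 := lo_add_le hL' (t := b) (x := β) (y := j)
        (lt_of_le_of_ne h3 fun e => jβ (b.injective e).symm)
      have e2 := lo_add_le hL' (t := b) (x := j) (y := a) (by
        have := inj b ja; have := (b j).isLt; rw [Fin.lt_def]; omega)
      exact Qk _ (by linarith) (by linarith)
  have Qmid : ∀ x, L a + L β ≤ x → x < ∑ j, L j - L z → Q (M + M) x := by
    intro x h1 h2
    obtain ⟨j, hj1, hj2⟩ := exists_mem_interval (t := t) (v := L) (x := x) (by linarith)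
      (by linarith)
    refine Qtiny j ?_ ?_ ?_ x hj1 hj2 <;> rintro rfl <;> linarith
  have Qa0 : ∀ x, 0 ≤ x → x < L a - L z → Q (M + M + M) x := by
    intro x h1 h2
    refine Qstep1 a (by linarith) (by linarith) ?_
    exact Qmid _ (by linarith) (by linarith)
  have Qa : ∀ x, 0 ≤ x → x < L a → Q ((p + q) * (p + q) + (M + M + M)) x := by
    intro x h1 h2
    rcases F.az_exit (h := h) hθ₁ (p + q) h1 h2 with h3 | ⟨i, hi, y, hy0, hy1, hy⟩
    · refine ⟨0, Nat.zero_le _, Or.inr fun i hi => ⟨x - i * (L a - L z), ?_⟩⟩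
      rw [zero_add, ← hq]
      refine F.walk_az_iterate hθ₁ i (le_trans (mul_le_mul_of_nonneg_right ?_ hθ₁) h3) h2
      exact_mod_cast (by omega : i ≤ p + q)
    · refine Qmono (Qstep hy (Qa0 y hy0 hy1)) (Nat.add_le_add_right ?_ _)
      rw [hq]; exact Nat.mul_le_mul hi (by omega)
  have Qall : ∀ x, 0 ≤ x → x < ∑ j, L j → Q K x := by
    intro x h0 h1
    rcases lt_or_ge x (L a) with h2 | h2
    · exact Qmono (Qa x h0 h2) (by omega)
    rcases lt_or_ge x (L a + L β) with h3 | h3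
    · rcases F.β_exit (h := h) hθ₂ (p + q) h2 h3 with h4 | ⟨i, hi, y, hy0, hy1, hy⟩
      · refine ⟨0, Nat.zero_le _, Or.inl fun i hi => ⟨x + i * (lo b L β - L a), ?_⟩⟩
        rw [zero_add, ← hp]
        refine F.walk_β_iterate hθ₂ i h2 (lt_of_le_of_lt ?_ h4)
        have : (i : ℝ) ≤ ((p + q : ℕ) : ℝ) := by exact_mod_cast (by omega : i ≤ p + q)
        have := mul_le_mul_of_nonneg_right this hθ₂
        linarith
      · refine Qmono (Qstep hy (Qmid y hy0 (by linarith))) ?_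
        rw [hp]
        have : i * p ≤ (p + q) * (p + q) := Nat.mul_le_mul hi (by omega)
        omega
    rcases lt_or_ge x (∑ j, L j - L z) with h4 | h4
    · exact Qmono (Qmid x h3 h4) (by omega)
    · refine Qmono (Qstep1 z (by linarith) (by linarith) (Qa _ (by linarith) (by linarith))) ?_
      omega
  refine exists_walk_of_runs hL hpos hM hind hirr (β := β) (by have := H.tβ; omega) hp0 hq0
    hcop.symm Qall ?_ ?_
  · refine ⟨L a - L z, by linarith, fun ε h1 h2 c hc => ?_⟩
    obtain ⟨h3, h4⟩ := runC c (by omega) (L a - ε) (by linarith) (by linarith)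
    refine ⟨_, h4, ?_, tβ ▸ h3⟩
    have : 0 ≤ c * (L a - L z) := by positivity
    linarith
  · intro c hc
    obtain ⟨h3, h4⟩ := runβ c (by omega) (L a) le_rfl (by linarith)
    have : 0 ≤ c * (lo b L β - L a) := by positivity
    refine ⟨_, ?_, ?_, h3.cast tβ.symm rfl rfl⟩ <;> linarith

lemma Std2.good (H : Std2 t b a z β k) (hd : 3 < d) (hinv : Inv (t, b, h))
    (hcop : Nat.Coprime (h a + h z) (h β)) : Good t b h := by
  obtain ⟨n1, n2, n3, n4, n5, n6⟩ := H.ne_all hd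
  set M : ℕ := ∑ j, h j with hMdef
  have hM : ∀ j, h j ≤ M := fun j => Finset.single_le_sum (fun _ _ => Nat.zero_le _) (mem_univ j)
  obtain ⟨R, hR⟩ : ∃ R : ℕ, M + (4 * M + (h β + (h a + h z)) * (h β + (h a + h z)) +
      h β * (h a + h z)) + (h β + (h a + h z)) + 2 = R := ⟨_, rfl⟩
  have hR0 : (0 : ℝ) ≤ R := Nat.cast_nonneg R
  have hd' : (3 : ℝ) < d := by exact_mod_cast hd
  refine ⟨{L | RunCone a z β k (R : ℝ) L}, ?_, ?_, ?_, fun L hL => hL.pos, fun L hL hind =>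
    H.exists_walk hd hinv.irr hinv.pos hcop hM (by rw [hR]; exact hL) hind⟩
  · have : {L : Fin d → ℝ | RunCone a z β k (R : ℝ) L} =
        (⋂ j, {L | 0 < L j}) ∩ ({L | ∑ j, L j - L a - L z - L β - L k < L a - L z} ∩
        ({L | L a - L z + (∑ j, L j - L a - L z - L β - L k) < L k} ∩
        ({L | (R : ℝ) * (L a - L z) < L a} ∩ {L | (R : ℝ) * L k < L β}))) := by
      ext L
      simp only [Set.mem_ofPred_eq, Set.mem_inter_iff, Set.mem_iInter]
      exact ⟨fun h => ⟨h.1, h.2, h.3, h.4, h.5⟩, fun ⟨h1, h2, h3, h4, h5⟩ => ⟨h1, h2, h3, h4, h5⟩⟩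
    rw [this]
    refine IsOpen.inter (isOpen_iInter_of_finite fun j => isOpen_lt (by fun_prop) (by fun_prop)) ?_
    refine (isOpen_lt (by fun_prop) (by fun_prop)).inter ?_
    refine (isOpen_lt (by fun_prop) (by fun_prop)).inter ?_
    exact (isOpen_lt (by fun_prop) (by fun_prop)).inter (isOpen_lt (by fun_prop) (by fun_prop))
  · let A : ℝ := (R + 3) * d
    let Z : ℝ := (R + 2) * d
    let B : ℝ := (R + 3) * (2 * d + 1)
    let C : ℝ := 2 * d + 1
    let L : Fin d → ℝ := fun j => 1 + (if j = a then A - 1 else 0) + (if j = z then Z - 1 else 0) +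
      (if j = β then B - 1 else 0) + if j = k then C - 1 else 0
    have la : L a = A := by simp [L, n1, n2, n3]
    have lz : L z = Z := by simp [L, n1.symm, n4, n5]
    have lβ : L β = B := by simp [L, n2.symm, n4.symm, n6]
    have lk : L k = C := by simp [L, n3.symm, n5.symm, n6.symm]
    have ls : ∑ j, L j = d + (A - 1) + (Z - 1) + (B - 1) + (C - 1) := by
      simp [L, Finset.sum_add_distrib]
    have hdR : 0 ≤ (R : ℝ) * d := by positivity
    refine ⟨L, ?_, ?_, ?_, ?_, ?_⟩
    · intro j
      simp only [L, A, Z, B, C]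
      split_ifs <;> nlinarith
    · rw [la, lz, lβ, lk, ls]
      simp only [A, Z, B, C]; linarith
    · rw [la, lz, lβ, lk, ls]
      simp only [A, Z, B, C]; linarith
    · rw [la, lz]
      simp only [A, Z]; linarith
    · rw [lβ, lk]
      simp only [B, C]; linarith
  · intro L hL c hc
    obtain ⟨h1, h2, h3, h4, h5⟩ := hL
    have e : ∑ j, c * L j = c * ∑ j, L j := (Finset.mul_sum _ _ _).symm
    have := mul_lt_mul_of_pos_left h2 hc
    have := mul_lt_mul_of_pos_left h3 hc
    have := mul_lt_mul_of_pos_left h4 hc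
    have := mul_lt_mul_of_pos_left h5 hc
    refine ⟨fun j => mul_pos hc (h1 j), ?_, ?_, ?_, ?_⟩ <;> (try rw [e]) <;> linarith

end

lemma Inv.good {s : State d} (hd : 3 < d) (hinv : Inv s) : Good s.1 s.2.1 s.2.2 := by
  obtain ⟨t, b, h, a, z, β, k, hr, H, hinv', hcop⟩ := exists_reach_coprime hd hinv
  exact hr.good (H.good hd hinv' hcop)

/-- An infinite path of Rauzy moves. -/
structure RPath (d : ℕ) where
  t : ℕ → Equiv.Perm (Fin d)
  b : ℕ → Equiv.Perm (Fin d)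
  w : ℕ → Fin d
  l : ℕ → Fin d
  mv : ∀ n, Mv (t n) (b n) (t (n + 1)) (b (n + 1)) (w n) (l n)

lemma Mv.last {t b t' b' : Equiv.Perm (Fin d)} {w l : Fin d} (H : Mv t b t' b' w l) :
    ((t' w : ℕ) + 1 = d ∨ (b' w : ℕ) + 1 = d) ∧ ∀ j, ((t j : ℕ) + 1 = d ∨ (b j : ℕ) + 1 = d) →
      w = j ∨ l = j := by
  have inj : ∀ (p : Equiv.Perm (Fin d)) {i j : Fin d}, (p i : ℕ) = p j → i = j :=
    fun p i j hij => p.injective (Fin.ext hij)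
  rcases H with ⟨rfl, H⟩ | ⟨rfl, H⟩
  · refine ⟨Or.inl H.top_last, ?_⟩
    have h1 := H.top_last; have h2 := H.bot_last
    rintro j (hj | hj)
    · exact Or.inl (inj t' (by omega))
    · exact Or.inr (inj b (by omega))
  · refine ⟨Or.inr H.top_last, ?_⟩
    have h1 := H.top_last; have h2 := H.bot_last
    rintro j (hj | hj)
    · exact Or.inr (inj t (by omega))
    · exact Or.inl (inj b' (by omega))

lemma sum_inc_red (h : Fin d → ℕ) (v : Fin d → ℝ) {w l : Fin d} (hne : w ≠ l) :
    ∑ j, (inc h w l j : ℝ) * red v w l j = ∑ j, (h j : ℝ) * v j := by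
  have : ∀ j, (inc h w l j : ℝ) * red v w l j = h j * v j +
      ((if j = l then (h w : ℝ) * v l else 0) - if j = w then (h w : ℝ) * v l else 0) := by
    intro j
    simp only [inc, red]
    push_cast
    by_cases h1 : j = l
    · subst h1; simp [hne.symm]; ring
    · by_cases h2 : j = w
      · subst h2; simp [h1]; ring
      · simp [h1, h2]
  simp [this, Finset.sum_add_distrib]

namespace RPath

variable (S : RPath d)

/-- The length vectors along a path. -/
def desc {M : Type*} [AddCommGroup M] (v : Fin d → M) : ℕ → Fin d → M
  | 0 => v
  | n + 1 => red (desc v n) (S.w n) (S.l n)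

/-- The heights along a path. -/
def hts (h : Fin d → ℕ) : ℕ → Fin d → ℕ
  | 0 => h
  | n + 1 => inc (hts h n) (S.w n) (S.l n)

/-- The path starting at time `k`. -/
def shift (k : ℕ) : RPath d :=
  ⟨fun n => S.t (k + n), fun n => S.b (k + n), fun n => S.w (k + n), fun n => S.l (k + n),
    fun n => S.mv (k + n)⟩

lemma desc_shift {M : Type*} [AddCommGroup M] (v : Fin d → M) (k n : ℕ) :
    (S.shift k).desc (S.desc v k) n = S.desc v (k + n) := by
  induction n with
  | zero => rfl
  | succ n ih => rw [desc, ih]; rfl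

lemma sum_hts_desc (h : Fin d → ℕ) (v : Fin d → ℝ) (n : ℕ) :
    ∑ j, (S.hts h n j : ℝ) * S.desc v n j = ∑ j, (h j : ℝ) * v j := by
  induction n with
  | zero => rfl
  | succ n ih => rw [← ih]; exact sum_inc_red _ _ (S.mv n).ne

lemma hts_mono_mul {h h' : Fin d → ℕ} {c : ℕ} (hh : ∀ j, h j ≤ c * h' j) (n : ℕ) :
    ∀ j, S.hts h n j ≤ c * S.hts h' n j := by
  induction n with
  | zero => exact hh
  | succ n ih =>
    intro j
    simp only [hts, inc]
    have h1 := ih j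
    have h2 := ih (S.w n)
    split_ifs
    · rw [mul_add]; omega
    · simpa using h1

lemma hts_succ_le (h : Fin d → ℕ) (n : ℕ) (j : Fin d) : S.hts h n j ≤ S.hts h (n + 1) j := by
  simp only [hts, inc]; omega

lemma hts_mono (h : Fin d → ℕ) (j : Fin d) : Monotone fun n => S.hts h n j :=
  monotone_nat_of_le_succ fun n => S.hts_succ_le h n j

lemma le_sum_hts {h : Fin d → ℕ} (hh : ∀ j, 1 ≤ h j) (n : ℕ) : n ≤ ∑ j, S.hts h n j := by
  induction n with
  | zero => omega
  | succ n ih =>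
    have h1 : 1 ≤ S.hts h n (S.w n) := (hh _).trans (S.hts_mono h _ (Nat.zero_le n))
    simp only [hts, inc, Finset.sum_add_distrib, Finset.sum_ite_eq', mem_univ, if_true]
    omega

lemma consecutive (n : ℕ) : S.w (n + 1) = S.w n ∨ S.l (n + 1) = S.w n :=
  (S.mv (n + 1)).last.2 _ (S.mv n).last.1

/-- The lengths remain positive along the first `n` moves. -/
def Cone (n : ℕ) (L : Fin d → ℝ) : Prop := ∀ j, 0 < S.desc L n j

variable {S} {L : Fin d → ℝ}

lemma Cone.desc_le {n : ℕ} (hL : S.Cone (n + 1) L) (j : Fin d) :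
    S.desc L (n + 1) j ≤ S.desc L n j := by
  have h1 := hL (S.l n)
  have hne := (S.mv n).ne.symm
  simp only [desc, red, if_neg hne, sub_zero] at h1 ⊢
  split_ifs <;> linarith

lemma Cone.of_succ {n : ℕ} (hL : S.Cone (n + 1) L) : S.Cone n L :=
  fun j => (hL j).trans_le (hL.desc_le j)

lemma Cone.mono {m n : ℕ} (hL : S.Cone n L) (hmn : m ≤ n) : S.Cone m L := by
  induction n, hmn using Nat.le_induction with
  | base => exact hL
  | succ n _ ih => exact ih hL.of_succ

lemma Cone.shift {k n : ℕ} (hL : S.Cone (k + n) L) : (S.shift k).Cone n (S.desc L k) := by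
  intro j; rw [desc_shift]; exact hL j

lemma Cone.lt {n : ℕ} (hL : S.Cone (n + 1) L) : S.desc L n (S.l n) < S.desc L n (S.w n) := by
  have h1 := hL (S.w n)
  simp only [desc, red, if_true] at h1
  linarith

lemma Cone.walk {n : ℕ} (hL : S.Cone n L) {h : Fin d → ℕ} {x y : ℝ} {m : ℕ}
    (hw : Walk (S.t n) (S.b n) (S.desc L n) (S.hts h n) x m y) :
    Walk (S.t 0) (S.b 0) L h x m y := by
  induction n with
  | zero => exact hw
  | succ n ih => exact ih hL.of_succ ((S.mv n).walk (hL.of_succ _).le hL.lt.le hw)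

lemma Cone.desc_antitone {m n : ℕ} (hL : S.Cone n L) (hmn : m ≤ n) (j : Fin d) :
    S.desc L n j ≤ S.desc L m j := by
  induction n, hmn using Nat.le_induction with
  | base => exact le_rfl
  | succ n _ ih => exact (hL.desc_le j).trans (ih hL.of_succ)

lemma Cone.desc_eq {m n : ℕ} (hmn : m ≤ n) {j : Fin d}
    (hj : ∀ i, m ≤ i → i < n → S.w i ≠ j) : S.desc L n j = S.desc L m j := by
  induction n, hmn using Nat.le_induction with
  | base => rfl
  | succ n hn ih =>
    rw [← ih fun i h1 h2 => hj i h1 (by omega)]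
    simp [desc, red, (hj n hn (by omega)).symm]

end RPath

/-- A quantity propagating from winners to losers along a path where every letter wins often
reaches all letters. -/
lemma RPath.propagate (S : RPath d) (V : ℕ → Fin d → Prop)
    (hmono : ∀ n j, V n j → V (n + 1) j) (hstep : ∀ n, V n (S.w n) → V (n + 1) (S.l n))
    {i : Fin d} (h0 : V 0 i) {B : ℕ → ℕ} (hB0 : B 0 = 0) (hBm : ∀ k, B k ≤ B (k + 1))
    (hB : ∀ k j, ∃ n, B k ≤ n ∧ n < B (k + 1) ∧ S.w n = j) (j : Fin d) : V (B (2 * d)) j := by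
  classical
  have hmono' : ∀ {m n}, m ≤ n → ∀ j, V m j → V n j := by
    intro m n hmn
    induction n, hmn using Nat.le_induction with
    | base => exact fun _ h => h
    | succ n _ ih => exact fun j h => hmono n j (ih j h)
  have hBm' : Monotone B := monotone_nat_of_le_succ hBm
  have key : ∀ k, k ≤ (univ.filter fun j => V (B (2 * k)) j).card ∨ ∀ j, V (B (2 * k)) j := by
    intro k
    induction k with
    | zero => left; omega
    | succ k ih =>
      rcases ih with ih | ih
      swap
      · right; exact fun j => hmono' (hBm' (by omega)) j (ih j)
      by_contra! hc
      obtain ⟨hc1, x, hx⟩ := hc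
      have hle : ∀ n, B (2 * k) ≤ n → n ≤ B (2 * (k + 1)) → ∀ j, V n j → V (B (2 * k)) j := by
        intro n h1 h2 j hj
        have hsub : (univ.filter fun j => V (B (2 * k)) j) ⊆ univ.filter fun j =>
            V (B (2 * (k + 1))) j := by
          intro j; simpa using hmono' (h1.trans h2) j
        have := Finset.eq_of_subset_of_card_le hsub (by omega)
        have hm : j ∈ univ.filter fun j => V (B (2 * (k + 1))) j := by
          simpa using hmono' h2 j hj
        rw [← this] at hm
        simpa using hm
      obtain ⟨n₀, h1, h2, h3⟩ := hB (2 * k) x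
      obtain ⟨n₁, h4, h5, h6⟩ := hB (2 * k + 1) i
      have hx' : ¬ V (B (2 * k)) x := fun h => hx (hmono' (hBm' (by omega)) x h)
      have hi : V (B (2 * k)) i := hmono' (by omega) i (hB0 ▸ h0)
      have e : B (2 * (k + 1)) = B (2 * k + 1 + 1) := rfl
      have out : ∀ n, n₀ ≤ n → n ≤ n₁ → ¬ V (B (2 * k)) (S.w n) := by
        intro n hn
        induction n, hn using Nat.le_induction with
        | base => intro _; rw [h3]; exact hx'
        | succ n hn ih =>
          intro hn1 hV
          have h7 := ih (by omega)
          rcases S.consecutive n with h8 | h8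
          · rw [h8] at hV; exact h7 hV
          · have h9 := hstep (n + 1) (hmono' (by omega) _ hV)
            rw [h8] at h9
            exact h7 (hle (n + 1 + 1) (by omega) (by rw [e]; omega) _ h9)
      exact out n₁ (by omega) le_rfl (h6 ▸ hi)
  rcases key d with h | h
  · have : (univ.filter fun j => V (B (2 * d)) j) = univ := by
      apply Finset.eq_univ_of_card
      have := Finset.card_le_univ (univ.filter fun j => V (B (2 * d)) j)
      rw [Fintype.card_fin] at *
      omega
    have hj := mem_univ j
    rw [← this] at hj
    simpa using hj
  · exact h j

/-- All lengths along a path are comparable to the inverse of a scale `M n`, which grows to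
infinity at bounded rate. -/
structure RPath.Balanced (S : RPath d) (L : Fin d → ℝ) (M : ℕ → ℝ) (c C : ℝ) : Prop where
  c_pos : 0 < c
  C_pos : 0 < C
  M_pos : ∀ n, 0 < M n
  mono : ∀ n, M n ≤ M (n + 1)
  le_two : ∀ n, M (n + 1) ≤ 2 * M n
  unbounded : ∀ K, ∃ n, K < M n
  le : ∀ n j, c ≤ M n * S.desc L n j
  ge : ∀ n j, M n * S.desc L n j ≤ C

namespace RPath
variable {S : RPath d} {L : Fin d → ℝ} {M : ℕ → ℝ} {c C : ℝ}

lemma sum_single_desc (S : RPath d) (v : Fin d → ℝ) (n : ℕ) (i : Fin d) :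
    ∑ j, (S.hts (Pi.single i 1) n j : ℝ) * S.desc v n j = v i := by
  rw [S.sum_hts_desc, Finset.sum_eq_single i]
  · simp
  · intro j _ hj; simp [Pi.single_eq_of_ne hj]
  · simp

namespace Balanced

lemma shift (H : S.Balanced L M c C) (k : ℕ) :
    (S.shift k).Balanced (S.desc L k) (fun n => M (k + n)) c C where
  c_pos := H.c_pos
  C_pos := H.C_pos
  M_pos n := H.M_pos _
  mono n := H.mono _
  le_two n := H.le_two _
  unbounded K := by
    obtain ⟨n, hn⟩ := H.unbounded K
    exact ⟨n, hn.trans_le (monotone_nat_of_le_succ H.mono (by omega))⟩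
  le n j := by rw [desc_shift]; exact H.le _ _
  ge n j := by rw [desc_shift]; exact H.ge _ _

lemma cone (H : S.Balanced L M c C) (n : ℕ) : S.Cone n L := fun j =>
  pos_of_mul_pos_right (H.c_pos.trans_le (H.le n j)) (H.M_pos n).le

lemma wins (H : S.Balanced L M c C) {m n : ℕ} (hmn : m ≤ n) (h : C / c * M m < M n) (j : Fin d) :
    ∃ i, m ≤ i ∧ i < n ∧ S.w i = j := by
  by_contra! hc
  have e := Cone.desc_eq (S := S) (L := L) hmn hc
  have h1 := H.le m j
  have h2 := H.ge n j
  rw [e] at h2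
  have h3 := H.cone m j
  have hc := H.c_pos
  rw [div_mul_eq_mul_div, div_lt_iff₀ hc] at h
  have h4 := mul_lt_mul_of_pos_right h h3
  nlinarith [mul_le_mul_of_nonneg_left h1 H.C_pos.le]

lemma exists_next (H : S.Balanced L M c C) (m : ℕ) :
    ∃ n, m ≤ n ∧ C / c * M m < M n ∧ M n ≤ 2 * (C / c + 1) * M m := by
  classical
  have hex : ∃ n, m ≤ n ∧ C / c * M m < M n := by
    obtain ⟨n, hn⟩ := H.unbounded (C / c * M m)
    exact ⟨max m n, le_max_left _ _,
      hn.trans_le (monotone_nat_of_le_succ H.mono (le_max_right _ _))⟩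
  refine ⟨Nat.find hex, (Nat.find_spec hex).1, (Nat.find_spec hex).2, ?_⟩
  have hm := H.M_pos m
  have hcC : 0 < C / c := div_pos H.C_pos H.c_pos
  have hpos := mul_pos hcC hm
  rcases (Nat.find_spec hex).1.eq_or_lt with h | h
  · rw [← h]; linarith
  · obtain ⟨n, hn⟩ : ∃ n, Nat.find hex = n + 1 := ⟨Nat.find hex - 1, by omega⟩
    have h1 := Nat.find_min hex (m := n) (by omega)
    rw [hn]
    have h2 : M n ≤ C / c * M m := by
      by_contra! h3; exact h1 ⟨by omega, h3⟩
    have := H.le_two n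
    linarith

/-- After a bounded number of scales every letter has been traversed by every tower. -/
lemma exists_positive (H : S.Balanced L M c C) :
    ∃ N, (∀ i j, 1 ≤ S.hts (Pi.single i 1) N j) ∧ M N ≤ (2 * (C / c + 1)) ^ (2 * d) * M 0 := by
  choose next h1 h2 h3 using H.exists_next
  let B : ℕ → ℕ := fun k => Nat.rec 0 (fun _ m => next m) k
  have hBs : ∀ k, B (k + 1) = next (B k) := fun k => rfl
  have hD : 0 < 2 * (C / c + 1) := by have := div_pos H.C_pos H.c_pos; linarith
  refine ⟨B (2 * d), fun i j => ?_, ?_⟩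
  · refine S.propagate (fun n j => 1 ≤ S.hts (Pi.single i 1) n j) ?_ ?_ (i := i) ?_
      (B := B) rfl (fun k => hBs k ▸ h1 _) (fun k j => H.wins (hBs k ▸ h1 _) (hBs k ▸ h2 _) j) j
    · exact fun n j h => h.trans (S.hts_succ_le _ _ _)
    · intro n h
      simp only [hts, inc, if_true]; omega
    · simp [hts]
  · have : ∀ k, M (B k) ≤ (2 * (C / c + 1)) ^ k * M 0 := by
      intro k
      induction k with
      | zero => simp [B]
      | succ k ih =>
        rw [hBs, pow_succ, mul_comm (_ ^ k), mul_assoc]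
        exact (h3 _).trans (mul_le_mul_of_nonneg_left ih hD.le)
    exact this _

lemma exists_contract [Nonempty (Fin d)] (H : S.Balanced L M c C) {δ : ℝ}
    (hδ : δ = c / (C * (2 * (C / c + 1)) ^ (2 * d))) :
    ∃ N, ∀ U, S.Cone N U → ∀ q r : ℝ, q ≤ r →
      (∀ j, q * S.desc L N j ≤ S.desc U N j ∧ S.desc U N j ≤ r * S.desc L N j) →
      ∃ q' r', q' ≤ r' ∧ r' - q' ≤ (1 - δ / 2) * (r - q) ∧
        ∀ j, q' * L j ≤ U j ∧ U j ≤ r' * L j := by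
  obtain ⟨N, hN1, hN2⟩ := H.exists_positive
  refine ⟨N, fun U hU q r hqr hqrU => ?_⟩
  set K := (2 * (C / c + 1)) ^ (2 * d)
  have hK : 0 < K := by have := div_pos H.C_pos H.c_pos; positivity
  have hLN := H.cone N
  have hL0 : ∀ j, 0 < L j := H.cone 0
  have hδL : ∀ i j, δ * L i ≤ S.desc L N j := by
    intro i j
    have h1 := H.ge 0 i
    have h2 := H.le N j
    have h3 : S.desc L 0 i = L i := rfl
    rw [h3] at h1
    rw [hδ, div_mul_eq_mul_div, div_le_iff₀ (mul_pos H.C_pos hK)]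
    have h4 : c ≤ K * M 0 * S.desc L N j :=
      h2.trans (mul_le_mul_of_nonneg_right hN2 (hLN j).le)
    have h5 : c * L i ≤ K * M 0 * S.desc L N j * L i :=
      mul_le_mul_of_nonneg_right h4 (hL0 i).le
    have h6 := mul_le_mul_of_nonneg_left h1 (mul_pos hK (hLN j)).le
    linarith
  have hA : ∀ i j, (1 : ℝ) ≤ S.hts (Pi.single i 1) N j := fun i j => by exact_mod_cast hN1 i j
  have hup : ∀ s : ℝ, (∀ j, S.desc U N j ≤ s * S.desc L N j) → ∀ i, U i ≤ s * L i := by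
    intro s hs i
    rw [← S.sum_single_desc U N i, ← S.sum_single_desc L N i, Finset.mul_sum]
    refine Finset.sum_le_sum fun j _ => ?_
    have := mul_le_mul_of_nonneg_left (hs j) (Nat.cast_nonneg (α := ℝ) (S.hts (Pi.single i 1) N j))
    linarith
  have hlow : ∀ i, q * L i ≤ U i := by
    intro i
    rw [← S.sum_single_desc U N i, ← S.sum_single_desc L N i, Finset.mul_sum]
    refine Finset.sum_le_sum fun j _ => ?_
    have := mul_le_mul_of_nonneg_left (hqrU j).1
      (Nat.cast_nonneg (α := ℝ) (S.hts (Pi.single i 1) N j))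
    linarith
  have hδ1 : 0 ≤ δ := by rw [hδ]; have := H.c_pos; have := H.C_pos; positivity
  have hδ2 : δ ≤ 1 := by
    obtain ⟨i⟩ := ‹Nonempty (Fin d)›
    have h1 := hδL i i
    have h2 := (H.cone N).desc_antitone (Nat.zero_le N) i
    have h3 : S.desc L 0 i = L i := rfl
    have h4 := hL0 i
    by_contra! h5
    nlinarith
  by_cases hcase : ∀ j, S.desc U N j ≤ (q + r) / 2 * S.desc L N j
  · refine ⟨q, (q + r) / 2, by linarith, by nlinarith, fun j => ⟨hlow j, hup _ hcase j⟩⟩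
  · push Not at hcase
    obtain ⟨j, hj⟩ := hcase
    refine ⟨q + δ * (r - q) / 2, r, ?_, by linarith, fun i => ⟨?_, hup _ (fun j => (hqrU j).2) i⟩⟩
    · nlinarith
    · have e : U i - q * L i = ∑ j, (S.hts (Pi.single i 1) N j : ℝ) *
          (S.desc U N j - q * S.desc L N j) := by
        simp only [mul_sub, Finset.sum_sub_distrib]
        rw [S.sum_single_desc U N i]
        congr 1
        rw [← S.sum_single_desc L N i, Finset.mul_sum]
        exact Finset.sum_congr rfl fun j _ => by ring
      have h1 : (S.hts (Pi.single i 1) N j : ℝ) * (S.desc U N j - q * S.desc L N j) ≤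
          ∑ j, (S.hts (Pi.single i 1) N j : ℝ) * (S.desc U N j - q * S.desc L N j) :=
        Finset.single_le_sum (f := fun j => (S.hts (Pi.single i 1) N j : ℝ) *
          (S.desc U N j - q * S.desc L N j))
          (fun j _ => mul_nonneg (Nat.cast_nonneg _) (by linarith [(hqrU j).1])) (mem_univ j)
      have h2 : S.desc U N j - q * S.desc L N j ≤
          (S.hts (Pi.single i 1) N j : ℝ) * (S.desc U N j - q * S.desc L N j) :=
        le_mul_of_one_le_left (by linarith [(hqrU j).1]) (hA i j)
      have h3 := mul_le_mul_of_nonneg_left (hδL i j) (sub_nonneg.2 hqr)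
      linarith

lemma exists_contract_pow [Nonempty (Fin d)] (H : S.Balanced L M c C) {δ : ℝ}
    (hδ : δ = c / (C * (2 * (C / c + 1)) ^ (2 * d))) (hδ1 : 0 ≤ 1 - δ / 2) (k : ℕ) :
    ∃ N, ∀ U, S.Cone N U → ∀ q r : ℝ, q ≤ r →
      (∀ j, q * S.desc L N j ≤ S.desc U N j ∧ S.desc U N j ≤ r * S.desc L N j) →
      ∃ q' r', q' ≤ r' ∧ r' - q' ≤ (1 - δ / 2) ^ k * (r - q) ∧
        ∀ j, q' * L j ≤ U j ∧ U j ≤ r' * L j := by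
  induction k generalizing S L M with
  | zero => exact ⟨0, fun U _ q r h1 h2 => ⟨q, r, h1, by simp, h2⟩⟩
  | succ k ih =>
    obtain ⟨N, hN⟩ := H.exists_contract hδ
    obtain ⟨N', hN'⟩ := ih (H.shift N)
    refine ⟨N + N', fun U hU q r hqr hqrU => ?_⟩
    obtain ⟨q₁, r₁, h1, h2, h3⟩ := hN' (S.desc U N) hU.shift q r hqr
      (by simpa only [desc_shift] using hqrU)
    obtain ⟨q₂, r₂, h4, h5, h6⟩ := hN U (hU.mono (by omega)) q₁ r₁ h1 h3
    refine ⟨q₂, r₂, h4, h5.trans ?_, h6⟩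
    rw [pow_succ', mul_assoc]
    exact mul_le_mul_of_nonneg_left h2 hδ1

lemma one_sub_mem [Nonempty (Fin d)] (H : S.Balanced L M c C) {δ : ℝ}
    (hδ : δ = c / (C * (2 * (C / c + 1)) ^ (2 * d))) : 0 ≤ 1 - δ / 2 ∧ 1 - δ / 2 < 1 := by
  obtain ⟨i⟩ := ‹Nonempty (Fin d)›
  have hc := H.c_pos
  have hC := H.C_pos
  have h1 := (H.le 0 i).trans (H.ge 0 i)
  have h2 : 0 < C / c := div_pos hC hc
  have h3 : (1 : ℝ) ≤ (2 * (C / c + 1)) ^ (2 * d) := one_le_pow₀ (by linarith)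
  have h4 : 0 < δ := by rw [hδ]; positivity
  have h5 : δ ≤ 1 := by
    rw [hδ, div_le_one (by positivity)]
    exact h1.trans (le_mul_of_one_le_right hC.le h3)
  constructor <;> linarith

/-- The cones of a balanced path shrink to a ray. -/
lemma cone_small [Nonempty (Fin d)] (H : S.Balanced L M c C) {C₂ : ℝ}
    (hC₂ : ∀ n j, M n ≤ C₂ * S.hts (fun _ => 1) n j) {ε : ℝ} (hε : 0 < ε) :
    ∃ n, ∀ U, S.Cone n U → ∑ j, U j = ∑ j, L j → ∀ j, |U j - L j| ≤ ε := by
  have hL0 : ∀ j, 0 < L j := H.cone 0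
  set s₀ := ∑ j, L j
  have hs : 0 < s₀ := Finset.sum_pos (fun j _ => hL0 j) univ_nonempty
  have hLle : ∀ j, L j ≤ s₀ := fun j => Finset.single_le_sum (fun k _ => (hL0 k).le) (mem_univ j)
  obtain ⟨h0, h1⟩ := H.one_sub_mem rfl
  set θ := 1 - c / (C * (2 * (C / c + 1)) ^ (2 * d)) / 2
  have hc := H.c_pos
  obtain ⟨i⟩ := ‹Nonempty (Fin d)›
  have hC₂0 : 0 < C₂ := by
    have h2 := hC₂ 0 i
    have h3 := H.M_pos 0
    by_contra! h4
    have h5 := mul_nonpos_of_nonpos_of_nonneg h4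
      (Nat.cast_nonneg (α := ℝ) (S.hts (fun _ => 1) 0 i))
    linarith
  set r := s₀ * C₂ / c
  have hr : 0 < r := by positivity
  obtain ⟨k, hk⟩ := exists_pow_lt_of_lt_one (x := ε / (r * s₀)) (by positivity) h1
  obtain ⟨N, hN⟩ := H.exists_contract_pow rfl h0 k
  refine ⟨N, fun U hU hUs j => ?_⟩
  obtain ⟨q', r', -, h2, h3⟩ := hN U hU 0 r hr.le (fun j => by
    refine ⟨by simpa using (hU j).le, ?_⟩
    have e := S.sum_hts_desc (fun _ => 1) U N
    simp only [Nat.cast_one, one_mul] at e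
    have h4 : (S.hts (fun _ => 1) N j : ℝ) * S.desc U N j ≤ s₀ := by
      rw [← hUs, ← e]
      exact Finset.single_le_sum (f := fun j => (S.hts (fun _ => 1) N j : ℝ) * S.desc U N j)
        (fun k _ => mul_nonneg (Nat.cast_nonneg _) (hU k).le) (mem_univ j)
    have h5 := H.le N j
    have h6 := hC₂ N j
    have hLN := H.cone N j
    have hMN := H.M_pos N
    have h7 : M N * S.desc U N j ≤ C₂ * s₀ := by
      have := mul_le_mul_of_nonneg_right h6 (hU j).le
      have := mul_le_mul_of_nonneg_left h4 hC₂0.le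
      linarith
    have h8 : c * S.desc U N j ≤ s₀ * C₂ * S.desc L N j := by
      have h9 := mul_le_mul_of_nonneg_right h5 (hU j).le
      have h10 := mul_le_mul_of_nonneg_right h7 hLN.le
      linarith
    rw [div_mul_eq_mul_div, le_div_iff₀ hc]
    linarith)
  have hq : q' ≤ 1 := by
    have := Finset.sum_le_sum fun j (_ : j ∈ univ) => (h3 j).1
    rw [← Finset.mul_sum, hUs] at this
    exact (mul_le_iff_le_one_left hs).1 this
  have hr' : 1 ≤ r' := by
    have := Finset.sum_le_sum fun j (_ : j ∈ univ) => (h3 j).2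
    rw [← Finset.mul_sum, hUs] at this
    exact (le_mul_iff_one_le_left hs).1 this
  have h4 : (r' - q') * s₀ ≤ ε := by
    rw [lt_div_iff₀ (by positivity)] at hk
    have := mul_le_mul_of_nonneg_right h2 hs.le
    rw [sub_zero] at this
    nlinarith
  have h5 := mul_le_mul_of_nonneg_left (hLle j) (by linarith : 0 ≤ r' - q')
  have h6 := (h3 j).1
  have h7 := (h3 j).2
  have h8 := mul_nonneg (sub_nonneg.2 hq) (hL0 j).le
  have h9 := mul_nonneg (sub_nonneg.2 hr') (hL0 j).le
  rw [abs_le]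
  constructor <;> linarith

end Balanced
end RPath

/-- A quantitative independence condition: integer combinations of the lengths are bounded below
in terms of the same combination of the integers `τ`. -/
def Sep (c : ℝ) (L : Fin d → ℝ) (τ : Fin d → ℤ) : Prop :=
  ∀ u : Fin d → ℤ, (∑ k, (u k : ℝ) * L k = 0 ∧ ∑ k, u k * τ k = 0) ∨
    c ≤ |∑ k, (u k : ℝ) * L k| * max 1 |((∑ k, u k * τ k : ℤ) : ℝ)|

lemma sum_mul_red {R : Type*} [CommRing R] (u v : Fin d → R) (w l : Fin d) :
    ∑ k, u k * red v w l k = ∑ k, (u k - if k = l then u w else 0) * v k := by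
  simp [red, mul_sub, sub_mul, Finset.sum_sub_distrib, ite_mul]

lemma Sep.red {c : ℝ} {L : Fin d → ℝ} {τ : Fin d → ℤ} (h : Sep c L τ) (w l : Fin d) :
    Sep c (red L w l) (red τ w l) := by
  intro u
  have := h fun k => u k - if k = l then u w else 0
  rw [sum_mul_red, sum_mul_red]
  simpa only [Int.cast_sub, Int.cast_ite, Int.cast_zero] using this

lemma Sep.neg {c : ℝ} {L : Fin d → ℝ} {τ : Fin d → ℤ} (h : Sep c L τ) :
    Sep c L (fun j => - τ j) := by
  intro u
  have := h u
  simpa only [mul_neg, Finset.sum_neg_distrib, neg_eq_zero, Int.cast_neg, abs_neg] using this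

lemma red_neg (τ : Fin d → ℤ) (w l : Fin d) :
    red (fun j => - τ j) w l = fun j => - red τ w l j := by
  funext j; simp only [red]; split_ifs <;> ring

/-- Heights of the rectangles of a suspension. -/
def hgt (t b : Equiv.Perm (Fin d)) (τ : Fin d → ℤ) (j : Fin d) : ℤ := lo t τ j - lo b τ j

lemma hgt_swap (t b : Equiv.Perm (Fin d)) (τ : Fin d → ℤ) (j : Fin d) :
    hgt b t (fun j => - τ j) j = hgt t b τ j := by
  simp only [hgt, lo_neg]; ring

/-- Suspension data over an interval exchange, with quantitative independence. -/
structure Geo (c : ℝ) (t b : Equiv.Perm (Fin d)) (L : Fin d → ℝ) (τ : Fin d → ℤ) : Prop where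
  irr : Irr t b
  susp : Susp t b τ
  pos : ∀ j, 0 < L j
  c_pos : 0 < c
  sep : Sep c L τ

namespace Geo
variable {c : ℝ} {t b : Equiv.Perm (Fin d)} {L : Fin d → ℝ} {τ : Fin d → ℤ}

lemma swap (H : Geo c t b L τ) : Geo c b t L (fun j => - τ j) :=
  ⟨H.irr.swap, H.susp.swap, H.pos, H.c_pos, H.sep.neg⟩

lemma hgt_nonneg (H : Geo c t b L τ) (j : Fin d) : 0 ≤ hgt t b τ j := by
  have := H.susp.top_nonneg j
  have := H.susp.bot_nonpos j
  unfold hgt; omega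

lemma ne_of_last (hd : 1 < d) (H : Geo c t b L τ) {α β : Fin d} (hα : (t α : ℕ) + 1 = d)
    (hβ : (b β : ℕ) + 1 = d) : α ≠ β := by
  rintro rfl
  have h1 := lo_last τ hα
  have h2 := lo_last τ hβ
  have h3 := H.susp.top α (by omega)
  have h4 := H.susp.bot α (by omega)
  omega

lemma hgt_pos (hd : 1 < d) (H : Geo c t b L τ) (j : Fin d) : 1 ≤ hgt t b τ j := by
  by_cases h : (t j : ℕ) = 0
  · by_cases h' : (b j : ℕ) = 0
    · obtain ⟨i, h1, h2⟩ := H.irr 1 one_pos hd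
      have : i = j := t.injective (Fin.ext (by omega))
      subst this; omega
    · have := H.susp.bot j h'
      have := H.susp.top_nonneg j
      unfold hgt; omega
  · have := H.susp.top j h
    have := H.susp.bot_nonpos j
    unfold hgt; omega

lemma topWin {b' : Equiv.Perm (Fin d)} {α β : Fin d} (hd : 1 < d) (H : Geo c t b L τ)
    (hm : TopWin t b b' α β) (hlt : L β < L α) :
    Geo c t b' (red L α β) (red τ α β) ∧
      ∀ j, hgt t b' (red τ α β) j = hgt t b τ j + if j = β then hgt t b τ α else 0 := by
  have e1 := lo_last τ hm.top_last
  have e2 := lo_last τ hm.bot_last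
  refine ⟨⟨hm.irr H.irr, ⟨fun j hj => ?_, fun j hj => ?_⟩, fun j => ?_, H.c_pos, H.sep.red _ _⟩,
    fun j => ?_⟩
  · rw [hm.lo_top]; exact H.susp.top j hj
  · by_cases hjβ : j = β
    · subst hjβ
      rw [hm.lo_bot_loser]
      have h1 := H.susp.bot_nonpos α
      have h2 := H.susp.top_nonneg α
      have h3 := H.susp.bot j (by have := hm.bot_last; omega)
      omega
    · rw [hm.lo_bot _ hjβ]
      refine H.susp.bot j fun h0 => hj ?_
      rw [hm.le j (Fin.le_def.2 (by omega))]; exact h0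
  · simp only [red]
    split_ifs with h
    · subst h; linarith
    · simpa using H.pos j
  · unfold hgt
    rw [hm.lo_top]
    by_cases hjβ : j = β
    · subst hjβ
      rw [hm.lo_bot_loser, if_pos rfl]; omega
    · rw [hm.lo_bot _ hjβ, if_neg hjβ]; omega

/-- One step of Rauzy induction is always possible. -/
lemma step (hd : 1 < d) (H : Geo c t b L τ) : ∃ t' b' w l, Mv t b t' b' w l ∧
    Geo c t' b' (red L w l) (red τ w l) ∧
    ∀ j, hgt t' b' (red τ w l) j = hgt t b τ j + if j = l then hgt t b τ w else 0 := by
  obtain ⟨α, hα⟩ : ∃ α, (t α : ℕ) + 1 = d := ⟨t.symm ⟨d - 1, by omega⟩, by simp; omega⟩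
  obtain ⟨β, hβ⟩ : ∃ β, (b β : ℕ) + 1 = d := ⟨b.symm ⟨d - 1, by omega⟩, by simp; omega⟩
  have hne := H.ne_of_last hd hα hβ
  rcases lt_trichotomy (L β) (L α) with h | h | h
  · obtain ⟨b', hb'⟩ := exists_topWin hne hα hβ
    exact ⟨t, b', α, β, Or.inl ⟨rfl, hb'⟩, H.topWin hd hb' h⟩
  · exfalso
    have e1 := lo_last τ hα
    have e2 := lo_last τ hβ
    have h2 := H.susp.top_nonneg α
    have h3 := H.susp.bot β (by omega)
    have hc := H.c_pos
    have := H.sep fun k => (if k = α then 1 else 0) - if k = β then 1 else 0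
    simp only [Int.cast_sub, Int.cast_ite, Int.cast_zero, Int.cast_one, sub_mul,
      Finset.sum_sub_distrib, ite_mul, one_mul, zero_mul, Finset.sum_ite_eq', mem_univ, if_true,
      h, sub_self, abs_zero] at this
    rcases this with h4 | h4
    · omega
    · linarith
  · obtain ⟨t', ht'⟩ := exists_topWin hne.symm hβ hα
    obtain ⟨h1, h2⟩ := H.swap.topWin hd ht' h
    refine ⟨t', b, β, α, Or.inr ⟨rfl, ht'⟩, ?_, fun j => ?_⟩
    · have := h1.swap
      rw [red_neg] at this
      simpa using this
    · have := h2 j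
      rw [red_neg] at this
      simpa only [hgt_swap] using this

end Geo

lemma card_lt_eq (t : Equiv.Perm (Fin d)) (x : Fin d) :
    (univ.filter fun k => t k < t x).card = t x := by
  have : univ.filter (fun k => t k < t x) = (Finset.Iio (t x)).map t.symm.toEmbedding := by
    ext k; simp
  rw [this, Finset.card_map, Fin.card_Iio]

/-- An irreducible permutation has no common final segment. -/
lemma Irr.not_final {t b : Equiv.Perm (Fin d)} (h : Irr t b) {G : Finset (Fin d)} {g y : Fin d}
    (hg : g ∈ G) (hy : y ∉ G) (ht : ∀ g ∈ G, ∀ y ∉ G, t y < t g) :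
    ∃ g ∈ G, ∃ y ∉ G, b g < b y := by
  by_contra! hb
  have hb' : ∀ g ∈ G, ∀ y ∉ G, b y < b g := fun g hg y hy =>
    lt_of_le_of_ne (hb g hg y hy) fun e => hy (b.injective e ▸ hg)
  have key : ∀ p : Equiv.Perm (Fin d), (∀ g ∈ G, ∀ y ∉ G, p y < p g) →
      (∀ y ∉ G, (p y : ℕ) < Gᶜ.card) ∧ ∀ g ∈ G, Gᶜ.card ≤ p g := by
    intro p hp
    constructor
    · intro y hy
      rw [← card_lt_eq]
      refine Finset.card_lt_card ⟨fun k hk => ?_, fun hsub => ?_⟩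
      · rw [mem_compl]
        intro hkG
        exact absurd (mem_filter.1 hk).2 (hp k hkG y hy).asymm
      · have := hsub (mem_compl.2 hy)
        simp at this
    · intro g hg
      rw [← card_lt_eq]
      refine Finset.card_le_card fun k hk => ?_
      simpa using hp g hg k (mem_compl.1 hk)
  obtain ⟨kt1, kt2⟩ := key t ht
  obtain ⟨kb1, kb2⟩ := key b hb'
  obtain ⟨i, h1, h2⟩ := h Gᶜ.card (Finset.card_pos.2 ⟨y, mem_compl.2 hy⟩)
    ((kb2 g hg).trans_lt (b g).isLt)
  have hi : i ∉ G := fun hi => by have := kt2 i hi; omega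
  have := kb1 i hi
  omega

lemma lo_next_or {M : Type*} [AddCommMonoid M] (t : Equiv.Perm (Fin d)) (v : Fin d → M)
    (x : Fin d) : (t x : ℕ) + 1 = d ∨ ∃ y, (t y : ℕ) = t x + 1 ∧ lo t v x + v x = lo t v y := by
  by_cases h : (t x : ℕ) + 1 = d
  · exact Or.inl h
  · right
    have := (t x).isLt
    have e : (t (t.symm ⟨t x + 1, by omega⟩) : ℕ) = t x + 1 := by simp
    exact ⟨_, e, (lo_succ v e).symm⟩

lemma exists_pred (t : Equiv.Perm (Fin d)) {y : Fin d} (h : (t y : ℕ) ≠ 0) :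
    ∃ x, (t y : ℕ) = t x + 1 := by
  have := (t y).isLt
  exact ⟨t.symm ⟨t y - 1, by omega⟩, by simp; omega⟩

namespace Geo
variable {c : ℝ} {t b : Equiv.Perm (Fin d)} {L : Fin d → ℝ} {τ : Fin d → ℤ}

lemma cluster (H : Geo c t b L τ) {A : ℝ} (hA : ∀ j, hgt t b τ j * L j ≤ A)
    {G : Finset (Fin d)} {M : ℝ} (hM1 : 1 ≤ M) (hM : ∀ x ∉ G, (hgt t b τ x : ℝ) ≤ M)
    (hx : ∀ x ∉ G, lo b τ x + τ x ≤ 0) (hG : ∃ g ∈ G, ∃ y ∉ G, t g < t y) :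
    ∃ j ∈ G, (hgt t b τ j : ℝ) ≤ d * A / c * M := by
  classical
  obtain ⟨g₁, hg₁, y₁, hy₁, hlt⟩ := hG
  obtain ⟨g, hg, hgmin⟩ := Finset.exists_min_image G (fun k => t k) ⟨g₁, hg₁⟩
  obtain ⟨y, hy, hymin⟩ := Finset.exists_min_image (univ.filter fun k => k ∉ G ∧ t g < t k)
    (fun k => t k) ⟨y₁, by simpa using ⟨hy₁, (hgmin _ hg₁).trans_lt hlt⟩⟩
  simp only [mem_filter, mem_univ, true_and] at hy hymin
  have htop : ∀ x ∉ G, lo t τ x ≤ hgt t b τ x := fun x _ => by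
    have := H.susp.bot_nonpos x; unfold hgt; omega
  have hR : ((lo t τ g : ℤ) : ℝ) ≤ M := by
    by_cases h0 : (t g : ℕ) = 0
    · rw [lo_first τ h0]; simp; linarith
    · obtain ⟨x, hxg⟩ := exists_pred t h0
      have hxG : x ∉ G := fun hxG => by
        have := Fin.le_def.1 (hgmin x hxG)
        omega
      rw [lo_succ τ hxg]
      refine le_trans ?_ (hM x hxG)
      have := hx x hxG
      exact_mod_cast (by unfold hgt; omega : lo t τ x + τ x ≤ hgt t b τ x)
  have hY : ((lo t τ y : ℤ) : ℝ) ≤ M :=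
    le_trans (by exact_mod_cast htop y hy.1) (hM y hy.1)
  set T := univ.filter fun k => t g ≤ t k ∧ t k < t y
  have hTG : ∀ k ∈ T, k ∈ G := by
    intro k hk
    obtain ⟨h1, h2⟩ := (mem_filter.1 hk).2
    by_contra hkG
    have hne : t g ≠ t k := fun e => hkG (t.injective e ▸ hg)
    exact absurd h2 (not_lt.2 (hymin k ⟨hkG, lt_of_le_of_ne h1 hne⟩))
  have hgT : g ∈ T := by simp [T, hy.2]
  have hsplit : ∀ v : Fin d → ℤ, lo t v y = lo t v g + ∑ k ∈ T, v k := by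
    intro v
    unfold lo
    rw [← Finset.sum_union]
    · refine Finset.sum_congr ?_ fun _ _ => rfl
      ext k
      simp only [T, mem_union, mem_filter, mem_univ, true_and]
      constructor
      · intro h
        rcases lt_or_ge (t k) (t g) with h' | h'
        · exact Or.inl h'
        · exact Or.inr ⟨h', h⟩
      · rintro (h | h)
        · exact h.trans hy.2
        · exact h.2
    · rw [Finset.disjoint_left]
      intro k hk hk'
      exact absurd (mem_filter.1 hk).2 (not_lt.2 (mem_filter.1 hk').2.1)
  have hτT : |((∑ k ∈ T, τ k : ℤ) : ℝ)| ≤ M := by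
    have h1 := hsplit τ
    have h2 : ((∑ k ∈ T, τ k : ℤ) : ℝ) = ((lo t τ y : ℤ) : ℝ) - ((lo t τ g : ℤ) : ℝ) := by
      rw [h1]; push_cast; ring
    have h3 : (0 : ℝ) ≤ ((lo t τ y : ℤ) : ℝ) := by exact_mod_cast H.susp.top_nonneg y
    have h4 : (0 : ℝ) ≤ ((lo t τ g : ℤ) : ℝ) := by exact_mod_cast H.susp.top_nonneg g
    rw [h2, abs_le]
    constructor <;> linarith
  have hLT : 0 < ∑ k ∈ T, L k := Finset.sum_pos (fun k _ => H.pos k) ⟨g, hgT⟩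
  have hsep : c ≤ (∑ k ∈ T, L k) * M := by
    have := H.sep fun k => if k ∈ T then 1 else 0
    simp only [Int.cast_ite, Int.cast_zero, Int.cast_one, ite_mul, one_mul, zero_mul,
      Finset.sum_ite_mem, Finset.univ_inter] at this
    rcases this with h | h
    · linarith [h.1]
    · rw [abs_of_pos hLT] at h
      exact h.trans (mul_le_mul_of_nonneg_left (max_le hM1 hτT) hLT.le)
  obtain ⟨j, hj, hjmax⟩ := Finset.exists_max_image T L ⟨g, hgT⟩
  refine ⟨j, hTG j hj, ?_⟩
  have h1 : ∑ k ∈ T, L k ≤ d * L j := by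
    refine (Finset.sum_le_card_nsmul T L (L j) hjmax).trans ?_
    rw [nsmul_eq_mul]
    refine mul_le_mul_of_nonneg_right ?_ (H.pos j).le
    have := T.card_le_univ
    rw [Fintype.card_fin] at this
    exact_mod_cast this
  have h2 : c ≤ d * L j * M := hsep.trans (mul_le_mul_of_nonneg_right h1 (by linarith))
  have h3 : (0 : ℝ) ≤ hgt t b τ j := by exact_mod_cast H.hgt_nonneg j
  rw [div_mul_eq_mul_div, le_div_iff₀ H.c_pos]
  have h4 := mul_le_mul_of_nonneg_left h2 h3
  have h5 : (hgt t b τ j * L j : ℝ) * (d * M) ≤ A * (d * M) :=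
    mul_le_mul_of_nonneg_right (hA j) (mul_nonneg (Nat.cast_nonneg _) (by linarith))
  linarith

/-- The heights of the rectangles have no large gaps. -/
lemma no_gap (H : Geo c t b L τ) {A : ℝ} (hA : ∀ j, hgt t b τ j * L j ≤ A)
    {G : Finset (Fin d)} {M : ℝ} (hM1 : 1 ≤ M) (hM : ∀ x ∉ G, (hgt t b τ x : ℝ) ≤ M)
    (hG : G.Nonempty) (hG' : ∃ y, y ∉ G) : ∃ j ∈ G, (hgt t b τ j : ℝ) ≤ d * A / c * M := by
  have main : ∀ {t b : Equiv.Perm (Fin d)} {τ : Fin d → ℤ}, Geo c t b L τ →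
      (∀ j, hgt t b τ j * L j ≤ A) → (∀ x ∉ G, (hgt t b τ x : ℝ) ≤ M) → ∑ j, τ j ≤ 0 →
      ∃ j ∈ G, (hgt t b τ j : ℝ) ≤ d * A / c * M := by
    intro t b τ H hA hM hσ
    obtain ⟨g, hg⟩ := hG
    obtain ⟨y, hy⟩ := hG'
    by_cases hfin : ∃ g ∈ G, ∃ y ∉ G, t g < t y
    · refine H.cluster hA hM1 hM (fun x _ => ?_) hfin
      rcases lo_next_or b τ x with h | ⟨z, -, h⟩
      · rw [lo_last τ h]; exact hσ
      · rw [h]; exact H.susp.bot_nonpos z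
    · push Not at hfin
      have ht : ∀ g ∈ G, ∀ y ∉ G, t y < t g := fun g hg y hy =>
        lt_of_le_of_ne (hfin g hg y hy) fun e => hy (t.injective e ▸ hg)
      obtain ⟨j, hj, hj'⟩ := H.swap.cluster (A := A) (G := G) (M := M)
        (fun j => by rw [hgt_swap]; exact hA j) hM1
        (fun x hx => by rw [hgt_swap]; exact hM x hx)
        (fun x hx => by
          rw [lo_neg]
          rcases lo_next_or t τ x with h | ⟨z, -, h⟩
          · have h1 := Fin.lt_def.1 (ht g hg x hx)
            have := (t g).isLt
            omega
          · have := H.susp.top_nonneg z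
            omega) (H.irr.not_final hg hy ht)
      exact ⟨j, hj, by rwa [hgt_swap] at hj'⟩
  rcases le_total (∑ j, τ j) 0 with h | h
  · exact main H hA hM h
  · obtain ⟨j, hj, hj'⟩ := main H.swap (fun j => by rw [hgt_swap]; exact hA j)
      (fun x hx => by rw [hgt_swap]; exact hM x hx) (by rw [Finset.sum_neg_distrib]; omega)
    exact ⟨j, hj, by rwa [hgt_swap] at hj'⟩

lemma le_pow_mul_of_no_gap {f : Fin d → ℝ} {K : ℝ} (hK : 1 ≤ K) (hf : ∀ j, 1 ≤ f j)
    (h : ∀ (G : Finset (Fin d)) (M : ℝ), 1 ≤ M → (∀ x ∉ G, f x ≤ M) → G.Nonempty →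
      (∃ y, y ∉ G) → ∃ j ∈ G, f j ≤ K * M) (i j : Fin d) : f j ≤ K ^ d * f i := by
  have key : ∀ k : ℕ, ∃ B : Finset (Fin d), i ∈ B ∧ (∀ x ∈ B, f x ≤ K ^ k * f i) ∧
      (k ≤ B.card ∨ B = univ) := by
    intro k
    induction k with
    | zero => exact ⟨{i}, by simp, by simp, Or.inl (Nat.zero_le _)⟩
    | succ k ih =>
      obtain ⟨B, hi, hB, hc⟩ := ih
      have hfi : 0 ≤ f i := by linarith [hf i]
      have hle : K ^ k * f i ≤ K ^ (k + 1) * f i := by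
        rw [pow_succ]
        exact mul_le_mul_of_nonneg_right (le_mul_of_one_le_right (by positivity) hK) hfi
      by_cases hu : B = univ
      · exact ⟨B, hi, fun x hx => (hB x hx).trans hle, Or.inr hu⟩
      · obtain ⟨j, hj, hj'⟩ := h Bᶜ (K ^ k * f i)
          (one_le_mul_of_one_le_of_one_le (one_le_pow₀ hK) (hf i))
          (fun x hx => hB x (by simpa using hx))
          (Finset.nonempty_iff_ne_empty.2 fun e => hu ((compl_eq_empty_iff B).1 e))
          ⟨i, by simpa using hi⟩
        have hjB : j ∉ B := mem_compl.1 hj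
        refine ⟨insert j B, mem_insert_of_mem hi, ?_, Or.inl ?_⟩
        · intro x hx
          rcases mem_insert.1 hx with rfl | hx
          · rw [pow_succ', mul_assoc]; exact hj'
          · exact (hB x hx).trans hle
        · rw [Finset.card_insert_of_notMem hjB]
          rcases hc with hc | hc
          · omega
          · exact absurd hc hu
  obtain ⟨B, -, hB, hc⟩ := key d
  have : B = univ := by
    rcases hc with hc | hc
    · exact Finset.eq_univ_of_card B (le_antisymm (B.card_le_univ) (by simpa using hc))
    · exact hc
  exact hB j (this ▸ mem_univ j)

end Geo

namespace Geo
variable {c : ℝ} {t b : Equiv.Perm (Fin d)} {L : Fin d → ℝ} {τ : Fin d → ℤ}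

lemma sum_hgt_le (hd : 1 < d) (H : Geo c t b L τ) {A : ℝ} (hA : ∑ j, hgt t b τ j * L j = A)
    (j : Fin d) : ∑ k, (hgt t b τ k : ℝ) ≤ d * (d * A / c + 1) ^ d * hgt t b τ j := by
  have h1 : ∀ j, (1 : ℝ) ≤ hgt t b τ j := fun j => by exact_mod_cast H.hgt_pos hd j
  have hnn : ∀ j, (0 : ℝ) ≤ hgt t b τ j * L j := fun j =>
    mul_nonneg (by linarith [h1 j]) (H.pos j).le
  have hA' : ∀ j, (hgt t b τ j : ℝ) * L j ≤ A := fun j => by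
    rw [← hA]
    exact Finset.single_le_sum (f := fun j => (hgt t b τ j : ℝ) * L j) (fun k _ => hnn k)
      (mem_univ j)
  have hA0 : 0 ≤ A := by rw [← hA]; exact Finset.sum_nonneg fun k _ => hnn k
  have hK : 0 ≤ d * A / c := div_nonneg (mul_nonneg (Nat.cast_nonneg _) hA0) H.c_pos.le
  have key := le_pow_mul_of_no_gap (f := fun j => (hgt t b τ j : ℝ)) (K := d * A / c + 1)
    (by linarith) h1 fun G M hM hG hne hne' => by
      obtain ⟨i, hi, hi'⟩ := H.no_gap hA' hM hG hne hne'
      exact ⟨i, hi, hi'.trans (mul_le_mul_of_nonneg_right (by linarith) (by linarith))⟩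
  refine (Finset.sum_le_card_nsmul univ _ _ fun k _ => key j k).trans ?_
  rw [nsmul_eq_mul, Finset.card_fin, mul_assoc]

lemma abs_le_sum_hgt (hd : 1 < d) (H : Geo c t b L τ) (j : Fin d) :
    |(τ j : ℝ)| ≤ ∑ k, (hgt t b τ k : ℝ) := by
  have hle : ∀ k, hgt t b τ k ≤ ∑ k, hgt t b τ k := fun k =>
    Finset.single_le_sum (fun k _ => H.hgt_nonneg k) (mem_univ k)
  have : |τ j| ≤ ∑ k, hgt t b τ k := by
    have h1 := H.susp.top_nonneg j
    have h2 := H.susp.bot_nonpos j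
    have h3 := hle j
    unfold hgt at h3
    rw [abs_le]
    rcases lo_next_or t τ j with ht | ⟨z, -, ht⟩
    · rcases lo_next_or b τ j with hb | ⟨z, -, hb⟩
      · exact absurd rfl (H.ne_of_last hd ht hb)
      · have h4 := H.susp.top_nonneg z
        have h5 := H.susp.bot_nonpos z
        have h6 := hle z
        unfold hgt at h6
        unfold hgt
        constructor <;> linarith
    · have h4 := H.susp.top_nonneg z
      have h5 := H.susp.bot_nonpos z
      have h6 := hle z
      unfold hgt at h6
      unfold hgt
      constructor <;> linarith
  exact_mod_cast this

lemma le_sum_hgt_mul (hd : 1 < d) (H : Geo c t b L τ) (j : Fin d) :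
    c ≤ (∑ k, (hgt t b τ k : ℝ)) * L j := by
  have h1 := H.abs_le_sum_hgt hd j
  have h2 : (1 : ℝ) ≤ ∑ k, (hgt t b τ k : ℝ) := by
    have h3 : hgt t b τ j ≤ ∑ k, hgt t b τ k :=
      Finset.single_le_sum (fun k _ => H.hgt_nonneg k) (mem_univ j)
    exact_mod_cast (H.hgt_pos hd j).trans h3
  have hp := H.pos j
  have := H.sep fun k => if k = j then 1 else 0
  simp only [Int.cast_ite, Int.cast_zero, Int.cast_one, ite_mul, one_mul, zero_mul,
    Finset.sum_ite_eq', mem_univ, if_true] at this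
  rcases this with h | h
  · linarith [h.1]
  · rw [abs_of_pos hp] at h
    rw [mul_comm]
    exact h.trans (mul_le_mul_of_nonneg_left (max_le h2 h1) hp.le)

/-- The Rauzy path of a quantitatively independent length vector is balanced. -/
lemma exists_balanced (hd : 1 < d) (H : Geo c t b L τ) : ∃ S : RPath d, S.t 0 = t ∧ S.b 0 = b ∧
    ∃ M C C₂, S.Balanced L M c C ∧ ∀ n j, M n ≤ C₂ * S.hts (fun _ => 1) n j := by
  classical
  have hstep : ∀ s : {s : Equiv.Perm (Fin d) × Equiv.Perm (Fin d) × (Fin d → ℝ) × (Fin d → ℤ) //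
      Geo c s.1 s.2.1 s.2.2.1 s.2.2.2}, ∃ s' : {s : Equiv.Perm (Fin d) × Equiv.Perm (Fin d) ×
      (Fin d → ℝ) × (Fin d → ℤ) // Geo c s.1 s.2.1 s.2.2.1 s.2.2.2}, ∃ w l,
      Mv s.1.1 s.1.2.1 s'.1.1 s'.1.2.1 w l ∧ s'.1.2.2.1 = red s.1.2.2.1 w l ∧
      s'.1.2.2.2 = red s.1.2.2.2 w l ∧ ∀ j, hgt s'.1.1 s'.1.2.1 s'.1.2.2.2 j =
        hgt s.1.1 s.1.2.1 s.1.2.2.2 j + if j = l then hgt s.1.1 s.1.2.1 s.1.2.2.2 w else 0 := by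
    rintro ⟨⟨t, b, L, τ⟩, H⟩
    obtain ⟨t', b', w, l, h1, h2, h3⟩ := H.step hd
    exact ⟨⟨⟨t', b', _, _⟩, h2⟩, w, l, h1, rfl, rfl, h3⟩
  choose next w l hmv hL hτ hh using hstep
  let s := fun n => next^[n] ⟨⟨t, b, L, τ⟩, H⟩
  have hs : ∀ n, s (n + 1) = next (s n) := fun n => Function.iterate_succ_apply' _ _ _
  let S : RPath d := ⟨fun n => (s n).1.1, fun n => (s n).1.2.1, fun n => w (s n), fun n => l (s n),
    fun n => by rw [hs]; exact hmv _⟩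
  have hdesc : ∀ n, S.desc L n = (s n).1.2.2.1 := by
    intro n
    induction n with
    | zero => rfl
    | succ n ih => rw [RPath.desc, ih, hs, hL]
  let g : ℕ → Fin d → ℤ := fun n => hgt (s n).1.1 (s n).1.2.1 (s n).1.2.2.2
  have hg : ∀ n j, g (n + 1) j = g n j + if j = l (s n) then g n (w (s n)) else 0 := by
    intro n j
    have := hh (s n) j
    rw [← hs] at this
    exact this
  have hgeo : ∀ n, Geo c (s n).1.1 (s n).1.2.1 (S.desc L n) (s n).1.2.2.2 := fun n => by
    rw [hdesc]; exact (s n).2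
  have hpos : ∀ n j, 1 ≤ g n j := fun n j => (hgeo n).hgt_pos hd j
  let h₀ : Fin d → ℕ := fun j => (g 0 j).toNat
  have hhts : ∀ n j, ((S.hts h₀ n j : ℕ) : ℤ) = g n j := by
    intro n
    induction n with
    | zero => intro j; exact Int.toNat_of_nonneg (by have := hpos 0 j; omega)
    | succ n ih =>
      intro j
      rw [hg, ← ih j, ← ih, RPath.hts, inc]
      push_cast
      rfl
  have hhtsR : ∀ n j, (S.hts h₀ n j : ℝ) = (g n j : ℝ) := fun n j => by
    rw [← hhts]; rfl
  set A := ∑ j, (g 0 j : ℝ) * L j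
  have hA : ∀ n, ∑ j, (g n j : ℝ) * S.desc L n j = A := by
    intro n
    have := S.sum_hts_desc h₀ L n
    simp only [hhtsR] at this
    rw [this]
    exact Finset.sum_congr rfl fun j _ => by rw [← hhtsR]; rfl
  have hgR : ∀ n j, (1 : ℝ) ≤ g n j := fun n j => by exact_mod_cast hpos n j
  have hLpos : ∀ n j, 0 < S.desc L n j := fun n => (hgeo n).pos
  have hj₀ : ∃ j : Fin d, True := ⟨⟨0, by omega⟩, trivial⟩
  obtain ⟨j₀, -⟩ := hj₀
  have hAj : ∀ n j, (g n j : ℝ) * S.desc L n j ≤ A := fun n j => by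
    rw [← hA n]
    exact Finset.single_le_sum (f := fun j => (g n j : ℝ) * S.desc L n j)
      (fun k _ => mul_nonneg (by linarith [hgR n k]) (hLpos n k).le) (mem_univ j)
  have hA0 : 0 < A := (mul_pos (by linarith [hgR 0 j₀]) (hLpos 0 j₀)).trans_le (hAj 0 j₀)
  have hc := H.c_pos
  set D : ℝ := d * (d * A / c + 1) ^ d
  have hd0 : (0 : ℝ) < d := by exact_mod_cast (by omega : 0 < d)
  have hD : 0 < D := by positivity
  have hM : ∀ n j, ∑ k, (g n k : ℝ) ≤ D * g n j := fun n j => (hgeo n).sum_hgt_le hd (hA n) j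
  have hle : ∀ n j, (g n j : ℝ) ≤ ∑ k, (g n k : ℝ) := fun n j =>
    Finset.single_le_sum (f := fun j => (g n j : ℝ)) (fun k _ => by linarith [hgR n k])
      (mem_univ j)
  have hsucc : ∀ n, ∑ k, (g (n + 1) k : ℝ) = ∑ k, (g n k : ℝ) + g n (w (s n)) := by
    intro n
    simp only [hg, Int.cast_add, Int.cast_ite, Int.cast_zero, Finset.sum_add_distrib,
      Finset.sum_ite_eq', mem_univ, if_true]
  refine ⟨S, rfl, rfl, fun n => ∑ k, (g n k : ℝ), D * A,
    D * (∑ k, S.hts h₀ 0 k : ℕ), ⟨hc, mul_pos hD hA0, ?_, ?_, ?_, ?_, ?_, ?_⟩, ?_⟩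
  · exact fun n => by linarith [hgR n j₀, hle n j₀]
  · exact fun n => by rw [hsucc]; linarith [hgR n (w (s n))]
  · exact fun n => by rw [hsucc]; linarith [hle n (w (s n))]
  · intro K
    obtain ⟨n, hn⟩ := exists_nat_gt K
    refine ⟨n, hn.trans_le ?_⟩
    have := S.le_sum_hts (h := h₀) (fun j => by
      have := hpos 0 j
      simp only [h₀]; omega) n
    simp only [← hhtsR]
    exact_mod_cast this
  · exact fun n j => (hgeo n).le_sum_hgt_mul hd j
  · intro n j
    have h1 := mul_le_mul_of_nonneg_right (hM n j) (hLpos n j).le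
    have h2 := mul_le_mul_of_nonneg_left (hAj n j) hD.le
    linarith
  · intro n j
    refine (hM n j).trans
      (le_of_le_of_eq (mul_le_mul_of_nonneg_left ?_ hD.le) (mul_assoc _ _ _).symm)
    rw [← hhtsR]
    exact_mod_cast S.hts_mono_mul (h' := fun _ => 1) (c := ∑ k, S.hts h₀ 0 k) (fun j => by
      rw [mul_one]
      exact Finset.single_le_sum (f := fun k => S.hts h₀ 0 k) (fun _ _ => Nat.zero_le _)
        (mem_univ j)) n j

end Geo

lemma one_le_mul_abs_add_sqrt_two {X Y : ℤ} (h : ¬ (X = 0 ∧ Y = 0)) :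
    1 ≤ 4 * max 1 |(Y : ℝ)| * |(X : ℝ) + √2 * Y| := by
  have hs : √2 * √2 = (2 : ℝ) := Real.mul_self_sqrt (by norm_num)
  have hs0 : 0 ≤ √2 := Real.sqrt_nonneg 2
  have hs2 : √2 ≤ (3 / 2 : ℝ) := by
    rw [Real.sqrt_le_left (by norm_num)]; norm_num
  have hne : X * X - 2 * (Y * Y) ≠ 0 := by
    intro e
    by_cases hY : Y = 0
    · subst hY
      exact h ⟨by simpa using e, rfl⟩
    · have h2 : Irrational √2 := by simpa using Nat.prime_two.irrational_sqrt
      apply h2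
      refine ⟨|(X / Y : ℚ)|, ?_⟩
      have hY' : (Y : ℝ) ≠ 0 := by exact_mod_cast hY
      have e' : (X : ℝ) * X = 2 * (Y * Y) := by
        have : X * X = 2 * (Y * Y) := by omega
        exact_mod_cast this
      push_cast
      rw [← Real.sqrt_sq_eq_abs, div_pow, pow_two, pow_two, e', mul_div_assoc,
        div_self (mul_ne_zero hY' hY'), mul_one]
  have h1 : (1 : ℝ) ≤ |(X : ℝ) + √2 * Y| * |(X : ℝ) - √2 * Y| := by
    rw [← abs_mul]
    have : ((X : ℝ) + √2 * Y) * (X - √2 * Y) = ((X * X - 2 * (Y * Y) : ℤ) : ℝ) := by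
      push_cast; linear_combination - (Y : ℝ) * Y * hs
    rw [this]
    exact_mod_cast Int.one_le_abs hne
  set a := |(X : ℝ) + √2 * Y|
  set m := max 1 |(Y : ℝ)|
  have hm1 : 1 ≤ m := le_max_left _ _
  have hmY : |(Y : ℝ)| ≤ m := le_max_right _ _
  have ha : 0 ≤ a := abs_nonneg _
  rcases le_total 1 a with h2 | h2
  · nlinarith
  · have h3 : |(X : ℝ) - √2 * Y| ≤ 4 * m := by
      have e : (X : ℝ) - √2 * Y = (X + √2 * Y) - 2 * √2 * Y := by ring
      rw [e]
      refine (abs_sub _ _).trans ?_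
      rw [abs_mul, abs_of_nonneg (by linarith : 0 ≤ 2 * √2)]
      have := mul_le_mul (by linarith : 2 * √2 ≤ 3) hmY (abs_nonneg _) (by norm_num)
      linarith
    have := mul_le_mul_of_nonneg_left h3 ha
    linarith

lemma sep_of_int {P τ : Fin d → ℤ} {s : ℝ} (hs : 0 < s) :
    Sep (s / 4) (fun j => s * ((P j : ℝ) + √2 * τ j)) τ := by
  intro u
  have e : ∑ k, (u k : ℝ) * (s * ((P k : ℝ) + √2 * τ k)) =
      s * (((∑ k, u k * P k : ℤ) : ℝ) + √2 * ((∑ k, u k * τ k : ℤ) : ℝ)) := by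
    push_cast
    rw [Finset.mul_sum, ← Finset.sum_add_distrib, Finset.mul_sum]
    exact Finset.sum_congr rfl fun k _ => by ring
  rw [e]
  by_cases h : (∑ k, u k * P k = 0 ∧ ∑ k, u k * τ k = 0)
  · left; rw [h.1, h.2]; simp
  · right
    have := one_le_mul_abs_add_sqrt_two h
    rw [abs_mul, abs_of_pos hs]
    have := mul_le_mul_of_nonneg_left this hs.le
    linarith

open Filter Topology in
/-- Quantitatively independent vectors are dense in the simplex. -/
lemma exists_sep {W : Set (Fin d → ℝ)} (hW : IsOpen W) {L₀ : Fin d → ℝ} (h₀ : L₀ ∈ W)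
    (hpos : ∀ j, 0 < L₀ j) (hsum : ∑ j, L₀ j = 1) (τ : Fin d → ℤ) :
    ∃ L ∈ W, (∀ j, 0 < L j) ∧ ∑ j, L j = 1 ∧ ∃ c, 0 < c ∧ Sep c L τ := by
  have hlim : Tendsto (fun n : ℕ => fun j => (((⌊L₀ j * n⌋₊ : ℤ) : ℝ) + √2 * τ j) / n) atTop
      (𝓝 L₀) := by
    rw [tendsto_pi_nhds]
    intro j
    have h1 := (tendsto_nat_floor_mul_div_atTop (hpos j).le).comp
      (tendsto_natCast_atTop_atTop (R := ℝ))
    have h2 := tendsto_const_div_atTop_nhds_zero_nat (√2 * (τ j : ℝ))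
    have := h1.add h2
    rw [add_zero] at this
    refine this.congr fun n => ?_
    simp [add_div]
  have hF : ContinuousAt (fun x : Fin d → ℝ => (∑ j, x j)⁻¹ • x) L₀ := by
    have h1 : ContinuousAt (fun x : Fin d → ℝ => ∑ j, x j) L₀ := by fun_prop
    exact (h1.inv₀ (by rw [hsum]; norm_num)).smul continuousAt_id
  have hFW : ∀ᶠ x in 𝓝 L₀, (∑ j, x j)⁻¹ • x ∈ W := by
    apply hF
    simp only [hsum, inv_one, one_smul]
    exact hW.mem_nhds h₀
  have hP : ∀ᶠ x in 𝓝 L₀, ∀ j, (0 : ℝ) < x j := by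
    rw [Filter.eventually_all]
    exact fun j => (continuous_apply j).continuousAt.eventually (lt_mem_nhds (hpos j))
  obtain ⟨n, ⟨h1, h2⟩, hn⟩ := ((hlim.eventually (hFW.and hP)).and (eventually_gt_atTop 0)).exists
  have hn' : (0 : ℝ) < n := by exact_mod_cast hn
  set x : Fin d → ℝ := fun j => (((⌊L₀ j * n⌋₊ : ℤ) : ℝ) + √2 * τ j) / n with hx
  have hne : Nonempty (Fin d) := by
    by_contra he
    rw [not_nonempty_iff] at he
    simp at hsum
  have hs : 0 < ∑ j, x j := Finset.sum_pos (fun j _ => h2 j) univ_nonempty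
  refine ⟨_, h1, fun j => ?_, ?_, (∑ j, x j)⁻¹ * (n : ℝ)⁻¹ / 4, by positivity, ?_⟩
  · simp only [Pi.smul_apply, smul_eq_mul]
    exact mul_pos (inv_pos.2 hs) (h2 j)
  · simp only [Pi.smul_apply, smul_eq_mul, ← Finset.mul_sum]
    exact inv_mul_cancel₀ hs.ne'
  · have := sep_of_int (P := fun j => (⌊L₀ j * n⌋₊ : ℤ)) (τ := τ)
      (s := (∑ j, x j)⁻¹ * (n : ℝ)⁻¹) (by positivity)
    convert this using 2
    simp only [Pi.smul_apply, smul_eq_mul, hx, div_eq_mul_inv]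
    ring

/-- The interval labelled `j`. -/
def itv (t : Equiv.Perm (Fin d)) (L : Fin d → ℝ) (j : Fin d) : Set ℝ :=
  Set.Ico (lo t L j) (lo t L j + L j)

lemma continuous_lo (t : Equiv.Perm (Fin d)) (j : Fin d) :
    Continuous fun L : Fin d → ℝ => lo t L j :=
  continuous_finsetSum _ fun k _ => continuous_apply k

lemma continuous_red (w l : Fin d) : Continuous fun L : Fin d → ℝ => red L w l := by
  refine continuous_pi fun j => ?_
  unfold red
  refine (continuous_apply j).sub ?_
  split_ifs
  · exact continuous_apply l
  · exact continuous_const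

/-- After one move, the new interval `j` is carried into the old interval `i` by `f` iterates,
uniformly in the lengths. -/
def Carries (t b t' : Equiv.Perm (Fin d)) (h : Fin d → ℕ) (w l j i : Fin d) (f : ℕ)
    (φ : (Fin d → ℝ) → ℝ) : Prop :=
  Continuous φ ∧ ∀ L : Fin d → ℝ, (∀ k, 0 < L k) → L l < L w → ∀ y ∈ itv t' (red L w l) j,
    Walk t b L h y f (y + φ L) ∧ y + φ L ∈ itv t L i

lemma red_of_ne {M : Type*} [AddCommGroup M] (v : Fin d → M) {w l j : Fin d} (h : j ≠ w) :
    red v w l j = v j := by simp [red, h]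

lemma red_self {M : Type*} [AddCommGroup M] (v : Fin d → M) (w l : Fin d) :
    red v w l w = v w - v l := by simp [red]

section
variable {t b t' b' : Equiv.Perm (Fin d)} {w l : Fin d}

lemma Carries.zero {h : Fin d → ℕ} {j i : Fin d} (H : ∀ L : Fin d → ℝ, (∀ k, 0 < L k) →
    L l < L w → itv t' (red L w l) j ⊆ itv t L i) : Carries t b t' h w l j i 0 fun _ => 0 :=
  ⟨continuous_const, fun L hL hlt y hy => by
    simp only [add_zero]; exact ⟨Walk.nil y, H L hL hlt hy⟩⟩

lemma Carries.single {h : Fin d → ℕ} {j i : Fin d} (k : Fin d) (H : ∀ L : Fin d → ℝ,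
    (∀ k, 0 < L k) → L l < L w → ∀ y ∈ itv t' (red L w l) j, y ∈ itv t L k ∧
      y - lo t L k + lo b L k ∈ itv t L i) :
    Carries t b t' h w l j i (h k) fun L => lo b L k - lo t L k :=
  ⟨(continuous_lo b k).sub (continuous_lo t k), fun L hL hlt y hy => by
    obtain ⟨h1, h2⟩ := H L hL hlt y hy
    have e : y + (lo b L k - lo t L k) = y - lo t L k + lo b L k := by ring
    rw [e]
    exact ⟨Walk.single k h1.1 h1.2 rfl, h2⟩⟩

lemma Mv.carries_self (H : Mv t b t' b' w l) (h : Fin d → ℕ) (j : Fin d) :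
    ∃ f φ, Carries t b t' h w l j j f φ := by
  rcases H with ⟨rfl, H⟩ | ⟨rfl, H⟩
  · refine ⟨0, _, Carries.zero fun L hL _ y hy => ?_⟩
    unfold itv at hy ⊢
    rw [H.lo_top] at hy
    refine ⟨hy.1, hy.2.trans_le ?_⟩
    unfold red
    split_ifs
    · linarith [hL l]
    · linarith
  · by_cases hj : j = l
    · subst hj
      refine ⟨_, _, Carries.single w fun L hL hlt y hy => ?_⟩
      unfold itv at hy ⊢
      rw [H.lo_bot_loser, red_of_ne _ H.ne.symm] at hy
      have e1 := lo_last L H.top_last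
      have e2 := lo_last L H.bot_last
      obtain ⟨h1, h2⟩ := hy
      refine ⟨⟨?_, ?_⟩, ?_, ?_⟩ <;> linarith
    · refine ⟨0, _, Carries.zero fun L hL _ y hy => ?_⟩
      unfold itv at hy ⊢
      rw [H.lo_bot _ hj] at hy
      refine ⟨hy.1, hy.2.trans_le ?_⟩
      unfold red
      split_ifs
      · linarith [hL l]
      · linarith

lemma Mv.carries_winner (H : Mv t b t' b' w l) (h : Fin d → ℕ) :
    ∃ f φ, Carries t b t' h w l l w f φ := by
  rcases H with ⟨rfl, H⟩ | ⟨rfl, H⟩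
  · refine ⟨_, _, Carries.single l fun L hL hlt y hy => ?_⟩
    unfold itv at hy ⊢
    rw [H.lo_top, red_of_ne _ H.ne.symm] at hy
    have e1 := lo_last L H.top_last
    have e2 := lo_last L H.bot_last
    obtain ⟨h1, h2⟩ := hy
    refine ⟨⟨h1, h2⟩, ?_, ?_⟩ <;> linarith
  · refine ⟨0, _, Carries.zero fun L hL hlt y hy => ?_⟩
    unfold itv at hy ⊢
    rw [H.lo_bot_loser, red_of_ne _ H.ne.symm] at hy
    obtain ⟨h1, h2⟩ := hy
    refine ⟨?_, ?_⟩ <;> linarith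

/-- Every point of an old interval is the image of a point of a new one. -/
lemma Mv.exists_carries (H : Mv t b t' b' w l) (h : Fin d → ℕ) {L : Fin d → ℝ} {z : ℝ}
    {i : Fin d} (hz : z ∈ itv t L i) :
    ∃ j f φ, Carries t b t' h w l j i f φ ∧ z - φ L ∈ itv t' (red L w l) j := by
  by_cases hi : i = w
  · subst hi
    by_cases hz' : z < lo t L i + (L i - L l)
    · refine ⟨i, 0, fun _ => 0, Carries.zero fun L hL _ y hy => ?_, ?_⟩
      · unfold itv at hy ⊢
        rcases H with ⟨rfl, H⟩ | ⟨rfl, H⟩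
        · rw [H.lo_top, red_self] at hy
          exact ⟨hy.1, by linarith [hL l, hy.2]⟩
        · rw [H.lo_bot _ H.ne, red_self] at hy
          exact ⟨hy.1, by linarith [hL l, hy.2]⟩
      · unfold itv at hz ⊢
        rw [sub_zero]
        rcases H with ⟨rfl, H⟩ | ⟨rfl, H⟩
        · rw [H.lo_top, red_self]; exact ⟨hz.1, hz'⟩
        · rw [H.lo_bot _ H.ne, red_self]; exact ⟨hz.1, hz'⟩
    · push Not at hz'
      rcases H with ⟨rfl, H⟩ | ⟨rfl, H⟩
      · refine ⟨l, _, _, Carries.single l fun L hL hlt y hy => ?_, ?_⟩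
        · unfold itv at hy ⊢
          rw [H.lo_top, red_of_ne _ H.ne.symm] at hy
          have e1 := lo_last L H.top_last
          have e2 := lo_last L H.bot_last
          obtain ⟨h1, h2⟩ := hy
          refine ⟨⟨h1, h2⟩, ?_, ?_⟩ <;> linarith
        · unfold itv at hz ⊢
          rw [H.lo_top, red_of_ne _ H.ne.symm]
          have e1 := lo_last L H.top_last
          have e2 := lo_last L H.bot_last
          obtain ⟨h1, h2⟩ := hz
          refine ⟨?_, ?_⟩ <;> linarith
      · refine ⟨l, 0, fun _ => 0, Carries.zero fun L hL hlt y hy => ?_, ?_⟩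
        · unfold itv at hy ⊢
          rw [H.lo_bot_loser, red_of_ne _ H.ne.symm] at hy
          obtain ⟨h1, h2⟩ := hy
          refine ⟨?_, ?_⟩ <;> linarith
        · unfold itv at hz ⊢
          rw [H.lo_bot_loser, red_of_ne _ H.ne.symm]
          obtain ⟨h1, h2⟩ := hz
          refine ⟨?_, ?_⟩ <;> linarith
  · rcases H with ⟨rfl, H⟩ | ⟨rfl, H⟩
    · refine ⟨i, 0, fun _ => 0, Carries.zero fun L hL _ y hy => ?_, ?_⟩
      · unfold itv at hy ⊢
        rwa [H.lo_top, red_of_ne _ hi] at hy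
      · unfold itv at hz ⊢
        rwa [H.lo_top, red_of_ne _ hi, sub_zero]
    · by_cases hil : i = l
      · subst hil
        refine ⟨i, _, _, Carries.single w fun L hL hlt y hy => ?_, ?_⟩
        · unfold itv at hy ⊢
          rw [H.lo_bot_loser, red_of_ne _ hi] at hy
          have e1 := lo_last L H.top_last
          have e2 := lo_last L H.bot_last
          obtain ⟨h1, h2⟩ := hy
          refine ⟨⟨?_, ?_⟩, ?_, ?_⟩ <;> linarith
        · unfold itv at hz ⊢
          rw [H.lo_bot_loser, red_of_ne _ hi]
          have e1 := lo_last L H.top_last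
          have e2 := lo_last L H.bot_last
          obtain ⟨h1, h2⟩ := hz
          refine ⟨?_, ?_⟩ <;> linarith
      · refine ⟨i, 0, fun _ => 0, Carries.zero fun L hL _ y hy => ?_, ?_⟩
        · unfold itv at hy ⊢
          rwa [H.lo_bot _ hil, red_of_ne _ hi] at hy
        · unfold itv at hz ⊢
          rwa [H.lo_bot _ hil, red_of_ne _ hi, sub_zero]

lemma Mv.first (H : Mv t b t' b' w l) {a : Fin d} (ha : (t a : ℕ) = 0) : (t' a : ℕ) = 0 := by
  rcases H with ⟨rfl, H⟩ | ⟨rfl, H⟩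
  · exact ha
  · rw [H.le a (Fin.le_def.2 (by omega))]; exact ha

end

namespace RPath
variable {S : RPath d} {L : Fin d → ℝ} {h : Fin d → ℕ}

lemma continuous_desc (S : RPath d) (n : ℕ) : Continuous fun L : Fin d → ℝ => S.desc L n := by
  induction n with
  | zero => exact continuous_id
  | succ n ih => exact (continuous_red _ _).comp ih

lemma first (S : RPath d) {a : Fin d} (ha : (S.t 0 a : ℕ) = 0) (n : ℕ) : (S.t n a : ℕ) = 0 := by
  induction n with
  | zero => exact ha
  | succ n ih => exact (S.mv n).first ih

/-- The interval `j` at time `m` is carried into the interval `i` at time `0` by `f` iterates,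
uniformly over the cone. -/
def Lands (S : RPath d) (h : Fin d → ℕ) (m : ℕ) (j i : Fin d) (f : ℕ)
    (φ : (Fin d → ℝ) → ℝ) : Prop :=
  Continuous φ ∧ ∀ L, S.Cone m L → ∀ y ∈ itv (S.t m) (S.desc L m) j,
    Walk (S.t 0) (S.b 0) L h y f (y + φ L) ∧ y + φ L ∈ itv (S.t 0) L i

lemma Lands.zero (S : RPath d) (h : Fin d → ℕ) (i : Fin d) : S.Lands h 0 i i 0 fun _ => 0 :=
  ⟨continuous_const, fun L _ y hy => by simp only [add_zero]; exact ⟨Walk.nil y, hy⟩⟩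

lemma Lands.trans {m k : ℕ} {i j i₀ : Fin d} {f f₀ : ℕ} {φ φ₀ : (Fin d → ℝ) → ℝ}
    (H : (S.shift m).Lands (S.hts h m) k j i f φ) (H₀ : S.Lands h m i i₀ f₀ φ₀) :
    S.Lands h (m + k) j i₀ (f + f₀) fun L => φ (S.desc L m) + φ₀ L := by
  refine ⟨(H.1.comp (S.continuous_desc m)).add H₀.1, fun L hL y hy => ?_⟩
  obtain ⟨h1, h2⟩ := H.2 (S.desc L m) hL.shift y (by rw [desc_shift]; exact hy)
  have hm : S.Cone m L := hL.mono (by omega)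
  obtain ⟨h3, h4⟩ := H₀.2 L hm _ h2
  rw [← add_assoc]
  exact ⟨(hm.walk h1).append h3, h4⟩

lemma Lands.succ {m : ℕ} {i j i₀ : Fin d} {f f₀ : ℕ} {φ φ₀ : (Fin d → ℝ) → ℝ}
    (H : Carries (S.t m) (S.b m) (S.t (m + 1)) (S.hts h m) (S.w m) (S.l m) j i f φ)
    (H₀ : S.Lands h m i i₀ f₀ φ₀) :
    S.Lands h (m + 1) j i₀ (f + f₀) fun L => φ (S.desc L m) + φ₀ L :=
  Lands.trans (S := S) (k := 1)
    ⟨H.1, fun L hL y hy => H.2 L (hL.mono (Nat.zero_le 1)) (Cone.lt (n := 0) hL) y hy⟩ H₀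

lemma exists_lands (S : RPath d) (h : Fin d → ℕ) {x : ℝ} {i : Fin d} (hx : x ∈ itv (S.t 0) L i)
    (m : ℕ) : ∃ j f φ, S.Lands h m j i f φ ∧ x - φ L ∈ itv (S.t m) (S.desc L m) j := by
  induction m with
  | zero => exact ⟨i, 0, _, Lands.zero S h i, by simpa [desc] using hx⟩
  | succ m ih =>
    obtain ⟨j, f, φ, h1, h2⟩ := ih
    obtain ⟨k, g, ψ, h3, h4⟩ := (S.mv m).exists_carries (S.hts h m) h2
    refine ⟨k, g + f, _, Lands.succ h3 h1, ?_⟩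
    rw [sub_add_eq_sub_sub_swap]
    exact h4

variable {M : ℕ → ℝ} {c C : ℝ}

lemma Balanced.exists_lands (H : S.Balanced L M c C) (h : Fin d → ℕ) (i a : Fin d) :
    ∃ k f φ, S.Lands h k a i f φ := by
  choose next h1 h2 h3 using H.exists_next
  let B : ℕ → ℕ := fun k => Nat.rec 0 (fun _ m => next m) k
  have hBs : ∀ k, B (k + 1) = next (B k) := fun k => rfl
  refine ⟨B (2 * d), S.propagate (fun n j => ∃ f φ, S.Lands h n j i f φ) ?_ ?_ (i := i) ?_
      (B := B) rfl (fun k => hBs k ▸ h1 _) (fun k j => H.wins (hBs k ▸ h1 _) (hBs k ▸ h2 _) j) a⟩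
  · rintro n j ⟨f, φ, hf⟩
    obtain ⟨g, ψ, hg⟩ := (S.mv n).carries_self (S.hts h n) j
    exact ⟨_, _, Lands.succ hg hf⟩
  · rintro n ⟨f, φ, hf⟩
    obtain ⟨g, ψ, hg⟩ := (S.mv n).carries_winner (S.hts h n)
    exact ⟨_, _, Lands.succ hg hf⟩
  · exact ⟨_, _, Lands.zero S h i⟩

lemma Balanced.exists_desc_lt (H : S.Balanced L M c C) {ε : ℝ} (hε : 0 < ε) :
    ∃ m, ∀ j, S.desc L m j < ε := by
  obtain ⟨m, hm⟩ := H.unbounded (C / ε)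
  refine ⟨m, fun j => ?_⟩
  rw [div_lt_iff₀ hε] at hm
  exact lt_of_mul_lt_mul_left ((H.ge m j).trans_lt hm) (H.M_pos m).le

/-- Points near the origin are carried close to a given point by a fixed number of iterates,
uniformly over a cone. -/
lemma Balanced.exists_offset (H : S.Balanced L M c C) (h : Fin d → ℕ) {a : Fin d}
    (ha : (S.t 0 a : ℕ) = 0) {x ε : ℝ} (hx0 : 0 ≤ x) (hx1 : x < ∑ j, L j) (hε : 0 < ε) :
    ∃ n f φ, Continuous φ ∧ |φ L - x| < ε ∧ ∀ L, S.Cone n L → ∀ y, 0 ≤ y → y < S.desc L n a →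
      Walk (S.t 0) (S.b 0) L h y f (y + φ L) := by
  obtain ⟨i, hi1, hi2⟩ := exists_mem_interval (t := S.t 0) hx0 hx1
  obtain ⟨m, hm⟩ := H.exists_desc_lt hε
  obtain ⟨j, f, φ, h1, h2⟩ := S.exists_lands h (show x ∈ itv (S.t 0) L i from ⟨hi1, hi2⟩) m
  obtain ⟨k, g, ψ, h3⟩ := (H.shift m).exists_lands (S.hts h m) j a
  have hmem : ∀ {L}, ∀ y, 0 ≤ y → y < S.desc L (m + k) a →
      y ∈ itv (S.t (m + k)) (S.desc L (m + k)) a := fun y h0 h1 => by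
    unfold itv
    rw [lo_first _ (S.first ha _)]
    exact ⟨h0, by simpa using h1⟩
  obtain ⟨h4, h5⟩ := Lands.trans h3 h1
  refine ⟨m + k, g + f, _, h4, ?_, fun L hL y hy0 hy1 => (h5 L hL y (hmem y hy0 hy1)).1⟩
  obtain ⟨-, h6⟩ := h3.2 (S.desc L m) ((H.cone (m + k)).shift) 0 (by
    rw [desc_shift]; exact hmem 0 le_rfl (H.cone _ _))
  unfold itv at h2 h6
  have h7 : (S.shift m).t 0 = S.t m := rfl
  rw [h7, zero_add] at h6
  have := hm j
  rw [abs_lt]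
  constructor <;> linarith [h2.1, h2.2, h6.1, h6.2]

end RPath

section
variable {t b : Equiv.Perm (Fin d)} {L : Fin d → ℝ} {h : Fin d → ℕ} {x y : ℝ} {m : ℕ}

lemma Walk.mem_Ico (hL : ∀ j, 0 ≤ L j) (hw : Walk t b L h x m y)
    (hx : x ∈ Set.Ico 0 (∑ j, L j)) : y ∈ Set.Ico 0 (∑ j, L j) := by
  induction hw with
  | nil x => exact hx
  | cons j h1 h2 _ ih =>
    refine ih ⟨?_, ?_⟩
    · linarith [lo_nonneg hL j (t := b)]
    · linarith [lo_add_le_sum hL j (t := b)]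

lemma ietMap_eq {π : Equiv.Perm (Fin d)} (hL : ∀ j, 0 ≤ L j) {j : Fin d}
    (h1 : lo (1 : Equiv.Perm (Fin d)) L j ≤ x) (h2 : x < lo (1 : Equiv.Perm (Fin d)) L j + L j) :
    ietMap π L x = x - lo (1 : Equiv.Perm (Fin d)) L j + lo π L j := by
  have hex : ∃ j : Fin d, x ∈ Set.Ico (leftEnd L j) (leftEnd L j + L j) := ⟨j, h1, h2⟩
  have hj : hex.choose = j := interval_unique (t := 1) hL hex.choose_spec.1 hex.choose_spec.2 h1 h2
  rw [ietMap, dif_pos hex, hj]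
  rfl

lemma Walk.iterate_ietMap {π : Equiv.Perm (Fin d)} (hL : ∀ j, 0 ≤ L j)
    (hw : Walk 1 π L (fun _ => 1) x m y) : (ietMap π L)^[m] x = y := by
  induction hw with
  | nil x => rfl
  | cons j h1 h2 _ ih =>
    rw [add_comm, Function.iterate_succ_apply, ietMap_eq hL h1 h2]
    exact ih

end

namespace RPath
variable (S : RPath d)

lemma desc_mul (c : ℝ) (L : Fin d → ℝ) (n : ℕ) :
    S.desc (fun j => c * L j) n = fun j => c * S.desc L n j := by
  induction n with
  | zero => rfl
  | succ n ih =>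
    funext j
    simp only [desc, ih, red]
    split_ifs <;> ring

lemma desc_surjective (n : ℕ) : Function.Surjective fun L : Fin d → ℝ => S.desc L n := by
  induction n with
  | zero => exact fun L => ⟨L, rfl⟩
  | succ n ih =>
    intro L
    obtain ⟨L', hL'⟩ := ih fun j => L j + if j = S.w n then L (S.l n) else 0
    refine ⟨L', ?_⟩
    funext j
    simp only at hL'
    simp [desc, hL', red, (S.mv n).ne.symm]

lemma ratIndep_desc {L : Fin d → ℝ} (hL : RatIndep L) (n : ℕ) : RatIndep (S.desc L n) := by
  induction n with
  | zero => exact hL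
  | succ n ih => exact ih.red (S.mv n).ne

lemma inv {h : Fin d → ℕ} (H : Inv (S.t 0, S.b 0, h)) (n : ℕ) :
    Inv (S.t n, S.b n, S.hts h n) := by
  induction n with
  | zero => exact H
  | succ n ih => exact Step.inv ⟨S.w n, S.l n, S.mv n, rfl⟩ ih

end RPath

/-- All sufficiently large iterates of `ietMap π L` send some point close to `p` to a point close
to `q`. -/
def Hits (π : Equiv.Perm (Fin d)) (L : Fin d → ℝ) (p q ε : ℝ) : Prop :=
  ∃ N : ℕ, ∀ k, N ≤ k → ∃ x ∈ Set.Ico (0 : ℝ) 1, |x - p| < ε ∧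
    (ietMap π L)^[k] x ∈ Set.Ico (0 : ℝ) 1 ∧ |(ietMap π L)^[k] x - q| < ε

lemma exists_open_hits (hd : 3 < d) {π : Equiv.Perm (Fin d)} (hirr : Irr 1 π) (hdeg : ¬ Deg 1 π)
    {W : Set (Fin d → ℝ)} (hW : IsOpen W) {L₀ : Fin d → ℝ} (h₀ : L₀ ∈ W) (hpos : ∀ j, 0 < L₀ j)
    (hsum : ∑ j, L₀ j = 1) {p q ε : ℝ} (hp : p ∈ Set.Ico (0 : ℝ) 1) (hq : q ∈ Set.Ico (0 : ℝ) 1)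
    (hε : 0 < ε) :
    ∃ O : Set (Fin d → ℝ), IsOpen O ∧ (∃ L ∈ O, L ∈ W ∧ (∀ j, 0 < L j) ∧ ∑ j, L j = 1) ∧
      ∀ L ∈ O, ∑ j, L j = 1 → RatIndep L → Hits π L p q ε := by
  have : NeZero d := ⟨by omega⟩
  obtain ⟨K, hKW, hKpos, hKsum, c, hc, hsep⟩ := exists_sep hW h₀ hpos hsum fun i => (π i : ℤ) - i
  obtain ⟨S, hS0, hS1, M, C, C₂, H, hC₂⟩ :=
    Geo.exists_balanced (by omega) (⟨hirr, hirr.susp, hKpos, hc, hsep⟩ : Geo c 1 π K _)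
  set a : Fin d := ⟨0, by omega⟩
  have ha : (S.t 0 a : ℕ) = 0 := by rw [hS0]; rfl
  obtain ⟨n₁, f, φ, hφ, hφK, hf⟩ :=
    H.exists_offset (fun _ => 1) ha hp.1 (hKsum ▸ hp.2) (half_pos hε)
  obtain ⟨n₂, g, ψ, hψ, hψK, hg⟩ :=
    H.exists_offset (fun _ => 1) ha hq.1 (hKsum ▸ hq.2) (half_pos hε)
  set r := min (min (S.desc K n₁ a) (S.desc K n₂ a)) (ε / 2) with hr
  have hr0 : 0 < r := lt_min (lt_min (H.cone _ _) (H.cone _ _)) (half_pos hε)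
  have hd0 : (0 : ℝ) < d := by exact_mod_cast (by omega : 0 < d)
  obtain ⟨n₃, hn₃⟩ := H.exists_desc_lt (div_pos hr0 hd0)
  have hsmall : ∑ j, S.desc K n₃ j < r := by
    calc ∑ j, S.desc K n₃ j < ∑ _j : Fin d, r / d :=
          Finset.sum_lt_sum_of_nonempty univ_nonempty fun j _ => hn₃ j
      _ = r := by
          rw [Finset.sum_const, card_univ, Fintype.card_fin, nsmul_eq_mul]
          field_simp
  have cdesc : ∀ n j, Continuous fun L : Fin d → ℝ => S.desc L n j := fun n j =>
    (continuous_apply j).comp (S.continuous_desc n)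
  have csum : Continuous fun L : Fin d → ℝ => ∑ j, S.desc L n₃ j :=
    continuous_finsetSum _ fun j _ => cdesc n₃ j
  have hr1 : r ≤ S.desc K n₁ a := (min_le_left _ _).trans (min_le_left _ _)
  have hr2 : r ≤ S.desc K n₂ a := (min_le_left _ _).trans (min_le_right _ _)
  have hr3 : r ≤ ε / 2 := min_le_right _ _
  have hnhds : ∀ᶠ L in nhds K, L ∈ W ∧ |φ L - p| < ε / 2 ∧ |ψ L - q| < ε / 2 ∧
      ∑ j, S.desc L n₃ j < S.desc L n₁ a ∧ ∑ j, S.desc L n₃ j < S.desc L n₂ a ∧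
      ∑ j, S.desc L n₃ j < ε / 2 := by
    refine Filter.Eventually.and (hW.mem_nhds hKW) <| .and ?_ <| .and ?_ <| .and ?_ <| .and ?_ ?_
    · exact (hφ.sub continuous_const).abs.continuousAt.eventually_lt continuousAt_const hφK
    · exact (hψ.sub continuous_const).abs.continuousAt.eventually_lt continuousAt_const hψK
    · exact csum.continuousAt.eventually_lt (cdesc _ _).continuousAt (hsmall.trans_le hr1)
    · exact csum.continuousAt.eventually_lt (cdesc _ _).continuousAt (hsmall.trans_le hr2)
    · exact csum.continuousAt.eventually_lt continuousAt_const (hsmall.trans_le hr3)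
  obtain ⟨η, hη, hball⟩ := Metric.eventually_nhds_iff_ball.1 hnhds
  obtain ⟨n₄, hn₄⟩ := H.cone_small hC₂ (half_pos hη)
  obtain ⟨n, h1, h2, h3, h4⟩ : ∃ n, n₁ ≤ n ∧ n₂ ≤ n ∧ n₃ ≤ n ∧ n₄ ≤ n :=
    ⟨n₁ + n₂ + n₃ + n₄, by omega, by omega, by omega, by omega⟩
  have hinv : Inv (S.t 0, S.b 0, fun _ => 1) := by
    rw [hS0, hS1]
    exact ⟨hirr, hdeg, fun m hm => Nat.dvd_one.1 (hm a), fun _ => one_pos⟩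
  obtain ⟨O, hO, ⟨K', hK'⟩, hcone, hOpos, hOgood⟩ := (S.inv hinv n).good hd
  have hball' : ∀ L, S.desc L n ∈ O → ∑ j, L j = 1 → L ∈ Metric.ball K η := by
    intro L hL hL1
    rw [Metric.mem_ball, dist_pi_lt_iff hη]
    intro j
    rw [Real.dist_eq]
    have hL' : S.Cone n L := hOpos _ hL
    linarith [hn₄ L (hL'.mono h4) (by rw [hL1, hKsum]) j]
  refine ⟨(fun L => S.desc L n) ⁻¹' O, hO.preimage (S.continuous_desc n), ?_, ?_⟩
  · obtain ⟨v, hv⟩ := S.desc_surjective n K'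
    simp only at hv
    have hvc : S.Cone n v := fun j => by rw [hv]; exact hOpos _ hK' j
    have hv0 : ∀ j, 0 < v j := hvc.mono (Nat.zero_le n)
    have hs : 0 < ∑ j, v j := Finset.sum_pos (fun j _ => hv0 j) univ_nonempty
    have hmem : S.desc (fun j => (∑ j, v j)⁻¹ * v j) n ∈ O := by
      rw [S.desc_mul, hv]; exact hcone _ hK' _ (inv_pos.2 hs)
    have hs1 : ∑ j, (∑ j, v j)⁻¹ * v j = 1 := by
      rw [← Finset.mul_sum, inv_mul_cancel₀ hs.ne']
    exact ⟨_, hmem, (hball _ (hball' _ hmem hs1)).1, fun j => mul_pos (inv_pos.2 hs) (hv0 j), hs1⟩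
  · intro L hL hL1 hind
    have hL' : S.Cone n L := hOpos _ hL
    have hL0 : ∀ j, 0 ≤ L j := fun j => (hL'.mono (Nat.zero_le n) j).le
    obtain ⟨-, b1, b2, b3, b4, b5⟩ := hball _ (hball' _ hL hL1)
    obtain ⟨N, hN⟩ := hOgood _ hL (S.ratIndep_desc hind n)
    have hle : ∑ j, S.desc L n j ≤ ∑ j, S.desc L n₃ j :=
      Finset.sum_le_sum fun j _ => hL'.desc_antitone h3 j
    refine ⟨N + g, fun k hk => ?_⟩
    obtain ⟨s, s', s0, s1, s0', s1', hw⟩ := hN (k + f - g) (by omega)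
    have w1 := hL'.walk hw
    have w2 := hf L (hL'.mono h1) s s0 (by linarith)
    have w3 := hg L (hL'.mono h2) s' s0' (by linarith)
    have hle0 : ∑ j, S.desc L n j ≤ 1 := hL1 ▸
      Finset.sum_le_sum fun j _ => hL'.desc_antitone (Nat.zero_le n) j
    have m2 := w2.mem_Ico hL0 ⟨s0, by linarith⟩
    have m3 := w3.mem_Ico hL0 ⟨s0', by linarith⟩
    rw [hS0, hS1] at w1 w2 w3
    have e : (ietMap π L)^[k] (s + φ L) = s' + ψ L := by
      rw [← w2.iterate_ietMap hL0, ← Function.iterate_add_apply,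
        show k + f = g + (k + f - g) by omega, Function.iterate_add_apply,
        w1.iterate_ietMap hL0, w3.iterate_ietMap hL0]
    rw [hL1] at m2 m3
    refine ⟨s + φ L, m2, ?_, e ▸ m3, ?_⟩
    · rw [abs_lt] at b1 ⊢
      constructor <;> linarith
    · rw [e]
      rw [abs_lt] at b2 ⊢
      constructor <;> linarith

lemma eventually_residual_sum_ne_zero {a : Fin d → ℝ} (ha : a ≠ 0) :
    ∀ᶠ L : stdSimplex ℝ (Fin d) in residual (stdSimplex ℝ (Fin d)),
      ∑ j, a j * (L : Fin d → ℝ) j ≠ 0 := by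
  have hcont : Continuous fun L : Fin d → ℝ => ∑ j, a j * L j :=
    continuous_finsetSum _ fun j _ => continuous_const.mul (continuous_apply j)
  refine residual_of_dense_open
    (isOpen_ne_fun (hcont.comp continuous_subtype_val) continuous_const) fun L => ?_
  by_cases hL : ∑ j, a j * (L : Fin d → ℝ) j = 0
  swap
  · exact subset_closure hL
  obtain ⟨i, hi⟩ := Function.ne_iff.1 ha
  let P : ℝ → Fin d → ℝ := fun s j =>
    (1 - s) * (L : Fin d → ℝ) j + s * (Pi.single i 1 : Fin d → ℝ) j
  have hP : ∀ s ∈ Set.Icc (0 : ℝ) 1, P s ∈ stdSimplex ℝ (Fin d) := fun s hs =>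
    convex_stdSimplex ℝ (Fin d) L.2 (single_mem_stdSimplex ℝ i) (by linarith [hs.2]) hs.1
      (by ring)
  have hPc : Continuous P := by fun_prop
  let Q : ℝ → stdSimplex ℝ (Fin d) := fun s =>
    ⟨P (Set.projIcc (0 : ℝ) 1 zero_le_one s), hP _ (Subtype.coe_prop _)⟩
  have hQ : Continuous Q := Continuous.subtype_mk
    (hPc.comp (continuous_subtype_val.comp continuous_projIcc)) _
  have hQ0 : Q 0 = L := by
    apply Subtype.ext
    funext j
    simp only [Q, P, Set.projIcc_left, sub_zero, one_mul, zero_mul, add_zero]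
    rfl
  refine mem_closure_of_tendsto (b := nhdsWithin (0 : ℝ) (Set.Ioi 0)) (f := Q) ?_ ?_
  · have := hQ.tendsto 0
    rw [hQ0] at this
    exact this.mono_left nhdsWithin_le_nhds
  · filter_upwards [Ioo_mem_nhdsGT (zero_lt_one' ℝ)] with s hs
    have hQs : (Q s : Fin d → ℝ) = P s := by
      simp only [Q]
      rw [Set.projIcc_of_mem zero_le_one ⟨hs.1.le, hs.2.le⟩]
      rfl
    show ∑ j, a j * (Q s : Fin d → ℝ) j ≠ 0
    have e : ∑ j, a j * P s j = (1 - s) * ∑ j, a j * (L : Fin d → ℝ) j + s * a i := by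
      simp only [P, mul_add, Finset.sum_add_distrib, Finset.mul_sum]
      congr 1
      · exact Finset.sum_congr rfl fun j _ => by ring
      · simp [Pi.single_apply, mul_comm]
    rw [hQs, e, hL, mul_zero, zero_add]
    exact mul_ne_zero hs.1.ne' hi

lemma eventually_residual_ratIndep :
    ∀ᶠ L : stdSimplex ℝ (Fin d) in residual (stdSimplex ℝ (Fin d)), RatIndep (L : Fin d → ℝ) := by
  have : ∀ᶠ L : stdSimplex ℝ (Fin d) in residual (stdSimplex ℝ (Fin d)), ∀ u : Fin d → ℤ, u ≠ 0 →
      ∑ j, (u j : ℝ) * (L : Fin d → ℝ) j ≠ 0 := by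
    refine eventually_countable_forall.2 fun u => ?_
    by_cases hu : u = 0
    · exact .of_forall fun L h => absurd hu h
    · refine (eventually_residual_sum_ne_zero (a := fun j => (u j : ℝ)) fun h => hu ?_).mono
        fun L hL _ => hL
      funext j
      simpa using congrFun h j
  filter_upwards [this] with L hL u hu
  by_contra hne
  exact hL u hne hu

lemma RatIndep.pos {L : Fin d → ℝ} (h : RatIndep L) (hL : L ∈ stdSimplex ℝ (Fin d)) (j : Fin d) :
    0 < L j := by
  refine lt_of_le_of_ne (hL.1 j) fun h0 => ?_
  have := congrFun (h (Pi.single j 1) (by simp [Pi.single_apply, ← h0])) j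
  simp at this

lemma eventually_residual_hits (hd : 3 < d) {π : Equiv.Perm (Fin d)} (hirr : Irr 1 π)
    (hdeg : ¬ Deg 1 π) {p q ε : ℝ} (hp : p ∈ Set.Ico (0 : ℝ) 1) (hq : q ∈ Set.Ico (0 : ℝ) 1)
    (hε : 0 < ε) :
    ∀ᶠ L : stdSimplex ℝ (Fin d) in residual (stdSimplex ℝ (Fin d)), RatIndep (L : Fin d → ℝ) →
      Hits π (L : Fin d → ℝ) p q ε := by
  refine Filter.mem_of_superset (residual_of_dense_open isOpen_interior ?_) interior_subset
  rw [dense_iff_inter_open]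
  rintro U hU hne
  obtain ⟨W, hW, rfl⟩ := isOpen_induced_iff.1 hU
  obtain ⟨L₀, hL₀, hind⟩ := (dense_of_mem_residual eventually_residual_ratIndep).inter_open_nonempty
    _ hU hne
  obtain ⟨O, hO, ⟨L₁, h1, h2, h3, h4⟩, h5⟩ := exists_open_hits hd hirr hdeg hW hL₀
    (RatIndep.pos hind L₀.2) L₀.2.2 hp hq hε
  refine ⟨⟨L₁, fun j => (h3 j).le, h4⟩, h2, mem_interior.2 ⟨Subtype.val ⁻¹' O, ?_,
    hO.preimage continuous_subtype_val, h1⟩⟩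
  exact fun L hL => h5 L hL L.2.2

lemma topMixingOn_of_hits {π : Equiv.Perm (Fin d)} {L : Fin d → ℝ}
    (H : ∀ p q ε : ℚ, (p : ℝ) ∈ Set.Ico (0 : ℝ) 1 → (q : ℝ) ∈ Set.Ico (0 : ℝ) 1 → 0 < (ε : ℝ) →
      Hits π L p q ε) : TopMixingOn (ietMap π L) (Set.Ico (0 : ℝ) 1) := by
  have key : ∀ U : Set ℝ, IsOpen U → (U ∩ Set.Ico (0 : ℝ) 1).Nonempty → ∃ (p : ℚ) (δ : ℝ), 0 < δ ∧
      (p : ℝ) ∈ Set.Ico (0 : ℝ) 1 ∧ ∀ x : ℝ, |x - p| < δ → x ∈ U := by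
    rintro U hU ⟨x, hxU, hx0, hx1⟩
    obtain ⟨δ, hδ, hball⟩ := Metric.isOpen_iff.1 hU x hxU
    obtain ⟨p, hp1, hp2⟩ := exists_rat_btwn (lt_min hx1 (by linarith : x < x + δ / 2))
    rw [lt_min_iff] at hp2
    refine ⟨p, δ / 2, half_pos hδ, ⟨by linarith, hp2.1⟩, fun y hy => hball ?_⟩
    rw [Metric.mem_ball, Real.dist_eq]
    rw [abs_lt] at hy ⊢
    constructor <;> linarith
  intro U V hU hV hUne hVne
  obtain ⟨p, δ, hδ, hp, hpU⟩ := key U hU hUne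
  obtain ⟨q, δ', hδ', hq, hqV⟩ := key V hV hVne
  obtain ⟨ε, hε0, hε⟩ := exists_rat_btwn (lt_min hδ hδ')
  rw [lt_min_iff] at hε
  obtain ⟨N, hN⟩ := H p q ε hp hq hε0
  refine ⟨N, fun n hn => ?_⟩
  obtain ⟨x, hx, h1, h2, h3⟩ := hN n hn
  exact ⟨_, ⟨x, ⟨hpU x (h1.trans hε.1), hx⟩, rfl⟩, hqV _ (h3.trans hε.2), h2⟩

end

/-- For `d > 3` and an irreducible non-degenerate permutation `π` of
`{1,…,d}`, the set of length vectors `L` in the simplex `Δ_{d-1}` with all entries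
strictly positive such that `T_{L,π}` is topologically mixing on `[0,1)` is residual:
it contains a dense Gδ subset of `Δ_{d-1}` (with its subspace topology). -/
theorem residual_set_topologically_mixing {d : ℕ} (hd : 3 < d)
    (π : Equiv.Perm (Fin d)) (hirr : IsIrreducible π) (hnd : ¬ IsDegenerate π) :
    ∃ G : Set (stdSimplex ℝ (Fin d)), IsGδ G ∧ Dense G ∧
      ∀ L ∈ G, (∀ i, 0 < (L : Fin d → ℝ) i) ∧
        TopMixingOn (ietMap π (L : Fin d → ℝ)) (Set.Ico (0 : ℝ) 1) := by
  have hhits : ∀ᶠ L : stdSimplex ℝ (Fin d) in residual (stdSimplex ℝ (Fin d)), ∀ p q ε : ℚ,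
      (p : ℝ) ∈ Set.Ico (0 : ℝ) 1 → (q : ℝ) ∈ Set.Ico (0 : ℝ) 1 → 0 < (ε : ℝ) →
      RatIndep (L : Fin d → ℝ) → Hits π (L : Fin d → ℝ) p q ε := by
    simp only [eventually_countable_forall]
    exact fun p q ε hp hq hε => eventually_residual_hits hd (irr_of_isIrreducible hirr)
      (not_deg_of_not_isDegenerate hnd) hp hq hε
  obtain ⟨G, hG, hGδ, hGd⟩ := mem_residual.1 (hhits.and eventually_residual_ratIndep)
  refine ⟨G, hGδ, hGd, fun L hL => ?_⟩
  obtain ⟨h1, h2⟩ := hG hL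
  exact ⟨h2.pos L.2, topMixingOn_of_hits fun p q ε hp hq hε => h1 p q ε hp hq hε h2⟩

end IETPaper
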